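/- arXiv:1001.0094 — 4 statements merged into one kernel-verified Lean document; each statement's English description precedes it below -/
import Mathlib

section
/- Let X and Y be Polish spaces, (Ω,F,P) a probability space, μ a probability kernel from Ω to X, ν a probability kernel from Ω to Y, and c : Ω×X×Y → [0,∞) a function such that for each ω the map (x,y) ↦ c(ω,x,y) is continuous, for each (x,y) the map ω ↦ c(ω,x,y) is F-measurable, and E ∫_{X×Y} c(ω,x,y) μ_ω(dx) ν_ω(dy) < +∞. Then there exists a probability kernel π^opt ∈ K(μ,ν) such that C^stoch(c,μ,ν) = E ∫_{X×Y} c(ω,x,y) π^opt_ω(dx,dy) < +∞; that is, the infimum defining the stochastic Monge–Kantorovich cost is attained by a measurable family of couplings. -/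
open MeasureTheory ProbabilityTheory Filter ENNReal

/-- The stochastic Monge–Kantorovich cost: the infimum, over all probability kernels `π`
from `Ω` to `X × Y` whose marginal kernels are `μ` and `ν`, of
`E ∫ c(ω,x,y) π_ω(dx,dy)`. -/
noncomputable def stochCost {Ω X Y : Type*} [MeasurableSpace Ω] [MeasurableSpace X]
    [MeasurableSpace Y] (P : Measure Ω) (c : Ω → X → Y → ℝ)
    (μ : Kernel Ω X) (ν : Kernel Ω Y) : ℝ≥0∞ :=
  ⨅ π ∈ {π : Kernel Ω (X × Y) | IsMarkovKernel π ∧ π.fst = μ ∧ π.snd = ν},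
    ∫⁻ ω, ∫⁻ q, ENNReal.ofReal (c ω q.1 q.2) ∂(π ω) ∂P


open Topology

lemma hilbert_aux {H : Type*} [NormedAddCommGroup H] [InnerProductSpace ℝ H]
    (C : ℕ → Set H) (hanti : Antitone C) (hne : ∀ n, (C n).Nonempty) (R : ℝ)
    (hR : ∀ n, ∀ x ∈ C n, ‖x‖ ≤ R)
    (hmid : ∀ n, ∀ x ∈ C n, ∀ y ∈ C n, (2⁻¹ : ℝ) • (x + y) ∈ C n) :
    ∃ x : ℕ → H, (∀ n, x n ∈ C n) ∧ CauchySeq x := by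
  let S : ℕ → Set ℝ := fun n => (fun x : H => ‖x‖ ^ 2) '' C n
  let a : ℕ → ℝ := fun n => sInf (S n)
  have hbdd : ∀ n, BddBelow (S n) := by
    intro n
    refine ⟨0, ?_⟩
    rintro _ ⟨x, -, rfl⟩
    positivity
  have hSne : ∀ n, (S n).Nonempty := fun n => (hne n).image _
  have hale : ∀ n, ∀ x ∈ C n, a n ≤ ‖x‖ ^ 2 := fun n x hx => csInf_le (hbdd n) ⟨x, hx, rfl⟩
  have hmono : Monotone a := by
    intro n m hnm
    exact csInf_le_csInf (hbdd n) (hSne m) (Set.image_mono (hanti hnm))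
  have habove : BddAbove (Set.range a) := by
    refine ⟨R ^ 2, ?_⟩
    rintro _ ⟨n, rfl⟩
    obtain ⟨x, hx⟩ := hne n
    refine (hale n x hx).trans ?_
    have := hR n x hx
    have := norm_nonneg x
    gcongr
  have hlim := tendsto_atTop_ciSup hmono habove
  set A := ⨆ n, a n with hA
  have haA : ∀ n, a n ≤ A := fun n => le_ciSup habove n
  have hx : ∀ n : ℕ, ∃ x ∈ C n, ‖x‖ ^ 2 < a n + 1 / ((n : ℝ) + 1) := by
    intro n
    obtain ⟨_, ⟨x, hx, rfl⟩, h⟩ := exists_lt_of_csInf_lt (hSne n)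
      (show sInf (S n) < a n + 1 / ((n : ℝ) + 1) from lt_add_of_pos_right _ (by positivity))
    exact ⟨x, hx, h⟩
  choose x hxC hxa using hx
  refine ⟨x, hxC, ?_⟩
  refine cauchySeq_of_le_tendsto_0' (fun n => √(2 * (A - a n) + 4 * (1 / ((n : ℝ) + 1)))) ?_ ?_
  · intro n m hnm
    rw [dist_eq_norm]
    apply Real.le_sqrt_of_sq_le
    have h1 := hale n _ (hmid n _ (hxC n) _ (hanti hnm (hxC m)))
    rw [norm_smul, mul_pow] at h1
    norm_num at h1
    have h2 := parallelogram_law_with_norm_mul ℝ (x n) (x m)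
    have h3 := hxa n
    have h4 := hxa m
    have h5 : 1 / ((m : ℝ) + 1) ≤ 1 / ((n : ℝ) + 1) := by
      have : (n : ℝ) ≤ m := by exact_mod_cast hnm
      gcongr
    have := haA m
    nlinarith
  · have h1 : Tendsto (fun n : ℕ => 2 * (A - a n) + 4 * (1 / ((n : ℝ) + 1))) atTop
        (𝓝 (2 * (A - A) + 4 * 0)) :=
      ((tendsto_const_nhds.sub hlim).const_mul 2).add
        (tendsto_one_div_add_atTop_nhds_zero_nat.const_mul 4)
    have h2 := (Real.continuous_sqrt.tendsto _).comp h1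
    simpa [Function.comp_def] using h2

lemma exists_separating (E : Type*) [TopologicalSpace E] [PolishSpace E] [MeasurableSpace E]
    [BorelSpace E] : ∃ f : ℕ → BoundedContinuousFunction E NNReal, (∀ k x, f k x ≤ 1) ∧
      ∀ p q : ProbabilityMeasure E,
        (∀ k, ∫⁻ x, f k x ∂(p : Measure E) = ∫⁻ x, f k x ∂(q : Measure E)) → p = q := by
  obtain ⟨B, hBc, -, hB⟩ := TopologicalSpace.exists_countable_basis E
  have : Countable B := hBc
  let U : Finset B → Set E := fun s => ⋂ i ∈ s, (i : Set E)
  have hUo : ∀ s, IsOpen (U s) := fun s =>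
    isOpen_biInter_finset fun i _ => hB.isOpen i.2
  have hF : ∀ s, IsClosed (U s)ᶜ := fun s => (hUo s).isClosed_compl
  obtain ⟨g, hg⟩ := exists_surjective_nat (Finset B × ℕ)
  refine ⟨fun k => (hF (g k).1).apprSeq (g k).2, fun k x =>
    HasOuterApproxClosed.apprSeq_apply_le_one _ _ _, ?_⟩
  intro p q h
  have hclosed : ∀ s, (p : Measure E) (U s)ᶜ = (q : Measure E) (U s)ᶜ := by
    intro s
    refine tendsto_nhds_unique
      (HasOuterApproxClosed.tendsto_lintegral_apprSeq (hF s) (p : Measure E)) ?_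
    have h2 := HasOuterApproxClosed.tendsto_lintegral_apprSeq (hF s) (q : Measure E)
    refine h2.congr fun n => ?_
    obtain ⟨k, hk⟩ := hg (s, n)
    have h3 : ∫⁻ x, (hF (g k).1).apprSeq (g k).2 x ∂(p : Measure E)
        = ∫⁻ x, (hF (g k).1).apprSeq (g k).2 x ∂(q : Measure E) := h k
    rw [hk] at h3
    exact h3.symm
  have hopen : ∀ s, (p : Measure E) (U s) = (q : Measure E) (U s) := by
    intro s
    have h1 := prob_compl_eq_one_sub (μ := (p : Measure E)) (hF s).measurableSet
    have h2 := prob_compl_eq_one_sub (μ := (q : Measure E)) (hF s).measurableSet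
    rw [compl_compl] at h1 h2
    rw [h1, h2, hclosed]
  apply Subtype.ext
  classical
  have hfin : IsFiniteMeasure (p : Measure E) := inferInstance
  change (p : Measure E) = (q : Measure E)
  refine ext_of_generate_finite (Set.range U) ?_ ?_ ?_ (by simp)
  · rw [BorelSpace.measurable_eq (α := E), hB.borel_eq_generateFrom]
    apply le_antisymm
    · apply MeasurableSpace.generateFrom_mono
      intro b hb
      refine ⟨{⟨b, hb⟩}, ?_⟩
      simp only [U, Finset.mem_singleton, Set.iInter_iInter_eq_left]
    · apply MeasurableSpace.generateFrom_le
      rintro _ ⟨s, rfl⟩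
      exact Finset.measurableSet_biInter _ fun i _ => MeasurableSpace.measurableSet_generateFrom i.2
  · rintro _ ⟨s, rfl⟩ _ ⟨t, rfl⟩ -
    refine ⟨s ∪ t, ?_⟩
    simp only [U]
    ext x
    simp only [Set.mem_iInter, Finset.mem_union, Set.mem_inter_iff]
    grind
  · rintro _ ⟨s, rfl⟩
    exact hopen s

lemma continuous_toReal_lint {E : Type*} [TopologicalSpace E] [MeasurableSpace E]
    [OpensMeasurableSpace E] (f : BoundedContinuousFunction E NNReal) :
    Continuous (fun p : ProbabilityMeasure E => (∫⁻ x, f x ∂(p : Measure E)).toReal) := by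
  have := ProbabilityMeasure.continuous_testAgainstNN_eval (Ω := E) f
  exact NNReal.continuous_coe.comp this

lemma exists_limit {X Y : Type*}
    [TopologicalSpace X] [PolishSpace X] [MeasurableSpace X] [BorelSpace X]
    [TopologicalSpace Y] [PolishSpace Y] [MeasurableSpace Y] [BorelSpace Y]
    (f : ℕ → BoundedContinuousFunction (X × Y) NNReal)
    (hf : ∀ p q : ProbabilityMeasure (X × Y),
        (∀ k, ∫⁻ x, f k x ∂(p : Measure (X × Y)) = ∫⁻ x, f k x ∂(q : Measure (X × Y))) → p = q)
    (a : Measure X) (b : Measure Y) [IsProbabilityMeasure a] [IsProbabilityMeasure b]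
    (p : ℕ → ProbabilityMeasure (X × Y)) (ha : ∀ n, (p n : Measure (X × Y)).fst = a)
    (hb : ∀ n, (p n : Measure (X × Y)).snd = b)
    (hlim : ∀ k, ∃ l : ℝ, Tendsto (fun n => (∫⁻ x, f k x ∂(p n : Measure (X × Y))).toReal)
      atTop (𝓝 l)) :
    ∃ q, Tendsto p atTop (𝓝 q) := by
  have htight : IsTightMeasureSet
      {((μ : ProbabilityMeasure (X × Y)) : Measure (X × Y)) | μ ∈ Set.range p} := by
    rw [isTightMeasureSet_iff_exists_isCompact_measure_compl_le]
    intro ε hε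
    have hε2 : 0 < ε / 2 := ENNReal.half_pos hε.ne'
    obtain ⟨K, hK, hKa⟩ := isTightMeasureSet_iff_exists_isCompact_measure_compl_le.1
      (isTightMeasureSet_singleton (μ := a)) _ hε2
    obtain ⟨L, hL, hLb⟩ := isTightMeasureSet_iff_exists_isCompact_measure_compl_le.1
      (isTightMeasureSet_singleton (μ := b)) _ hε2
    refine ⟨K ×ˢ L, hK.prod hL, ?_⟩
    rintro _ ⟨_, ⟨n, rfl⟩, rfl⟩
    have hsub : (K ×ˢ L)ᶜ ⊆ (Prod.fst ⁻¹' Kᶜ) ∪ (Prod.snd ⁻¹' Lᶜ) := by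
      rintro ⟨x, y⟩ h
      simp only [Set.mem_compl_iff, Set.mem_prod, Set.mem_union, Set.mem_preimage] at h ⊢
      tauto
    calc (p n : Measure (X × Y)) (K ×ˢ L)ᶜ
        ≤ (p n : Measure (X × Y)) (Prod.fst ⁻¹' Kᶜ) + (p n : Measure (X × Y)) (Prod.snd ⁻¹' Lᶜ) :=
          (measure_mono hsub).trans (measure_union_le _ _)
      _ = a Kᶜ + b Lᶜ := by
          rw [← Measure.fst_apply hK.measurableSet.compl, ha,
            ← Measure.snd_apply hL.measurableSet.compl, hb]
      _ ≤ ε / 2 + ε / 2 := add_le_add (hKa a rfl) (hLb b rfl)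
      _ = ε := ENNReal.add_halves ε
  have hcomp := isCompact_closure_of_isTightMeasureSet htight
  have hmem : ∀ᶠ n in atTop, p n ∈ closure (Set.range p) :=
    Eventually.of_forall fun n => subset_closure ⟨n, rfl⟩
  obtain ⟨q, -, hq⟩ := hcomp.exists_mapClusterPt_of_frequently hmem.frequently
  choose l hl using hlim
  have key : ∀ q, MapClusterPt q atTop p → ∀ k,
      (∫⁻ x, f k x ∂(q : Measure (X × Y))).toReal = l k := by
    intro q hq k
    have h1 := hq.continuousAt_comp (continuous_toReal_lint (f k)).continuousAt
    have h2 : ClusterPt _ (𝓝 (l k)) := ClusterPt.mono h1 (hl k)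
    have := h2.neBot
    exact eq_of_nhds_neBot this
  refine ⟨q, hcomp.tendsto_nhds_of_unique_mapClusterPt hmem ?_⟩
  intro q' _ hq'
  apply hf
  intro k
  have hfin : ∀ r : ProbabilityMeasure (X × Y), ∫⁻ x, f k x ∂(r : Measure (X × Y)) ≠ ⊤ := by
    intro r
    exact (BoundedContinuousFunction.lintegral_lt_top_of_nnreal _ (f k)).ne
  rw [← ENNReal.toReal_eq_toReal_iff' (hfin _) (hfin _), key q' hq', key q hq]

/-- The probability measure attached to a point by a Markov kernel. -/
noncomputable def kpm {Ω E : Type*} [MeasurableSpace Ω] [MeasurableSpace E] (π : Kernel Ω E)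
    [IsMarkovKernel π] (ω : Ω) : ProbabilityMeasure E := ⟨π ω, inferInstance⟩

lemma measurable_limit {Ω E : Type*} [MeasurableSpace Ω] [TopologicalSpace E] [PolishSpace E]
    [MeasurableSpace E] [BorelSpace E] (π : ℕ → Kernel Ω E) [∀ n, IsMarkovKernel (π n)]
    (q : Ω → ProbabilityMeasure E)
    (h : ∀ ω, Tendsto (fun n => kpm (π n) ω) atTop (𝓝 (q ω))) :
    Measurable (fun ω => (q ω : Measure E)) := by
  refine Measurable.measure_of_isPiSystem_of_isProbabilityMeasure
    ((BorelSpace.measurable_eq (α := E)).trans borel_eq_generateFrom_isClosed)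
    isPiSystem_isClosed ?_
  intro F hF
  replace hF : IsClosed F := hF
  refine measurable_of_tendsto_metrizable (f := fun m ω => ∫⁻ x, hF.apprSeq m x ∂(q ω : Measure E))
    ?_ (tendsto_pi_nhds.2 fun ω =>
    HasOuterApproxClosed.tendsto_lintegral_apprSeq hF (q ω : Measure E))
  intro m
  refine measurable_of_tendsto_metrizable (f := fun n ω => ∫⁻ x, hF.apprSeq m x ∂(π n ω))
    ?_ (tendsto_pi_nhds.2 fun ω => ?_)
  · intro n
    exact Measurable.lintegral_kernel (by fun_prop)
  · exact (ProbabilityMeasure.tendsto_iff_forall_lintegral_tendsto.1 (h ω)) _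

/-- The midpoint of two kernels. -/
noncomputable def midKernel {Ω E : Type*} [MeasurableSpace Ω] [MeasurableSpace E]
    (π ρ : Kernel Ω E) : Kernel Ω E where
  toFun ω := (2⁻¹ : ℝ≥0∞) • (π ω + ρ ω)
  measurable' := by
    refine Measure.measurable_of_measurable_coe _ fun s hs => ?_
    simp only [Measure.smul_apply, Measure.add_apply, smul_eq_mul]
    exact ((π.measurable_coe hs).add (ρ.measurable_coe hs)).const_mul _

lemma midKernel_apply {Ω E : Type*} [MeasurableSpace Ω] [MeasurableSpace E]
    (π ρ : Kernel Ω E) (ω : Ω) : midKernel π ρ ω = (2⁻¹ : ℝ≥0∞) • (π ω + ρ ω) := rfl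

lemma half_add_self (a : ℝ≥0∞) : (2⁻¹ : ℝ≥0∞) * (a + a) = a := by
  rw [← two_mul, ← mul_assoc, ENNReal.inv_mul_cancel (by simp) (by simp), one_mul]

lemma midKernel_markov {Ω E : Type*} [MeasurableSpace Ω] [MeasurableSpace E]
    (π ρ : Kernel Ω E) [IsMarkovKernel π] [IsMarkovKernel ρ] : IsMarkovKernel (midKernel π ρ) := by
  refine ⟨fun ω => ⟨?_⟩⟩
  rw [midKernel_apply]
  simp only [Measure.smul_apply, Measure.add_apply, smul_eq_mul, measure_univ]
  exact half_add_self 1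

lemma midKernel_lintegral {Ω E : Type*} [MeasurableSpace Ω] [MeasurableSpace E]
    (π ρ : Kernel Ω E) (ω : Ω) (f : E → ℝ≥0∞) :
    ∫⁻ x, f x ∂(midKernel π ρ ω) = 2⁻¹ * (∫⁻ x, f x ∂(π ω) + ∫⁻ x, f x ∂(ρ ω)) := by
  rw [midKernel_apply, lintegral_smul_measure, lintegral_add_measure, smul_eq_mul]

lemma midKernel_fst {Ω X Y : Type*} [MeasurableSpace Ω] [MeasurableSpace X] [MeasurableSpace Y]
    (π ρ : Kernel Ω (X × Y)) (h : π.fst = ρ.fst) : (midKernel π ρ).fst = π.fst := by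
  ext ω s hs
  have h1 : π.fst ω s = ρ.fst ω s := by rw [h]
  rw [Kernel.fst_apply' _ _ hs, Kernel.fst_apply' _ _ hs] at h1
  rw [Kernel.fst_apply' _ _ hs, Kernel.fst_apply' _ _ hs, midKernel_apply]
  simp only [Measure.smul_apply, Measure.add_apply, smul_eq_mul]
  rw [← h1, half_add_self]

lemma midKernel_snd {Ω X Y : Type*} [MeasurableSpace Ω] [MeasurableSpace X] [MeasurableSpace Y]
    (π ρ : Kernel Ω (X × Y)) (h : π.snd = ρ.snd) : (midKernel π ρ).snd = π.snd := by
  ext ω s hs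
  have h1 : π.snd ω s = ρ.snd ω s := by rw [h]
  rw [Kernel.snd_apply' _ _ hs, Kernel.snd_apply' _ _ hs] at h1
  rw [Kernel.snd_apply' _ _ hs, Kernel.snd_apply' _ _ hs, midKernel_apply]
  simp only [Measure.smul_apply, Measure.add_apply, smul_eq_mul]
  rw [← h1, half_add_self]

/-- **Existence of a stochastic optimal transference plan.**
Let `X`, `Y` be Polish spaces, `(Ω, F, P)` a probability space, `μ` a probability kernel
from `Ω` to `X`, `ν` a probability kernel from `Ω` to `Y`, and `c : Ω × X × Y → [0,∞)`
such that `c(ω,·,·)` is continuous for each `ω`, `c(·,x,y)` is measurable for each `(x,y)`,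
and `E ∫ c(ω,x,y) μ_ω(dx) ν_ω(dy) < ∞`. Then there exists a probability kernel
`π ∈ K(μ,ν)` attaining the stochastic Monge–Kantorovich cost, which is finite. -/
theorem exists_stochastic_optimal_plan
    {Ω X Y : Type*} [MeasurableSpace Ω]
    [TopologicalSpace X] [PolishSpace X] [MeasurableSpace X] [BorelSpace X]
    [TopologicalSpace Y] [PolishSpace Y] [MeasurableSpace Y] [BorelSpace Y]
    (P : Measure Ω) [IsProbabilityMeasure P]
    (μ : Kernel Ω X) [IsMarkovKernel μ] (ν : Kernel Ω Y) [IsMarkovKernel ν]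
    (c : Ω → X → Y → ℝ)
    (hc_nonneg : ∀ ω x y, 0 ≤ c ω x y)
    (hc_cont : ∀ ω, Continuous (fun q : X × Y => c ω q.1 q.2))
    (hc_meas : ∀ x y, Measurable (fun ω => c ω x y))
    (hint : ∫⁻ ω, ∫⁻ q, ENNReal.ofReal (c ω q.1 q.2) ∂((μ ω).prod (ν ω)) ∂P < ⊤) :
    ∃ π : Kernel Ω (X × Y), IsMarkovKernel π ∧ π.fst = μ ∧ π.snd = ν ∧
      stochCost P c μ ν = ∫⁻ ω, ∫⁻ q, ENNReal.ofReal (c ω q.1 q.2) ∂(π ω) ∂P ∧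
      stochCost P c μ ν < ⊤ := by
  classical
  let J : Kernel Ω (X × Y) → ℝ≥0∞ := fun π =>
    ∫⁻ ω, ∫⁻ q, ENNReal.ofReal (c ω q.1 q.2) ∂(π ω) ∂P
  let K : Set (Kernel Ω (X × Y)) := {π | IsMarkovKernel π ∧ π.fst = μ ∧ π.snd = ν}
  have hcm : Measurable (fun z : Ω × (X × Y) => ENNReal.ofReal (c z.1 z.2.1 z.2.2)) := by
    have h1 := measurable_uncurry_of_continuous_of_measurable
      (u := fun (q : X × Y) (ω : Ω) => c ω q.1 q.2) hc_cont (fun q => hc_meas q.1 q.2)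
    exact (h1.comp measurable_swap).ennreal_ofReal
  have hJm : ∀ π : Kernel Ω (X × Y), IsMarkovKernel π →
      Measurable (fun ω => ∫⁻ q, ENNReal.ofReal (c ω q.1 q.2) ∂(π ω)) := by
    intro π hπ
    exact Measurable.lintegral_kernel_prod_right' hcm
  have hprodK : (μ ×ₖ ν) ∈ K :=
    ⟨inferInstance, Kernel.fst_prod _ _, Kernel.snd_prod _ _⟩
  set I := stochCost P c μ ν with hI
  have hIle : ∀ π ∈ K, I ≤ J π := fun π hπ => iInf₂_le π hπ
  have hItop : I < ⊤ := by
    refine (hIle _ hprodK).trans_lt ?_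
    simpa only [J, Kernel.prod_apply] using hint
  obtain ⟨f, hf1, hf⟩ := exists_separating (X × Y)
  let G : Kernel Ω (X × Y) → ℕ × Ω → ℝ := fun π z => (∫⁻ x, f z.1 x ∂(π z.2)).toReal
  have hfle : ∀ π ∈ K, ∀ k ω, ∫⁻ x, f k x ∂(π ω) ≤ 1 := by
    rintro π ⟨hπ, -⟩ k ω
    calc ∫⁻ x, f k x ∂(π ω) ≤ ∫⁻ x, 1 ∂(π ω) :=
          lintegral_mono fun x => ENNReal.coe_le_one_iff.2 (hf1 k x)
      _ = 1 := by simp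
  have hGm : ∀ π, Measurable (G π) := by
    intro π
    refine measurable_from_prod_countable_right fun k => ?_
    have : Measurable fun ω => ∫⁻ x, f k x ∂(π ω) := Measurable.lintegral_kernel (by fun_prop)
    exact this.ennreal_toReal
  have hGb : ∀ π ∈ K, ∀ z, ‖G π z‖ ≤ 1 := by
    intro π hπ z
    rw [Real.norm_eq_abs, abs_of_nonneg ENNReal.toReal_nonneg]
    exact ENNReal.toReal_le_of_le_ofReal zero_le_one (by simpa using hfle π hπ z.1 z.2)
  let m : Measure (ℕ × Ω) := (Measure.toFinite (Measure.count : Measure ℕ)).prod P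
  have hGL : ∀ π ∈ K, MemLp (G π) 2 m := fun π hπ =>
    MemLp.of_bound (hGm π).aestronglyMeasurable 1 (ae_of_all _ (hGb π hπ))
  let ε : ℕ → ℝ≥0∞ := fun n => ((n : ℝ≥0∞) + 1)⁻¹
  have hεanti : Antitone ε := by
    intro n k hnk
    simp only [ε]
    gcongr
  have hεpos : ∀ n, 0 < ε n := fun n => by simp [ε]
  have hεlim : Tendsto ε atTop (𝓝 0) := by
    have := (tendsto_add_atTop_iff_nat 1).2 ENNReal.tendsto_inv_nat_nhds_zero
    simpa [ε] using this
  let C : ℕ → Set (Lp ℝ 2 m) := fun n => {h | ∃ π ∈ K, J π ≤ I + ε n ∧ h =ᵐ[m] G π}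
  obtain ⟨h, hhC, hcau⟩ := hilbert_aux C
    (by
      rintro n k hnk h ⟨π, hπ, hJ, hh⟩
      exact ⟨π, hπ, hJ.trans (by gcongr; exact hεanti hnk), hh⟩)
    (by
      intro n
      have : I < I + ε n := ENNReal.lt_add_right hItop.ne (hεpos n).ne'
      obtain ⟨π, hπ, hlt⟩ : ∃ π ∈ K, J π < I + ε n := by
        by_contra! hcon
        exact absurd (le_iInf₂ (f := fun π (_ : π ∈ K) => J π) hcon) (not_le.2 this)
      exact ⟨(hGL π hπ).toLp, π, hπ, hlt.le, (hGL π hπ).coeFn_toLp⟩)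
    ((measureUnivNNReal m : ℝ) ^ (2 : ℝ≥0∞).toReal⁻¹ * 1)
    (by
      rintro n h ⟨π, hπ, -, hh⟩
      refine Lp.norm_le_of_ae_bound zero_le_one ?_
      filter_upwards [hh] with z hz
      rw [hz]
      exact hGb π hπ z)
    (by
      rintro n h ⟨π, hπ, hJ, hh⟩ h' ⟨π', hπ', hJ', hh'⟩
      have i1 := hπ.1
      have i2 := hπ'.1
      refine ⟨midKernel π π', ⟨midKernel_markov π π', ?_, ?_⟩, ?_, ?_⟩
      · rw [midKernel_fst _ _ (hπ.2.1.trans hπ'.2.1.symm), hπ.2.1]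
      · rw [midKernel_snd _ _ (hπ.2.2.trans hπ'.2.2.symm), hπ.2.2]
      · have : J (midKernel π π') = 2⁻¹ * (J π + J π') := by
          simp only [J, midKernel_lintegral]
          rw [lintegral_const_mul' _ _ (by simp), lintegral_add_left (hJm π i1)]
        rw [this]
        calc 2⁻¹ * (J π + J π') ≤ 2⁻¹ * ((I + ε n) + (I + ε n)) := by gcongr
          _ = I + ε n := half_add_self _
      · filter_upwards [hh, hh', Lp.coeFn_smul (2⁻¹ : ℝ) (h + h'), Lp.coeFn_add h h']
          with z h1 h2 h3 h4
        rw [h3, Pi.smul_apply, h4, Pi.add_apply, h1, h2]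
        simp only [G, midKernel_lintegral, smul_eq_mul]
        rw [ENNReal.toReal_mul, ENNReal.toReal_add
          ((hfle π hπ _ _).trans_lt one_lt_top).ne ((hfle π' hπ' _ _).trans_lt one_lt_top).ne]
        simp)
  choose π₀ hπ₀K hπ₀J hπ₀G using hhC
  obtain ⟨g, hg⟩ := cauchySeq_tendsto_of_complete hcau
  obtain ⟨ns, hns, hae⟩ := (tendstoInMeasure_of_tendsto_Lp hg).exists_seq_tendsto_ae
  have hae2 : ∀ᵐ z ∂m, ∃ l : ℝ, Tendsto (fun n => G (π₀ (ns n)) z) atTop (𝓝 l) := by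
    filter_upwards [hae, ae_all_iff.2 hπ₀G] with z h1 h2
    refine ⟨g z, h1.congr fun n => h2 _⟩
  have hae3 : ∀ᵐ ω ∂P, ∀ k, ∃ l : ℝ, Tendsto (fun n => G (π₀ (ns n)) (k, ω)) atTop (𝓝 l) := by
    rw [ae_all_iff]
    have h1 := Measure.ae_ae_of_ae_prod hae2
    rw [ae_toFinite] at h1
    simpa using h1
  obtain ⟨S, hSsub, hSm, hS0⟩ : ∃ S : Set Ω, (∀ ω ∈ S, ∀ k, ∃ l : ℝ,
      Tendsto (fun n => G (π₀ (ns n)) (k, ω)) atTop (𝓝 l)) ∧ MeasurableSet S ∧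
      ∀ᵐ ω ∂P, ω ∈ S := by
    obtain ⟨S, hS1, hS2, hS3⟩ := eventually_iff_exists_mem.1 hae3 |>.elim fun v hv => by
      obtain ⟨t, ht1, ht2, ht3⟩ := exists_measurable_superset_of_null (mem_ae_iff.1 hv.1)
      exact (⟨tᶜ, fun ω hω => hv.2 ω (by by_contra hh; exact hω (ht1 hh)), ht2.compl,
        by rw [ae_iff]; simpa using ht3⟩ : ∃ S : Set Ω, (∀ ω ∈ S, ∀ k, ∃ l : ℝ,
      Tendsto (fun n => G (π₀ (ns n)) (k, ω)) atTop (𝓝 l)) ∧ MeasurableSet S ∧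
      ∀ᵐ ω ∂P, ω ∈ S)
    exact ⟨S, hS1, hS2, hS3⟩
  have hmk : ∀ n, IsMarkovKernel (π₀ n) := fun n => (hπ₀K n).1
  let π₁ : ℕ → Kernel Ω (X × Y) := fun n => Kernel.piecewise hSm (π₀ (ns n)) (μ ×ₖ ν)
  have hmk1 : ∀ n, IsMarkovKernel (π₁ n) := fun n => Kernel.IsMarkovKernel.piecewise
  have hfst : ∀ n ω, (π₁ n ω).fst = μ ω := by
    intro n ω
    simp only [π₁, Kernel.piecewise_apply]
    split_ifs
    · rw [← (hπ₀K (ns n)).2.1]; rfl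
    · exact congrArg (fun κ : Kernel Ω X => κ ω) hprodK.2.1
  have hsnd : ∀ n ω, (π₁ n ω).snd = ν ω := by
    intro n ω
    simp only [π₁, Kernel.piecewise_apply]
    split_ifs
    · rw [← (hπ₀K (ns n)).2.2]; rfl
    · exact congrArg (fun κ : Kernel Ω Y => κ ω) hprodK.2.2
  have hex : ∀ ω, ∃ q, Tendsto (fun n => kpm (π₁ n) ω) atTop (𝓝 q) := by
    intro ω
    refine exists_limit f hf (μ ω) (ν ω) _ (fun n => hfst n ω) (fun n => hsnd n ω) ?_
    intro k
    by_cases hω : ω ∈ S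
    · obtain ⟨l, hl⟩ := hSsub ω hω k
      refine ⟨l, hl.congr fun n => ?_⟩
      simp [kpm, π₁, G, Kernel.piecewise_apply, hω]
    · refine ⟨(∫⁻ x, f k x ∂((μ ×ₖ ν) ω)).toReal, tendsto_const_nhds.congr fun n => ?_⟩
      simp [kpm, π₁, Kernel.piecewise_apply, hω]
  choose q hq using hex
  have hqm := measurable_limit π₁ q hq
  let π : Kernel Ω (X × Y) := ⟨fun ω => (q ω : Measure (X × Y)), hqm⟩
  have hπm : IsMarkovKernel π := ⟨fun ω => (q ω).2⟩
  have hπfst : π.fst = μ := by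
    ext1 ω
    have h1 := ProbabilityMeasure.tendsto_map_of_tendsto_of_continuous _ _ (hq ω)
      (continuous_fst (X := X) (Y := Y))
    have h2 : ∀ n, (kpm (π₁ n) ω).map (continuous_fst (X := X) (Y := Y)).measurable.aemeasurable
        = kpm μ ω := fun n => Subtype.ext (hfst n ω)
    simp only [h2] at h1
    have h3 := tendsto_nhds_unique tendsto_const_nhds h1
    exact (congrArg Subtype.val h3).symm
  have hπsnd : π.snd = ν := by
    ext1 ω
    have h1 := ProbabilityMeasure.tendsto_map_of_tendsto_of_continuous _ _ (hq ω)
      (continuous_snd (X := X) (Y := Y))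
    have h2 : ∀ n, (kpm (π₁ n) ω).map (continuous_snd (X := X) (Y := Y)).measurable.aemeasurable
        = kpm ν ω := fun n => Subtype.ext (hsnd n ω)
    simp only [h2] at h1
    have h3 := tendsto_nhds_unique tendsto_const_nhds h1
    exact (congrArg Subtype.val h3).symm
  refine ⟨π, hπm, hπfst, hπsnd, le_antisymm (hIle π ⟨hπm, hπfst, hπsnd⟩) ?_, hItop⟩
  have hlsc : ∀ ω, ∫⁻ q, ENNReal.ofReal (c ω q.1 q.2) ∂(π ω) ≤
      atTop.liminf (fun n => ∫⁻ q, ENNReal.ofReal (c ω q.1 q.2) ∂(π₁ n ω)) := by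
    intro ω
    refine lintegral_le_liminf_lintegral_of_forall_isOpen_measure_le_liminf_measure
      (hc_cont ω) (fun z => hc_nonneg ω z.1 z.2) fun U hU => ?_
    exact ProbabilityMeasure.le_liminf_measure_open_of_tendsto (hq ω) hU
  have hJ1 : ∀ n, ∫⁻ ω, ∫⁻ q, ENNReal.ofReal (c ω q.1 q.2) ∂(π₁ n ω) ∂P ≤ I + ε (ns n) := by
    intro n
    refine le_trans (le_of_eq ?_) (hπ₀J (ns n))
    refine lintegral_congr_ae ?_
    filter_upwards [hS0] with ω hω
    simp [π₁, Kernel.piecewise_apply, hω]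
  calc ∫⁻ ω, ∫⁻ q, ENNReal.ofReal (c ω q.1 q.2) ∂(π ω) ∂P
      ≤ ∫⁻ ω, atTop.liminf (fun n => ∫⁻ q, ENNReal.ofReal (c ω q.1 q.2) ∂(π₁ n ω)) ∂P :=
        lintegral_mono hlsc
    _ ≤ atTop.liminf (fun n => ∫⁻ ω, ∫⁻ q, ENNReal.ofReal (c ω q.1 q.2) ∂(π₁ n ω) ∂P) :=
        lintegral_liminf_le fun n => hJm _ (hmk1 n)
    _ ≤ atTop.liminf (fun n => I + ε (ns n)) := liminf_le_liminf (Eventually.of_forall hJ1)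
    _ = I := by
        have h1 : Tendsto (fun n => I + ε (ns n)) atTop (𝓝 (I + 0)) :=
          tendsto_const_nhds.add (hεlim.comp hns.tendsto_atTop)
        rw [add_zero] at h1
        exact h1.liminf_eq
end

section
/- Let X and Y be Polish spaces, (Ω,F,P) a probability space, μ a probability kernel from Ω to X, ν a probability kernel from Ω to Y, and c : Ω×X×Y → [0,∞) a function such that for each ω the map (x,y) ↦ c(ω,x,y) is continuous, for each (x,y) the map ω ↦ c(ω,x,y) is F-measurable, and E ∫_{X×Y} c(ω,x,y) μ_ω(dx) ν_ω(dy) < +∞. Then the map ω ↦ C^deter(c(ω,·,·), μ_ω, ν_ω), sending ω to the optimal transport cost between μ_ω and ν_ω with cost c(ω,·,·), is F-measurable. -/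
open MeasureTheory ProbabilityTheory Filter ENNReal

/-- The deterministic Monge–Kantorovich cost `C^deter(c,μ,ν)`: the infimum over all
couplings `π ∈ Π(μ,ν)` of `∫ c dπ`. -/
noncomputable def deterCost {X Y : Type*} [MeasurableSpace X] [MeasurableSpace Y]
    (c : X → Y → ℝ) (μ : Measure X) (ν : Measure Y) : ℝ≥0∞ :=
  ⨅ π ∈ {π : Measure (X × Y) | IsProbabilityMeasure π ∧ π.fst = μ ∧ π.snd = ν},
    ∫⁻ q, ENNReal.ofReal (c q.1 q.2) ∂π

open scoped NNReal Topology

section Glue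
set_option linter.unusedSectionVars false
variable {X Y E F : Type*} [MeasurableSpace X] [MeasurableSpace Y]
  [Fintype E] [MeasurableSpace E] [MeasurableSingletonClass E]
  [Fintype F] [MeasurableSpace F] [MeasurableSingletonClass F]

/-- glued coupling from a matrix -/
noncomputable def glue (μ : Measure X) (ν : Measure Y) (f : X → E) (g : Y → F)
    (p : E → F → ℝ≥0∞) : Measure (X × Y) :=
  ∑ s, ∑ t, (p s t * ((μ (f ⁻¹' {s}))⁻¹ * (ν (g ⁻¹' {t}))⁻¹)) •
    ((μ.prod ν).restrict ((f ⁻¹' {s}) ×ˢ (g ⁻¹' {t})))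

lemma glue_apply_prod (μ : Measure X) (ν : Measure Y) [IsProbabilityMeasure μ]
    [IsProbabilityMeasure ν] {f : X → E} {g : Y → F}
    (p : E → F → ℝ≥0∞) {S : Set X} {T : Set Y} (hS : MeasurableSet S) (hT : MeasurableSet T) :
    glue μ ν f g p (S ×ˢ T) = ∑ s, ∑ t, (p s t * ((μ (f ⁻¹' {s}))⁻¹ * (ν (g ⁻¹' {t}))⁻¹)) *
      (μ (S ∩ f ⁻¹' {s}) * ν (T ∩ g ⁻¹' {t})) := by
  simp only [glue, Measure.coe_finsetSum, Finset.sum_apply, Measure.smul_apply, smul_eq_mul]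
  refine Finset.sum_congr rfl fun s _ => Finset.sum_congr rfl fun t _ => ?_
  rw [Measure.restrict_apply (hS.prod hT), Set.prod_inter_prod, Measure.prod_prod]

lemma sum_fiber (μ : Measure X) {f : X → E} (hf : Measurable f) {S : Set X}
    (hS : MeasurableSet S) : ∑ s, μ (S ∩ f ⁻¹' {s}) = μ S := by
  have := (measure_biUnion_finset (μ := μ) (s := (Finset.univ : Finset E))
    (f := fun s => S ∩ f ⁻¹' {s}) ?_ ?_).symm
  · rw [this]; congr 1; ext x; simp
  · intro a _ b _ hab
    refine Set.disjoint_left.2 ?_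
    rintro x ⟨_, h1⟩ ⟨_, h2⟩
    exact hab (h1.symm.trans h2)
  · intro s _
    exact hS.inter (hf (measurableSet_singleton s))

lemma glue_fst (μ : Measure X) (ν : Measure Y) [IsProbabilityMeasure μ]
    [IsProbabilityMeasure ν] {f : X → E} {g : Y → F} (hf : Measurable f)
    (p : E → F → ℝ≥0∞) (h1 : ∀ s, ∑ t, p s t = μ (f ⁻¹' {s}))
    (h2 : ∀ t, ∑ s, p s t = ν (g ⁻¹' {t})) : (glue μ ν f g p).fst = μ := by
  ext S hS
  rw [Measure.fst_apply hS, ← Set.prod_univ, glue_apply_prod μ ν p hS .univ, ← sum_fiber μ hf hS]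
  refine Finset.sum_congr rfl fun s _ => ?_
  have key : ∀ t, (p s t * ((μ (f ⁻¹' {s}))⁻¹ * (ν (g ⁻¹' {t}))⁻¹)) *
      (μ (S ∩ f ⁻¹' {s}) * ν (Set.univ ∩ g ⁻¹' {t})) =
      p s t * ((μ (f ⁻¹' {s}))⁻¹ * μ (S ∩ f ⁻¹' {s})) := by
    intro t
    rw [Set.univ_inter]
    by_cases h : ν (g ⁻¹' {t}) = 0
    · have : p s t = 0 := by
        have := h2 t
        rw [h, Finset.sum_eq_zero_iff] at this
        exact this s (Finset.mem_univ _)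
      simp [this]
    · have := ENNReal.inv_mul_cancel h (measure_ne_top ν _)
      calc _ = p s t * ((μ (f ⁻¹' {s}))⁻¹ * μ (S ∩ f ⁻¹' {s})) *
              ((ν (g ⁻¹' {t}))⁻¹ * ν (g ⁻¹' {t})) := by ring
        _ = _ := by rw [this, mul_one]
  simp_rw [key]
  rw [← Finset.sum_mul, h1, ← mul_assoc]
  by_cases h : μ (f ⁻¹' {s}) = 0
  · rw [h, measure_mono_null Set.inter_subset_right h]; simp
  · rw [ENNReal.mul_inv_cancel h (measure_ne_top μ _), one_mul]

lemma glue_snd (μ : Measure X) (ν : Measure Y) [IsProbabilityMeasure μ]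
    [IsProbabilityMeasure ν] {f : X → E} {g : Y → F} (hg : Measurable g)
    (p : E → F → ℝ≥0∞) (h1 : ∀ s, ∑ t, p s t = μ (f ⁻¹' {s}))
    (h2 : ∀ t, ∑ s, p s t = ν (g ⁻¹' {t})) : (glue μ ν f g p).snd = ν := by
  ext S hS
  rw [Measure.snd_apply hS, ← Set.univ_prod, glue_apply_prod μ ν p .univ hS, ← sum_fiber ν hg hS,
    Finset.sum_comm]
  refine Finset.sum_congr rfl fun t _ => ?_
  have key : ∀ s, (p s t * ((μ (f ⁻¹' {s}))⁻¹ * (ν (g ⁻¹' {t}))⁻¹)) *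
      (μ (Set.univ ∩ f ⁻¹' {s}) * ν (S ∩ g ⁻¹' {t})) =
      p s t * ((ν (g ⁻¹' {t}))⁻¹ * ν (S ∩ g ⁻¹' {t})) := by
    intro s
    rw [Set.univ_inter]
    by_cases h : μ (f ⁻¹' {s}) = 0
    · have : p s t = 0 := by
        have := h1 s
        rw [h, Finset.sum_eq_zero_iff] at this
        exact this t (Finset.mem_univ _)
      simp [this]
    · have := ENNReal.inv_mul_cancel h (measure_ne_top μ _)
      calc _ = p s t * ((ν (g ⁻¹' {t}))⁻¹ * ν (S ∩ g ⁻¹' {t})) *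
              ((μ (f ⁻¹' {s}))⁻¹ * μ (f ⁻¹' {s})) := by ring
        _ = _ := by rw [this, mul_one]
  simp_rw [key]
  rw [← Finset.sum_mul, h2, ← mul_assoc]
  by_cases h : ν (g ⁻¹' {t}) = 0
  · rw [h, measure_mono_null Set.inter_subset_right h]; simp
  · rw [ENNReal.mul_inv_cancel h (measure_ne_top ν _), one_mul]

lemma glue_fiber (μ : Measure X) (ν : Measure Y) [IsProbabilityMeasure μ]
    [IsProbabilityMeasure ν] {f : X → E} {g : Y → F} (hf : Measurable f) (hg : Measurable g)
    (p : E → F → ℝ≥0∞) (h1 : ∀ s, ∑ t, p s t = μ (f ⁻¹' {s}))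
    (h2 : ∀ t, ∑ s, p s t = ν (g ⁻¹' {t})) (s : E) (t : F) :
    glue μ ν f g p ((f ⁻¹' {s}) ×ˢ (g ⁻¹' {t})) = p s t := by
  rw [glue_apply_prod μ ν p (hf (measurableSet_singleton s)) (hg (measurableSet_singleton t)),
    Finset.sum_eq_single s, Finset.sum_eq_single t]
  · rw [Set.inter_self, Set.inter_self]
    by_cases h : μ (f ⁻¹' {s}) = 0
    · have : p s t = 0 := by
        have := h1 s
        rw [h, Finset.sum_eq_zero_iff] at this
        exact this t (Finset.mem_univ _)
      simp [this]
    by_cases h' : ν (g ⁻¹' {t}) = 0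
    · have : p s t = 0 := by
        have := h2 t
        rw [h', Finset.sum_eq_zero_iff] at this
        exact this s (Finset.mem_univ _)
      simp [this]
    have e1 := ENNReal.inv_mul_cancel h (measure_ne_top μ _)
    have e2 := ENNReal.inv_mul_cancel h' (measure_ne_top ν _)
    calc _ = p s t * ((μ (f ⁻¹' {s}))⁻¹ * μ (f ⁻¹' {s})) *
              ((ν (g ⁻¹' {t}))⁻¹ * ν (g ⁻¹' {t})) := by ring
      _ = _ := by rw [e1, e2, mul_one, mul_one]
  · intro t' _ ht
    have : g ⁻¹' {t} ∩ g ⁻¹' {t'} = ∅ := by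
      ext y; simp only [Set.mem_inter_iff, Set.mem_preimage, Set.mem_singleton_iff,
        Set.mem_empty_iff_false, iff_false]
      rintro ⟨a, b⟩; exact ht (b.symm.trans a)
    rw [this]; simp
  · simp
  · intro t' _ ht
    have : f ⁻¹' {s} ∩ f ⁻¹' {t'} = ∅ := by
      ext y; simp only [Set.mem_inter_iff, Set.mem_preimage, Set.mem_singleton_iff,
        Set.mem_empty_iff_false, iff_false]
      rintro ⟨a, b⟩; exact ht (b.symm.trans a)
    rw [this]; simp
  · simp

lemma glue_map (π : Measure (X × Y)) [IsProbabilityMeasure π]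
    {f : X → E} {g : Y → F} (hf : Measurable f) (hg : Measurable g)
    (μ : Measure X) (ν : Measure Y) [IsProbabilityMeasure μ] [IsProbabilityMeasure ν]
    (h1 : ∀ s, ∑ t, π ((f ⁻¹' {s}) ×ˢ (g ⁻¹' {t})) = μ (f ⁻¹' {s}))
    (h2 : ∀ t, ∑ s, π ((f ⁻¹' {s}) ×ˢ (g ⁻¹' {t})) = ν (g ⁻¹' {t})) :
    (glue μ ν f g (fun s t => π ((f ⁻¹' {s}) ×ˢ (g ⁻¹' {t})))).map (Prod.map f g)
      = π.map (Prod.map f g) := by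
  refine Measure.ext_of_singleton ?_
  rintro ⟨s, t⟩
  have hm : Measurable (Prod.map f g) := hf.prodMap hg
  rw [Measure.map_apply hm (measurableSet_singleton _),
    Measure.map_apply hm (measurableSet_singleton _), ← Set.singleton_prod_singleton,
    Set.preimage_prod_map_prod]
  exact glue_fiber μ ν hf hg _ h1 h2 s t

lemma fiber_sums (π : Measure (X × Y)) 
    {f : X → E} {g : Y → F} (hf : Measurable f) (hg : Measurable g) :
    (∀ s, ∑ t, π ((f ⁻¹' {s}) ×ˢ (g ⁻¹' {t})) = π.fst (f ⁻¹' {s})) ∧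
    (∀ t, ∑ s, π ((f ⁻¹' {s}) ×ˢ (g ⁻¹' {t})) = π.snd (g ⁻¹' {t})) := by
  constructor
  · intro s
    have h := hf (measurableSet_singleton s)
    rw [Measure.fst_apply h, ← sum_fiber π (hg.comp measurable_snd) (measurable_fst h)]
    rfl
  · intro s
    have h := hg (measurableSet_singleton s)
    rw [Measure.snd_apply h, ← sum_fiber π (hf.comp measurable_fst) (measurable_snd h)]
    refine Finset.sum_congr rfl fun t _ => ?_
    rw [Set.inter_comm]; rfl

lemma lintegral_glue (μ : Measure X) (ν : Measure Y) (f : X → E) (g : Y → F)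
    (p : E → F → ℝ≥0∞) (k : X × Y → ℝ≥0∞) :
    ∫⁻ q, k q ∂(glue μ ν f g p) = ∑ s, ∑ t, p s t *
      (((μ (f ⁻¹' {s}))⁻¹ * (ν (g ⁻¹' {t}))⁻¹) *
        ∫⁻ q in (f ⁻¹' {s}) ×ˢ (g ⁻¹' {t}), k q ∂(μ.prod ν)) := by
  simp only [glue, lintegral_finsetSum_measure, lintegral_smul_measure, smul_eq_mul, mul_assoc]

end Glue

lemma exists_seq_basis (X : Type*) [TopologicalSpace X] [SecondCountableTopology X] :
    ∃ U : ℕ → Set X, (∀ n, IsOpen (U n)) ∧ ∀ x, ∀ u, IsOpen u → x ∈ u → ∃ n, x ∈ U n ∧ U n ⊆ u := by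
  have hb := TopologicalSpace.isBasis_countableBasis X
  have hc : (insert ∅ (TopologicalSpace.countableBasis X)).Countable :=
    (TopologicalSpace.countable_countableBasis X).insert _
  obtain ⟨U, hU⟩ := hc.exists_eq_range (Set.insert_nonempty _ _)
  refine ⟨U, fun n => ?_, fun x u hu hx => ?_⟩
  · have : U n ∈ insert ∅ (TopologicalSpace.countableBasis X) := hU ▸ Set.mem_range_self n
    rcases this with h | h
    · rw [h]; exact isOpen_empty
    · exact hb.isOpen h
  · obtain ⟨v, hv, hxv, hvu⟩ := hb.exists_subset_of_mem_open hx hu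
    have : v ∈ Set.range U := hU ▸ Set.mem_insert_of_mem _ hv
    obtain ⟨n, rfl⟩ := this
    exact ⟨n, hxv, hvu⟩

open Classical in
/-- code of a point with respect to the first n sets -/
noncomputable def codeMap {X : Type*} (U : ℕ → Set X) (n : ℕ) (x : X) : Fin n → Bool :=
  fun i => decide (x ∈ U i)

lemma measurable_codeMap {X : Type*} [MeasurableSpace X] {U : ℕ → Set X}
    (hU : ∀ n, MeasurableSet (U n)) (n : ℕ) : Measurable (codeMap U n) := by
  classical
  refine measurable_pi_lambda _ fun i => ?_
  refine measurable_to_bool ?_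
  convert hU i using 1
  ext x; simp [codeMap]

lemma tendsto_of_map_code {X Y : Type*}
    [TopologicalSpace X] [PolishSpace X] [MeasurableSpace X] [BorelSpace X]
    [TopologicalSpace Y] [PolishSpace Y] [MeasurableSpace Y] [BorelSpace Y]
    {U : ℕ → Set X} {V : ℕ → Set Y} (hUo : ∀ n, IsOpen (U n)) (hVo : ∀ n, IsOpen (V n))
    (hU : ∀ x, ∀ u, IsOpen u → x ∈ u → ∃ n, x ∈ U n ∧ U n ⊆ u)
    (hV : ∀ x, ∀ u, IsOpen u → x ∈ u → ∃ n, x ∈ V n ∧ V n ⊆ u)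
    (π : ProbabilityMeasure (X × Y)) (ρ : ℕ → ProbabilityMeasure (X × Y))
    (h : ∀ n, (ρ n : Measure (X × Y)).map (Prod.map (codeMap U n) (codeMap V n))
      = (π : Measure (X × Y)).map (Prod.map (codeMap U n) (codeMap V n))) :
    Tendsto ρ atTop (𝓝 π) := by
  have hm : ∀ n, Measurable (Prod.map (codeMap U n) (codeMap V n)) := fun n =>
    (measurable_codeMap (fun i => (hUo i).measurableSet) n).prodMap
      (measurable_codeMap (fun i => (hVo i).measurableSet) n)
  let S : Set (Set (X × Y)) := {s | ∃ m, ∃ T : Set ((Fin m → Bool) × (Fin m → Bool)),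
    s = (Prod.map (codeMap U m) (codeMap V m)) ⁻¹' T}
  have hmono : ∀ m n, m ≤ n → ∀ T : Set ((Fin m → Bool) × (Fin m → Bool)),
      ∃ T' : Set ((Fin n → Bool) × (Fin n → Bool)),
      (Prod.map (codeMap U m) (codeMap V m)) ⁻¹' T = (Prod.map (codeMap U n) (codeMap V n)) ⁻¹' T' := by
    intro m n hmn T
    refine ⟨{q | (fun i => q.1 (Fin.castLE hmn i), fun i => q.2 (Fin.castLE hmn i)) ∈ T}, ?_⟩
    rfl
  have hpi : IsPiSystem S := by
    rintro _ ⟨m, T, rfl⟩ _ ⟨n, T', rfl⟩ _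
    obtain ⟨A, hA⟩ := hmono m (max m n) (le_max_left _ _) T
    obtain ⟨B, hB⟩ := hmono n (max m n) (le_max_right _ _) T'
    exact ⟨max m n, A ∩ B, by rw [hA, hB, Set.preimage_inter]⟩
  refine hpi.tendsto_probabilityMeasure_of_tendsto_of_mem ?_ ?_ ?_
  · rintro _ ⟨m, T, rfl⟩
    exact hm m (Set.toFinite T).measurableSet
  · rintro u hu ⟨x, y⟩ hxy
    obtain ⟨a, b, ha, hb, hxa, hyb, hab⟩ := isOpen_prod_iff.1 hu x y hxy
    obtain ⟨i, hi, hia⟩ := hU x a ha hxa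
    obtain ⟨j, hj, hjb⟩ := hV y b hb hyb
    refine ⟨U i ×ˢ V j, ⟨max i j + 1, {q | q.1 ⟨i, by omega⟩ = true ∧ q.2 ⟨j, by omega⟩ = true}, ?_⟩,
      prod_mem_nhds ((hUo i).mem_nhds hi) ((hVo j).mem_nhds hj),
      (Set.prod_mono hia hjb).trans hab⟩
    ext q; simp [codeMap]
  · rintro _ ⟨m, T, rfl⟩
    refine tendsto_const_nhds.congr' ?_
    filter_upwards [eventually_ge_atTop m] with n hn
    obtain ⟨A, hA⟩ := hmono m n hn T
    rw [hA]
    have := congrArg (fun (κ : Measure _) => κ A) (h n)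
    simp only [Measure.map_apply (hm n) (Set.toFinite A).measurableSet] at this
    apply ENNReal.coe_injective
    simp only [ProbabilityMeasure.ennreal_coeFn_eq_coeFn_toMeasure]
    exact this.symm

lemma isCompact_couplings {X Y : Type*}
    [TopologicalSpace X] [PolishSpace X] [MeasurableSpace X] [BorelSpace X]
    [TopologicalSpace Y] [PolishSpace Y] [MeasurableSpace Y] [BorelSpace Y]
    (μ : Measure X) (ν : Measure Y) [IsProbabilityMeasure μ] [IsProbabilityMeasure ν] :
    IsCompact {π : ProbabilityMeasure (X × Y) | (π : Measure (X × Y)).fst = μ ∧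
      (π : Measure (X × Y)).snd = ν} := by
  set S := {π : ProbabilityMeasure (X × Y) | (π : Measure (X × Y)).fst = μ ∧
      (π : Measure (X × Y)).snd = ν} with hS
  have hcl : IsClosed S := by
    let μ' : ProbabilityMeasure X := ⟨μ, inferInstance⟩
    let ν' : ProbabilityMeasure Y := ⟨ν, inferInstance⟩
    have e : S = {π | π.map (continuous_fst (X := X) (Y := Y)).measurable.aemeasurable = μ'} ∩
        {π | π.map (continuous_snd (X := X) (Y := Y)).measurable.aemeasurable = ν'} := by
      ext π
      simp only [hS, Set.mem_ofPred_eq, Set.mem_inter_iff]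
      exact ⟨fun h => ⟨Subtype.ext h.1, Subtype.ext h.2⟩,
        fun h => ⟨congrArg Subtype.val h.1, congrArg Subtype.val h.2⟩⟩
    rw [e]
    exact (isClosed_eq (ProbabilityMeasure.continuous_map continuous_fst) continuous_const).inter
      (isClosed_eq (ProbabilityMeasure.continuous_map continuous_snd) continuous_const)
  rw [← hcl.closure_eq]
  refine isCompact_closure_of_isTightMeasureSet ?_
  rw [isTightMeasureSet_iff_exists_isCompact_measure_compl_le]
  intro ε hε
  obtain ⟨K, hK, hKμ⟩ := isTightMeasureSet_iff_exists_isCompact_measure_compl_le.1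
    (isTightMeasureSet_singleton (μ := μ)) (ε / 2) (ENNReal.half_pos hε.ne')
  obtain ⟨L, hL, hLν⟩ := isTightMeasureSet_iff_exists_isCompact_measure_compl_le.1
    (isTightMeasureSet_singleton (μ := ν)) (ε / 2) (ENNReal.half_pos hε.ne')
  refine ⟨K ×ˢ L, hK.prod hL, ?_⟩
  rintro _ ⟨π, ⟨h1, h2⟩, rfl⟩
  have hsub : (K ×ˢ L)ᶜ ⊆ Prod.fst ⁻¹' Kᶜ ∪ Prod.snd ⁻¹' Lᶜ := by
    rintro ⟨x, y⟩ hxy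
    by_cases hx : x ∈ K
    · right; intro hy; exact hxy ⟨hx, hy⟩
    · left; exact hx
  calc (π : Measure (X × Y)) (K ×ˢ L)ᶜ
      ≤ (π : Measure (X × Y)) (Prod.fst ⁻¹' Kᶜ ∪ Prod.snd ⁻¹' Lᶜ) := measure_mono hsub
    _ ≤ _ := measure_union_le _ _
    _ = μ Kᶜ + ν Lᶜ := by
      rw [← Measure.fst_apply hK.measurableSet.compl, ← Measure.snd_apply hL.measurableSet.compl,
        h1, h2]
    _ ≤ ε / 2 + ε / 2 := add_le_add (hKμ μ rfl) (hLν ν rfl)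
    _ = ε := ENNReal.add_halves ε

/-- bounded continuous nonnegative version of a function -/
noncomputable def bcfOf {Z : Type*} [TopologicalSpace Z] (k : Z → ℝ) (hk : Continuous k) (N : ℝ≥0)
    (hN : ∀ z, k z ≤ N) : BoundedContinuousFunction Z ℝ≥0 :=
  BoundedContinuousFunction.mkOfBound ⟨fun z => (k z).toNNReal, continuous_real_toNNReal.comp hk⟩ N
    (by
      intro x y
      have hx : (k x).toNNReal ≤ N := Real.toNNReal_le_iff_le_coe.2 (hN x)
      have hy : (k y).toNNReal ≤ N := Real.toNNReal_le_iff_le_coe.2 (hN y)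
      rw [NNReal.dist_eq]
      have h1 : (((k x).toNNReal : ℝ≥0) : ℝ) ≤ N := hx
      have h2 : (((k y).toNNReal : ℝ≥0) : ℝ) ≤ N := hy
      simp only [ContinuousMap.coe_mk]
      rw [abs_le]
      constructor <;> linarith [NNReal.coe_nonneg (k x).toNNReal, NNReal.coe_nonneg (k y).toNNReal])

lemma continuous_lint {Z : Type*} [TopologicalSpace Z] [MeasurableSpace Z] [OpensMeasurableSpace Z]
    (k : Z → ℝ) (hk : Continuous k) (N : ℝ≥0) (hN : ∀ z, k z ≤ N) :
    Continuous fun π : ProbabilityMeasure Z => ∫⁻ z, ENNReal.ofReal (k z) ∂(π : Measure Z) :=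
  ProbabilityMeasure.continuous_lintegral_boundedContinuousFunction (bcfOf k hk N hN)

lemma deterCost_eq_iSup {X Y : Type*}
    [TopologicalSpace X] [PolishSpace X] [MeasurableSpace X] [BorelSpace X]
    [TopologicalSpace Y] [PolishSpace Y] [MeasurableSpace Y] [BorelSpace Y]
    (μ : Measure X) (ν : Measure Y) [IsProbabilityMeasure μ] [IsProbabilityMeasure ν]
    (c : X → Y → ℝ) (hc : Continuous (fun q : X × Y => c q.1 q.2)) :
    deterCost c μ ν = ⨆ N : ℕ, deterCost (fun x y => min (c x y) N) μ ν := by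
  apply le_antisymm
  · refine le_of_forall_gt_imp_ge_of_dense fun s hs => ?_
    have hcN : ∀ N : ℕ, Continuous (fun q : X × Y => min (c q.1 q.2) (N : ℝ)) := fun N =>
      hc.min continuous_const
    have hcomp := isCompact_couplings μ ν
    let t : ℕ → Set (ProbabilityMeasure (X × Y)) := fun N =>
      {π | (π : Measure (X × Y)).fst = μ ∧ (π : Measure (X × Y)).snd = ν} ∩
      {π | ∫⁻ q, ENNReal.ofReal (min (c q.1 q.2) (N : ℝ)) ∂(π : Measure (X × Y)) ≤ s}
    have htcl : ∀ N, IsClosed (t N) := fun N => hcomp.isClosed.inter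
      (isClosed_le (continuous_lint _ (hcN N) N (fun z => min_le_right _ _)) continuous_const)
    have hne : (⋂ N, t N).Nonempty := by
      refine IsCompact.nonempty_iInter_of_sequence_nonempty_isCompact_isClosed t ?_ ?_
        (hcomp.inter_right (isClosed_le (continuous_lint _ (hcN 0) ((0 : ℕ) : ℝ≥0) (fun z => min_le_right _ _))
          continuous_const)) htcl
      · rintro N π ⟨h1, h2⟩
        refine ⟨h1, le_trans (lintegral_mono fun q => ?_) h2⟩
        refine ENNReal.ofReal_le_ofReal (min_le_min le_rfl ?_)
        push_cast; linarith
      · intro N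
        have hlt : deterCost (fun x y => min (c x y) (N : ℝ)) μ ν < s :=
          lt_of_le_of_lt (le_iSup (fun N : ℕ => deterCost (fun x y => min (c x y) N) μ ν) N) hs
        simp only [deterCost, iInf_lt_iff] at hlt
        obtain ⟨π, ⟨hp, h1, h2⟩, h3⟩ := hlt
        exact ⟨⟨π, hp⟩, ⟨h1, h2⟩, h3.le⟩
    obtain ⟨π, hπ⟩ := hne
    rw [Set.mem_iInter] at hπ
    refine (iInf₂_le (π : Measure (X × Y)) ⟨inferInstance, (hπ 0).1.1, (hπ 0).1.2⟩).trans ?_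
    have hsup : ∀ q : X × Y, ENNReal.ofReal (c q.1 q.2) =
        ⨆ N : ℕ, ENNReal.ofReal (min (c q.1 q.2) (N : ℝ)) := by
      intro q
      apply le_antisymm
      · obtain ⟨N, hN⟩ := exists_nat_ge (c q.1 q.2)
        refine le_iSup_of_le N ?_
        rw [min_eq_left hN]
      · exact iSup_le fun N => ENNReal.ofReal_le_ofReal (min_le_left _ _)
    simp_rw [hsup]
    rw [lintegral_iSup]
    · exact iSup_le fun N => (hπ N).2
    · exact fun N => ENNReal.measurable_ofReal.comp (hcN N).measurable
    · intro M N hMN q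
      refine ENNReal.ofReal_le_ofReal (min_le_min le_rfl ?_)
      exact_mod_cast hMN
  · refine iSup_le fun N => ?_
    refine iInf₂_mono fun π _ => lintegral_mono fun q => ?_
    exact ENNReal.ofReal_le_ofReal (min_le_left _ _)

/-- transport polytope sublevel sets are closed in the parameters -/
lemma isClosed_lp (E F : Type*) [Fintype E] [Fintype F] (r : ℝ≥0) :
    IsClosed {z : (E → ℝ≥0) × (F → ℝ≥0) × (E → F → ℝ≥0) |
      ∃ p : E → F → Set.Icc (0 : ℝ≥0) 1, (∀ s, ∑ t, (p s t : ℝ≥0) = z.1 s) ∧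
        (∀ t, ∑ s, (p s t : ℝ≥0) = z.2.1 t) ∧ ∑ s, ∑ t, (p s t : ℝ≥0) * z.2.2 s t ≤ r} := by
  let A : Set ((E → F → Set.Icc (0 : ℝ≥0) 1) × ((E → ℝ≥0) × (F → ℝ≥0) × (E → F → ℝ≥0))) :=
    {w | (∀ s, ∑ t, (w.1 s t : ℝ≥0) = w.2.1 s) ∧
        (∀ t, ∑ s, (w.1 s t : ℝ≥0) = w.2.2.1 t) ∧
        ∑ s, ∑ t, (w.1 s t : ℝ≥0) * w.2.2.2 s t ≤ r}
  have hA : IsClosed A := by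
    have h1 : IsClosed {w : (E → F → Set.Icc (0 : ℝ≥0) 1) ×
        ((E → ℝ≥0) × (F → ℝ≥0) × (E → F → ℝ≥0)) | ∀ s, ∑ t, (w.1 s t : ℝ≥0) = w.2.1 s} := by
      simp only [Set.ofPred_forall]
      exact isClosed_iInter fun s => isClosed_eq (by fun_prop) (by fun_prop)
    have h2 : IsClosed {w : (E → F → Set.Icc (0 : ℝ≥0) 1) ×
        ((E → ℝ≥0) × (F → ℝ≥0) × (E → F → ℝ≥0)) | ∀ t, ∑ s, (w.1 s t : ℝ≥0) = w.2.2.1 t} := by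
      simp only [Set.ofPred_forall]
      exact isClosed_iInter fun s => isClosed_eq (by fun_prop) (by fun_prop)
    have h3 : IsClosed {w : (E → F → Set.Icc (0 : ℝ≥0) 1) ×
        ((E → ℝ≥0) × (F → ℝ≥0) × (E → F → ℝ≥0)) |
        ∑ s, ∑ t, (w.1 s t : ℝ≥0) * w.2.2.2 s t ≤ r} :=
      isClosed_le (by fun_prop) (by fun_prop)
    exact h1.inter (h2.inter h3)
  have := isClosedMap_snd_of_compactSpace A hA
  convert this using 1
  ext z
  constructor
  · rintro ⟨p, hp⟩; exact ⟨(p, z), hp, rfl⟩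
  · rintro ⟨⟨p, z'⟩, hp, rfl⟩; exact ⟨p, hp⟩

lemma measurable_deterCost_bdd
    {Ω X Y : Type*} [MeasurableSpace Ω]
    [TopologicalSpace X] [PolishSpace X] [MeasurableSpace X] [BorelSpace X]
    [TopologicalSpace Y] [PolishSpace Y] [MeasurableSpace Y] [BorelSpace Y]
    (μ : Kernel Ω X) [IsMarkovKernel μ] (ν : Kernel Ω Y) [IsMarkovKernel ν]
    (c : Ω → X → Y → ℝ) (N : ℝ≥0) (hN : ∀ ω x y, c ω x y ≤ N)
    (hc_cont : ∀ ω, Continuous (fun q : X × Y => c ω q.1 q.2))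
    (hc_meas : ∀ x y, Measurable (fun ω => c ω x y)) :
    Measurable (fun ω => deterCost (c ω) (μ ω) (ν ω)) := by
  obtain ⟨U, hUo, hU⟩ := exists_seq_basis X
  obtain ⟨V, hVo, hV⟩ := exists_seq_basis Y
  have hf : ∀ n, Measurable (codeMap U n) := measurable_codeMap (fun i => (hUo i).measurableSet)
  have hg : ∀ n, Measurable (codeMap V n) := measurable_codeMap (fun i => (hVo i).measurableSet)
  let A : ∀ n, (Fin n → Bool) → Set X := fun n s => codeMap U n ⁻¹' {s}
  let B : ∀ n, (Fin n → Bool) → Set Y := fun n s => codeMap V n ⁻¹' {s}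
  have hA : ∀ n s, MeasurableSet (A n s) := fun n s => hf n (measurableSet_singleton s)
  have hB : ∀ n s, MeasurableSet (B n s) := fun n s => hg n (measurableSet_singleton s)
  let I : ∀ n, (Fin n → Bool) → (Fin n → Bool) → Ω → ℝ≥0∞ := fun n s t ω =>
    (((μ ω (A n s))⁻¹ * (ν ω (B n t))⁻¹) *
        ∫⁻ q in (A n s) ×ˢ (B n t), ENNReal.ofReal (c ω q.1 q.2) ∂((μ ω).prod (ν ω)))
  have hIm : ∀ n s t, Measurable (I n s t) := by
    intro n s t
    refine (((μ.measurable_coe (hA n s)).inv).mul ((ν.measurable_coe (hB n t)).inv)).mul ?_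
    have hjm : Measurable (Function.uncurry fun (q : X × Y) (ω : Ω) => c ω q.1 q.2) :=
      measurable_uncurry_of_continuous_of_measurable (fun ω => hc_cont ω)
        (fun q => hc_meas q.1 q.2)
    have hjm' : Measurable (fun z : Ω × (X × Y) => ENNReal.ofReal (c z.1 z.2.1 z.2.2)) :=
      ENNReal.measurable_ofReal.comp (hjm.comp measurable_swap)
    have := Measurable.lintegral_kernel_prod_right
      (κ := (μ ×ₖ ν).restrict ((hA n s).prod (hB n t)))
      (f := fun (ω : Ω) (q : X × Y) => ENNReal.ofReal (c ω q.1 q.2)) hjm'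
    simpa only [Kernel.restrict_apply, Kernel.prod_apply] using this
  have hIfin : ∀ n s t ω, I n s t ω ≤ N := by
    intro n s t ω
    have h1 : ∫⁻ q in (A n s) ×ˢ (B n t), ENNReal.ofReal (c ω q.1 q.2) ∂((μ ω).prod (ν ω))
        ≤ N * (μ ω (A n s) * ν ω (B n t)) := by
      calc _ ≤ ∫⁻ q in (A n s) ×ˢ (B n t), (N : ℝ≥0∞) ∂((μ ω).prod (ν ω)) := by
            refine lintegral_mono fun q => ?_
            exact ENNReal.ofReal_le_of_le_toReal (by simpa using hN ω q.1 q.2)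
        _ = _ := by rw [setLIntegral_const, Measure.prod_prod]
    calc I n s t ω ≤ ((μ ω (A n s))⁻¹ * (ν ω (B n t))⁻¹) * (N * (μ ω (A n s) * ν ω (B n t))) := by
          simp only [I]; gcongr
      _ = N * ((μ ω (A n s))⁻¹ * μ ω (A n s)) * ((ν ω (B n t))⁻¹ * ν ω (B n t)) := by ring
      _ ≤ N * 1 * 1 := by
          gcongr <;> exact ENNReal.inv_mul_le_one _
      _ = N := by simp
  let z : ∀ n, Ω → ((Fin n → Bool) → ℝ≥0) × ((Fin n → Bool) → ℝ≥0) ×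
      ((Fin n → Bool) → (Fin n → Bool) → ℝ≥0) := fun n ω =>
    (fun s => (μ ω (A n s)).toNNReal, fun t => (ν ω (B n t)).toNNReal,
      fun s t => (I n s t ω).toNNReal)
  have hz : ∀ n, Measurable (z n) := by
    intro n
    refine Measurable.prodMk ?_ (Measurable.prodMk ?_ ?_)
    · exact measurable_pi_lambda _ fun s => (μ.measurable_coe (hA n s)).ennreal_toNNReal
    · exact measurable_pi_lambda _ fun s => (ν.measurable_coe (hB n s)).ennreal_toNNReal
    · exact measurable_pi_lambda _ fun s => measurable_pi_lambda _ fun t =>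
        (hIm n s t).ennreal_toNNReal
  let T : ℕ → ℝ≥0 → Set Ω := fun n r => {ω |
      ∃ p : (Fin n → Bool) → (Fin n → Bool) → Set.Icc (0 : ℝ≥0) 1,
        (∀ s, ∑ t, (p s t : ℝ≥0) = (z n ω).1 s) ∧
        (∀ t, ∑ s, (p s t : ℝ≥0) = (z n ω).2.1 t) ∧
        ∑ s, ∑ t, (p s t : ℝ≥0) * (z n ω).2.2 s t ≤ r}
  have hT : ∀ n r, MeasurableSet (T n r) := fun n r =>
    hz n (isClosed_lp (Fin n → Bool) (Fin n → Bool) r).measurableSet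
  have hI' : ∀ n s t ω, ((I n s t ω).toNNReal : ℝ≥0∞) = I n s t ω := fun n s t ω =>
    ENNReal.coe_toNNReal (ne_top_of_le_ne_top ENNReal.coe_ne_top (hIfin n s t ω))
  refine measurable_of_Iio fun a => ?_
  have key : (fun ω => deterCost (c ω) (μ ω) (ν ω)) ⁻¹' Set.Iio a =
      ⋃ n : ℕ, ⋃ q : ℚ, ⋃ (_ : ((Real.toNNReal q : ℝ≥0) : ℝ≥0∞) < a), T n (Real.toNNReal q) := by
    ext ω
    simp only [Set.mem_preimage, Set.mem_Iio, Set.mem_iUnion]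
    constructor
    · intro h
      simp only [deterCost, iInf_lt_iff] at h
      obtain ⟨π, ⟨hp, h1, h2⟩, h3⟩ := h
      obtain ⟨q, -, hq1, hq2⟩ := ENNReal.lt_iff_exists_rat_btwn.1 h3
      have hs := fun n => fiber_sums π (hf n) (hg n)
      rw [h1, h2] at hs
      let P : ∀ n, (Fin n → Bool) → (Fin n → Bool) → ℝ≥0∞ := fun n s t => π (A n s ×ˢ B n t)
      have hg1 : ∀ n, (glue (μ ω) (ν ω) (codeMap U n) (codeMap V n) (P n)).fst = μ ω := fun n =>
        glue_fst _ _ (hf n) _ (hs n).1 (hs n).2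
      have hprob : ∀ n, IsProbabilityMeasure
          (glue (μ ω) (ν ω) (codeMap U n) (codeMap V n) (P n)) := fun n => ⟨by
        rw [← Measure.fst_univ, hg1 n, measure_univ]⟩
      have hlim := tendsto_of_map_code hUo hVo hU hV ⟨π, hp⟩
        (fun n => ⟨glue (μ ω) (ν ω) (codeMap U n) (codeMap V n) (P n), hprob n⟩)
        (fun n => glue_map π (hf n) (hg n) _ _ (hs n).1 (hs n).2)
      have hlim2 := ((continuous_lint _ (hc_cont ω) N (fun z => hN ω z.1 z.2)).tendsto _).comp hlim
      obtain ⟨n, hn⟩ := (hlim2.eventually (gt_mem_nhds hq1)).exists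
      refine ⟨n, q, hq2, ?_⟩
      have hP : ∀ s t, ((P n s t).toNNReal : ℝ≥0∞) = P n s t := fun s t =>
        ENNReal.coe_toNNReal (measure_ne_top π _)
      refine ⟨fun s t => ⟨(P n s t).toNNReal, zero_le, ?_⟩, ?_, ?_, ?_⟩
      · rw [← ENNReal.coe_le_coe, hP]; exact prob_le_one
      · intro s
        rw [← ENNReal.coe_inj]
        push_cast
        simp only [hP, z]
        rw [ENNReal.coe_toNNReal (measure_ne_top _ _)]
        exact (hs n).1 s
      · intro s
        rw [← ENNReal.coe_inj]
        push_cast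
        simp only [hP, z]
        rw [ENNReal.coe_toNNReal (measure_ne_top _ _)]
        exact (hs n).2 s
      · rw [← ENNReal.coe_le_coe]
        push_cast
        simp only [hP, z, hI']
        refine le_trans (le_of_eq ?_) hn.le
        exact (lintegral_glue _ _ _ _ _ _).symm
    · rintro ⟨n, q, hq, p, h1, h2, h3⟩
      have k1 : ∀ s, ∑ t, ((p s t : ℝ≥0) : ℝ≥0∞) = μ ω (A n s) := fun s => by
        have := congrArg (fun x : ℝ≥0 => (x : ℝ≥0∞)) (h1 s)
        push_cast at this
        simp only [z] at this
        rwa [ENNReal.coe_toNNReal (measure_ne_top _ _)] at this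
      have k2 : ∀ t, ∑ s, ((p s t : ℝ≥0) : ℝ≥0∞) = ν ω (B n t) := fun s => by
        have := congrArg (fun x : ℝ≥0 => (x : ℝ≥0∞)) (h2 s)
        push_cast at this
        simp only [z] at this
        rwa [ENNReal.coe_toNNReal (measure_ne_top _ _)] at this
      have e1 := glue_fst (μ ω) (ν ω) (hf n) _ k1 k2
      have e2 := glue_snd (μ ω) (ν ω) (hg n) _ k1 k2
      refine lt_of_le_of_lt (iInf₂_le (glue (μ ω) (ν ω) (codeMap U n) (codeMap V n)
        (fun s t => ((p s t : ℝ≥0) : ℝ≥0∞))) ⟨⟨by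
          rw [← Measure.fst_univ, e1, measure_univ]⟩, e1, e2⟩) (lt_of_le_of_lt ?_ hq)
      · rw [← ENNReal.coe_le_coe] at h3
        push_cast at h3
        simp only [z, hI'] at h3
        refine le_trans (le_of_eq ?_) h3
        exact lintegral_glue _ _ _ _ _ _
  rw [key]
  exact .iUnion fun n => .iUnion fun q => .iUnion fun _ => hT n _

/-- **Measurability of the ω-wise optimal transport cost.**
Under the assumptions of the stochastic Monge–Kantorovich problem, the map
`ω ↦ C^deter(c(ω,·,·), μ_ω, ν_ω)` is measurable. -/
theorem measurable_deterCost_omega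
    {Ω X Y : Type*} [MeasurableSpace Ω]
    [TopologicalSpace X] [PolishSpace X] [MeasurableSpace X] [BorelSpace X]
    [TopologicalSpace Y] [PolishSpace Y] [MeasurableSpace Y] [BorelSpace Y]
    (P : Measure Ω) [IsProbabilityMeasure P]
    (μ : Kernel Ω X) [IsMarkovKernel μ] (ν : Kernel Ω Y) [IsMarkovKernel ν]
    (c : Ω → X → Y → ℝ)
    (hc_nonneg : ∀ ω x y, 0 ≤ c ω x y)
    (hc_cont : ∀ ω, Continuous (fun q : X × Y => c ω q.1 q.2))
    (hc_meas : ∀ x y, Measurable (fun ω => c ω x y))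
    (hint : ∫⁻ ω, ∫⁻ q, ENNReal.ofReal (c ω q.1 q.2) ∂((μ ω).prod (ν ω)) ∂P < ⊤) :
    Measurable (fun ω => deterCost (c ω) (μ ω) (ν ω)) := by
  have h : (fun ω => deterCost (c ω) (μ ω) (ν ω)) = fun ω => ⨆ N : ℕ,
      deterCost (fun x y => min (c ω x y) N) (μ ω) (ν ω) :=
    funext fun ω => deterCost_eq_iSup _ _ _ (hc_cont ω)
  rw [h]
  refine Measurable.iSup fun N => ?_
  exact measurable_deterCost_bdd μ ν (fun ω x y => min (c ω x y) N) N
    (fun ω x y => min_le_right _ _) (fun ω => (hc_cont ω).min continuous_const)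
    (fun x y => (hc_meas x y).min measurable_const)
end

section
/- Let X and Y be Polish spaces, (Ω,F,P) a probability space, μ a probability kernel from Ω to X, ν a probability kernel from Ω to Y, and c : Ω×X×Y → [0,∞) a function such that for each ω the map (x,y) ↦ c(ω,x,y) is continuous, for each (x,y) the map ω ↦ c(ω,x,y) is F-measurable, and E ∫_{X×Y} c(ω,x,y) μ_ω(dx) ν_ω(dy) < +∞. Then C^stoch(c,μ,ν) = E( inf_{π ∈ Π(μ_ω,ν_ω)} ∫_{X×Y} c(ω,x,y) π(dx,dy) ), i.e. the stochastic Monge–Kantorovich cost equals the expectation of the ω-wise deterministic optimal transport cost. -/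
open MeasureTheory ProbabilityTheory Filter ENNReal

lemma aux_ui {Z : Type*} [MeasurableSpace Z] (ρ : Measure Z) (C : Z → ℝ≥0∞)
    (hC : Measurable C) (hfin : ∀ z, C z ≠ ⊤) (hint : ∫⁻ z, C z ∂ρ ≠ ⊤) (η : ℝ≥0∞) (hη : η ≠ 0) :
    ∃ δ : ℝ≥0∞, δ ≠ 0 ∧ ∀ u : Z → ℝ≥0∞, Measurable u → (∀ z, u z ≤ 1) → ∫⁻ z, u z ∂ρ ≤ δ →
      ∫⁻ z, C z * u z ∂ρ ≤ η := by
  have h1 : Tendsto (fun N : ℕ => ∫⁻ z, (C z - N) ∂ρ) atTop (nhds (∫⁻ z, 0 ∂ρ)) := by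
    refine tendsto_lintegral_of_dominated_convergence C (fun N => by fun_prop)
      (fun N => Eventually.of_forall fun z => tsub_le_self) hint (Eventually.of_forall fun z => ?_)
    obtain ⟨N, hN⟩ := ENNReal.exists_nat_gt (hfin z)
    refine tendsto_const_nhds.congr' ?_
    filter_upwards [eventually_ge_atTop N] with M hM
    rw [eq_comm, tsub_eq_zero_iff_le]
    exact hN.le.trans (by exact_mod_cast hM)
  simp only [lintegral_zero] at h1
  have hη2 : (0:ℝ≥0∞) < η / 2 := ENNReal.half_pos hη
  obtain ⟨N, hN⟩ := (h1.eventually (ge_mem_nhds hη2)).exists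
  refine ⟨η / 2 / N, ENNReal.div_ne_zero.2 ⟨hη2.ne', ENNReal.natCast_ne_top N⟩, ?_⟩
  intro u hu hu1 hud
  calc ∫⁻ z, C z * u z ∂ρ ≤ ∫⁻ z, ((C z - N) + N * u z) ∂ρ := by
        refine lintegral_mono fun z => ?_
        calc C z * u z ≤ ((C z - N) + N) * u z := by gcongr; exact le_tsub_add
          _ = (C z - N) * u z + N * u z := by ring
          _ ≤ (C z - N) * 1 + N * u z := by gcongr; exact hu1 z
          _ = _ := by rw [mul_one]
    _ = ∫⁻ z, (C z - N) ∂ρ + N * ∫⁻ z, u z ∂ρ := by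
        rw [lintegral_add_left (by fun_prop), lintegral_const_mul _ hu]
    _ ≤ η / 2 + N * (η / 2 / N) := by gcongr
    _ ≤ η / 2 + η / 2 := by gcongr; exact ENNReal.mul_div_le
    _ = η := ENNReal.add_halves η

/-- Normalise a density so that both marginal densities are at most one. -/
noncomputable def auxNorm {X Y : Type*} [MeasurableSpace X] [MeasurableSpace Y]
    (μ : Measure X) (ν : Measure Y) (f : X × Y → ℝ≥0∞) (p : X × Y) : ℝ≥0∞ :=
  f p / (max 1 (∫⁻ y, f (p.1, y) ∂ν) * max 1 (∫⁻ x, f (x, p.2) ∂μ))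

/-- Complete a sub-coupling density to a coupling density. -/
noncomputable def auxDens {X Y : Type*} [MeasurableSpace X] [MeasurableSpace Y]
    (μ : Measure X) (ν : Measure Y) (s : ℝ≥0∞) (g : X × Y → ℝ≥0∞) (p : X × Y) : ℝ≥0∞ :=
  s * g p + (1 - s * ∫⁻ y, g (p.1, y) ∂ν) * (1 - s * ∫⁻ x, g (x, p.2) ∂μ) /
    (1 - s * ∫⁻ x, ∫⁻ y, g (x, y) ∂ν ∂μ)

section meas
variable {Ω X Y : Type*} [MeasurableSpace Ω] [MeasurableSpace X] [MeasurableSpace Y]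
    (μ : Kernel Ω X) [IsMarkovKernel μ] (ν : Kernel Ω Y) [IsMarkovKernel ν]

lemma aux_meas1 (g : Ω → X × Y → ℝ≥0∞) (hg : Measurable (Function.uncurry g)) :
    Measurable (fun q : Ω × X => ∫⁻ y, g q.1 (q.2, y) ∂(ν q.1)) := by
  have : Measurable (fun q : (Ω × X) × Y => g q.1.1 (q.1.2, q.2)) :=
    hg.comp (g := Function.uncurry g) (f := fun q : (Ω × X) × Y => (q.1.1, (q.1.2, q.2)))
      (by fun_prop)
  exact Measurable.lintegral_kernel_prod_right (κ := ν.comap Prod.fst measurable_fst) this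

lemma aux_meas2 (g : Ω → X × Y → ℝ≥0∞) (hg : Measurable (Function.uncurry g)) :
    Measurable (fun q : Ω × Y => ∫⁻ x, g q.1 (x, q.2) ∂(μ q.1)) := by
  have : Measurable (fun q : (Ω × Y) × X => g q.1.1 (q.2, q.1.2)) :=
    hg.comp (g := Function.uncurry g) (f := fun q : (Ω × Y) × X => (q.1.1, (q.2, q.1.2)))
      (by fun_prop)
  exact Measurable.lintegral_kernel_prod_right (κ := μ.comap Prod.fst measurable_fst) this

lemma aux_meas3 (g : Ω → X × Y → ℝ≥0∞) (hg : Measurable (Function.uncurry g)) :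
    Measurable (fun ω : Ω => ∫⁻ x, ∫⁻ y, g ω (x, y) ∂(ν ω) ∂(μ ω)) :=
  Measurable.lintegral_kernel_prod_right (κ := μ) (aux_meas1 ν g hg)

lemma aux_norm_meas (g : Ω → X × Y → ℝ≥0∞) (hg : Measurable (Function.uncurry g)) :
    Measurable (Function.uncurry fun ω => auxNorm (μ ω) (ν ω) (g ω)) := by
  have h1 := (aux_meas1 ν g hg).comp
    (f := fun q : Ω × (X × Y) => (q.1, q.2.1)) (by fun_prop)
  have h2 := (aux_meas2 μ g hg).comp
    (f := fun q : Ω × (X × Y) => (q.1, q.2.2)) (by fun_prop)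
  exact hg.div ((measurable_const.max h1).mul (measurable_const.max h2))

lemma aux_dens_meas (s : ℝ≥0∞) (g : Ω → X × Y → ℝ≥0∞) (hg : Measurable (Function.uncurry g)) :
    Measurable (Function.uncurry fun ω => auxDens (μ ω) (ν ω) s (g ω)) := by
  have h1 := (aux_meas1 ν g hg).comp
    (f := fun q : Ω × (X × Y) => (q.1, q.2.1)) (by fun_prop)
  have h2 := (aux_meas2 μ g hg).comp
    (f := fun q : Ω × (X × Y) => (q.1, q.2.2)) (by fun_prop)
  have h3 := (aux_meas3 μ ν g hg).comp
    (f := fun q : Ω × (X × Y) => q.1) (by fun_prop)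
  exact (hg.const_mul s).add
    (((measurable_const.sub (h1.const_mul s)).mul (measurable_const.sub (h2.const_mul s))).div
      (measurable_const.sub (h3.const_mul s)))
end meas

set_option linter.unusedSectionVars false
section fixed
variable {X Y : Type*} [MeasurableSpace X] [MeasurableSpace Y]
    (μ : Measure X) [IsProbabilityMeasure μ] (ν : Measure Y) [IsProbabilityMeasure ν]

lemma aux_norm_le1 (f : X × Y → ℝ≥0∞) (hf : Measurable f) (x : X) :
    ∫⁻ y, auxNorm μ ν f (x, y) ∂ν ≤ 1 := by
  set M := max 1 (∫⁻ y, f (x, y) ∂ν) with hM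
  calc ∫⁻ y, auxNorm μ ν f (x, y) ∂ν ≤ ∫⁻ y, f (x, y) * M⁻¹ ∂ν := by
        refine lintegral_mono fun y => ?_
        rw [← ENNReal.div_eq_inv_mul.trans (mul_comm _ _)]
        refine ENNReal.div_le_div_left ?_ _
        exact le_mul_of_one_le_right' (le_max_left _ _)
    _ = (∫⁻ y, f (x, y) ∂ν) * M⁻¹ := lintegral_mul_const _ (by fun_prop)
    _ ≤ M * M⁻¹ := by gcongr; exact le_max_right _ _
    _ ≤ 1 := ENNReal.mul_inv_le_one M

lemma aux_norm_le2 (f : X × Y → ℝ≥0∞) (hf : Measurable f) (y : Y) :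
    ∫⁻ x, auxNorm μ ν f (x, y) ∂μ ≤ 1 := by
  set M := max 1 (∫⁻ x, f (x, y) ∂μ) with hM
  calc ∫⁻ x, auxNorm μ ν f (x, y) ∂μ ≤ ∫⁻ x, f (x, y) * M⁻¹ ∂μ := by
        refine lintegral_mono fun x => ?_
        rw [← ENNReal.div_eq_inv_mul.trans (mul_comm _ _)]
        refine ENNReal.div_le_div_left ?_ _
        exact le_mul_of_one_le_left' (le_max_left _ _)
    _ = (∫⁻ x, f (x, y) ∂μ) * M⁻¹ := lintegral_mul_const _ (by fun_prop)
    _ ≤ M * M⁻¹ := by gcongr; exact le_max_right _ _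
    _ ≤ 1 := ENNReal.mul_inv_le_one M

lemma aux_norm_eq (f : X × Y → ℝ≥0∞) (h1 : ∀ x, ∫⁻ y, f (x, y) ∂ν ≤ 1)
    (h2 : ∀ y, ∫⁻ x, f (x, y) ∂μ ≤ 1) : auxNorm μ ν f = f := by
  funext p
  simp [auxNorm, max_eq_left (h1 _), max_eq_left (h2 _)]


lemma aux_key (s : ℝ≥0∞) {a b : ℝ≥0∞} (ha : a ≤ 1) (hb : b ≤ 1) (hs : s < 1) :
    s * a + (1 - s * a) * (1 - s * b) / (1 - s * b) = 1 := by
  have hb' : s * b < 1 := lt_of_le_of_lt (mul_le_of_le_one_right' hb) hs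
  have ha' : s * a ≤ 1 := (mul_le_of_le_one_right' ha).trans hs.le
  rw [ENNReal.mul_div_cancel_right (tsub_pos_of_lt hb').ne' (ne_top_of_le_ne_top one_ne_top tsub_le_self)]
  exact add_tsub_cancel_of_le ha'

lemma aux_dens_marg1 (s : ℝ≥0∞) (hs : s < 1) (g : X × Y → ℝ≥0∞) (hg : Measurable g)
    (h1 : ∀ x, ∫⁻ y, g (x, y) ∂ν ≤ 1) (h2 : ∀ y, ∫⁻ x, g (x, y) ∂μ ≤ 1)
    (x : X) : ∫⁻ y, auxDens μ ν s g (x, y) ∂ν = 1 := by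
  have hm : ∫⁻ x, ∫⁻ y, g (x, y) ∂ν ∂μ ≤ 1 := by
    calc _ ≤ ∫⁻ x, 1 ∂μ := lintegral_mono h1
      _ = 1 := by simp
  have hsw : ∫⁻ x, ∫⁻ y, g (x, y) ∂ν ∂μ = ∫⁻ y, ∫⁻ x, g (x, y) ∂μ ∂ν :=
    lintegral_lintegral_swap hg.aemeasurable
  have hmg2 : Measurable fun y => ∫⁻ x, g (x, y) ∂μ := hg.lintegral_prod_left'
  have hsub : ∫⁻ y, (1 - s * ∫⁻ x, g (x, y) ∂μ) ∂ν = 1 - s * ∫⁻ x, ∫⁻ y, g (x, y) ∂ν ∂μ := by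
    rw [lintegral_sub (by fun_prop), lintegral_const_mul _ hmg2, hsw]
    · simp
    · rw [lintegral_const_mul _ hmg2, ← hsw]
      exact (lt_of_le_of_lt (mul_le_of_le_one_right' hm) (hs.trans one_lt_top)).ne
    · exact Eventually.of_forall fun y => (mul_le_of_le_one_right' (h2 y)).trans hs.le
  simp only [auxDens, div_eq_mul_inv]
  rw [lintegral_add_left (by fun_prop), lintegral_const_mul _ (by fun_prop),
    lintegral_mul_const _ (by fun_prop), lintegral_const_mul _ (by fun_prop), hsub,
    ← div_eq_mul_inv]
  exact aux_key s (h1 x) hm hs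

lemma aux_dens_marg2 (s : ℝ≥0∞) (hs : s < 1) (g : X × Y → ℝ≥0∞) (hg : Measurable g)
    (h1 : ∀ x, ∫⁻ y, g (x, y) ∂ν ≤ 1) (h2 : ∀ y, ∫⁻ x, g (x, y) ∂μ ≤ 1)
    (y : Y) : ∫⁻ x, auxDens μ ν s g (x, y) ∂μ = 1 := by
  have hm : ∫⁻ x, ∫⁻ y, g (x, y) ∂ν ∂μ ≤ 1 := by
    calc _ ≤ ∫⁻ x, 1 ∂μ := lintegral_mono h1
      _ = 1 := by simp
  have hmg1 : Measurable fun x => ∫⁻ y, g (x, y) ∂ν := hg.lintegral_prod_right'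
  have hsub : ∫⁻ x, (1 - s * ∫⁻ y, g (x, y) ∂ν) ∂μ = 1 - s * ∫⁻ x, ∫⁻ y, g (x, y) ∂ν ∂μ := by
    rw [lintegral_sub (by fun_prop), lintegral_const_mul _ hmg1]
    · simp
    · rw [lintegral_const_mul _ hmg1]
      exact (lt_of_le_of_lt (mul_le_of_le_one_right' hm) (hs.trans one_lt_top)).ne
    · exact Eventually.of_forall fun y => (mul_le_of_le_one_right' (h1 y)).trans hs.le
  simp only [auxDens, div_eq_mul_inv]
  rw [lintegral_add_left (by fun_prop), lintegral_const_mul _ (by fun_prop),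
    lintegral_mul_const _ (by fun_prop), lintegral_mul_const _ (by fun_prop), hsub,
    mul_comm (1 - s * ∫⁻ x, ∫⁻ y, g (x, y) ∂ν ∂μ) _, ← div_eq_mul_inv]
  exact aux_key s (h2 y) hm hs

/-- A density with unit marginals yields a coupling. -/
lemma aux_coupling (h : X × Y → ℝ≥0∞) (hh : Measurable h)
    (hh1 : ∀ x, ∫⁻ y, h (x, y) ∂ν = 1) (hh2 : ∀ y, ∫⁻ x, h (x, y) ∂μ = 1) :
    ((μ.prod ν).withDensity h).fst = μ ∧ ((μ.prod ν).withDensity h).snd = ν := by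
  constructor
  · ext A hA
    rw [Measure.fst_apply hA, withDensity_apply _ (measurable_fst hA), ← Set.prod_univ,
      ← Measure.prod_restrict, lintegral_prod _ hh.aemeasurable]
    simp [hh1]
  · ext A hA
    rw [Measure.snd_apply hA, withDensity_apply _ (measurable_snd hA), ← Set.univ_prod,
      ← Measure.prod_restrict, lintegral_prod_symm _ hh.aemeasurable]
    simp [hh2]

lemma aux_cost (s : ℝ≥0∞) (hs : s < 1) (g : X × Y → ℝ≥0∞) (hg : Measurable g)
    (h1 : ∀ x, ∫⁻ y, g (x, y) ∂ν ≤ 1) (h2 : ∀ y, ∫⁻ x, g (x, y) ∂μ ≤ 1)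
    (e : ℝ≥0∞) (he : s + e = 1) (C : X × Y → ℝ≥0∞) (hC : Measurable C) :
    ∫⁻ p, C p * auxDens μ ν s g p ∂(μ.prod ν) ≤
      ∫⁻ p, C p * g p ∂(μ.prod ν) + e * ∫⁻ p, C p ∂(μ.prod ν) +
       2 / e * (∫⁻ p, C p * (1 - ∫⁻ y, g (p.1, y) ∂ν) ∂(μ.prod ν) +
        ∫⁻ p, C p * (1 - ∫⁻ x, g (x, p.2) ∂μ) ∂(μ.prod ν)) := by
  have hm : ∫⁻ x, ∫⁻ y, g (x, y) ∂ν ∂μ ≤ 1 := by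
    calc _ ≤ ∫⁻ x, 1 ∂μ := lintegral_mono h1
      _ = 1 := by simp
  have hmg1 : Measurable fun x => ∫⁻ y, g (x, y) ∂ν := hg.lintegral_prod_right'
  have hmg2 : Measurable fun y => ∫⁻ x, g (x, y) ∂μ := hg.lintegral_prod_left'
  have he1 : e ≤ 1 := he ▸ le_add_self
  have he0 : e ≠ 0 := by rintro rfl; simp at he; exact hs.ne he
  have hetop : e ≠ ⊤ := ne_top_of_le_ne_top one_ne_top he1
  have key : ∀ a : ℝ≥0∞, 1 - s * a ≤ e + (1 - a) := by
    intro a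
    rw [tsub_le_iff_right]
    calc (1 : ℝ≥0∞) = e + s * 1 := by rw [mul_one, add_comm, he]
      _ ≤ e + s * ((1 - a) + a) := by gcongr; exact le_tsub_add
      _ = e + s * (1 - a) + s * a := by ring
      _ ≤ e + 1 * (1 - a) + s * a := by gcongr
      _ = _ := by rw [one_mul]
  have hden : e ≤ 1 - s * ∫⁻ x, ∫⁻ y, g (x, y) ∂ν ∂μ := by
    refine ENNReal.le_sub_of_add_le_right
      (lt_of_le_of_lt (mul_le_of_le_one_right' hm) (hs.trans one_lt_top)).ne ?_
    calc _ ≤ e + s * 1 := by gcongr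
      _ = 1 := by rw [mul_one, add_comm, he]
  have hmul : ∀ a b : ℝ≥0∞, a ≤ 1 → b ≤ 1 → (e + a) * (e + b) / e ≤ e + 2 / e * (a + b) := by
    intro a b ha hb
    have : (e + a) * (e + b) ≤ e * e + 2 * (a + b) := by
      calc (e + a) * (e + b) = e * e + (e * b + a * e + a * b) := by ring
        _ ≤ e * e + (1 * b + a * 1 + a * 1) := by gcongr
        _ ≤ e * e + (1 * b + a * 1 + a * 1) + b := le_self_add
        _ = _ := by ring
    calc (e + a) * (e + b) / e ≤ (e * e + 2 * (a + b)) / e := by gcongr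
      _ = e * e / e + 2 * (a + b) / e := ENNReal.add_div
      _ = e + 2 / e * (a + b) := by
        rw [ENNReal.mul_div_cancel_right he0 hetop]
        congr 1
        simp only [div_eq_mul_inv]; ring
  have hpt : ∀ p, C p * auxDens μ ν s g p ≤ C p * g p + e * C p +
      (2 / e * (C p * (1 - ∫⁻ y, g (p.1, y) ∂ν)) + 2 / e * (C p * (1 - ∫⁻ x, g (x, p.2) ∂μ))) := by
    intro p
    have : auxDens μ ν s g p ≤ g p + (e + 2 / e * ((1 - ∫⁻ y, g (p.1, y) ∂ν) +
        (1 - ∫⁻ x, g (x, p.2) ∂μ))) := by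
      unfold auxDens
      refine add_le_add (mul_le_of_le_one_left' hs.le) ?_
      refine le_trans ?_ (hmul _ _ tsub_le_self tsub_le_self)
      exact ENNReal.div_le_div (mul_le_mul' (key _) (key _)) hden
    exact (mul_le_mul' le_rfl this).trans (le_of_eq (by ring))
  refine (lintegral_mono hpt).trans (le_of_eq ?_)
  rw [lintegral_add_left (by fun_prop), lintegral_add_left (by fun_prop),
    lintegral_add_left (by fun_prop), lintegral_const_mul _ hC,
    lintegral_const_mul _ (by fun_prop), lintegral_const_mul _ (by fun_prop), mul_add]
end fixed

open Classical in
/-- The membership pattern of a point with respect to the first `n` sets of a sequence. -/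
noncomputable def auxCell {X : Type*} (t : ℕ → Set X) (n : ℕ) (x : X) : Fin n → Bool :=
  fun i => decide (x ∈ t i)

lemma aux_cell_meas {X : Type*} [MeasurableSpace X] (t : ℕ → Set X)
    (ht : ∀ k, MeasurableSet (t k)) (n : ℕ) : Measurable (auxCell t n) := by
  refine measurable_pi_lambda _ fun i => ?_
  refine measurable_to_bool ?_
  have : (fun x => auxCell t n x i) ⁻¹' {true} = t i := by
    ext x; simp [auxCell]
  rw [this]; exact ht i

lemma aux_cell_mem {X : Type*} (t : ℕ → Set X) {n k : ℕ} (hk : k < n) {x x' : X}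
    (h : auxCell t n x' = auxCell t n x) (hx : x ∈ t k) : x' ∈ t k := by
  have := congrFun h ⟨k, hk⟩
  simpa [auxCell, hx] using this

/-- The countable family of step densities. -/
noncomputable def auxF {X Y : Type*} (t : ℕ → Set X) (u : ℕ → Set Y) (n K : ℕ)
    (q : (Fin n → Bool) → (Fin n → Bool) → ℕ) (p : X × Y) : ℝ≥0∞ :=
  (q (auxCell t n p.1) (auxCell u n p.2) : ℝ≥0∞) / ((K : ℝ≥0∞) + 1)

lemma aux_F_meas {X Y : Type*} [MeasurableSpace X] [MeasurableSpace Y] (t : ℕ → Set X)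
    (ht : ∀ k, MeasurableSet (t k)) (u : ℕ → Set Y) (hu : ∀ k, MeasurableSet (u k)) (n K : ℕ)
    (q : (Fin n → Bool) → (Fin n → Bool) → ℕ) : Measurable (auxF t u n K q) := by
  have h : Measurable fun p : X × Y => (auxCell t n p.1, auxCell u n p.2) :=
    ((aux_cell_meas t ht n).comp measurable_fst).prodMk ((aux_cell_meas u hu n).comp measurable_snd)
  exact (measurable_of_countable
    (fun s : (Fin n → Bool) × (Fin n → Bool) => (q s.1 s.2 : ℝ≥0∞) / ((K : ℝ≥0∞) + 1))).comp h

lemma aux_sum {Z S : Type*} [MeasurableSpace Z] [Fintype S] [MeasurableSpace S]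
    [MeasurableSingletonClass S] (χ : Z → S) (hχ : Measurable χ) (ρ : Measure Z)
    (F : Z → ℝ≥0∞) : ∫⁻ z, F z ∂ρ = ∑ s, ∫⁻ z in χ ⁻¹' {s}, F z ∂ρ := by
  have hU : (⋃ s, χ ⁻¹' {s}) = Set.univ := by ext z; simp
  rw [← setLIntegral_univ, ← hU, lintegral_iUnion (fun s => hχ (measurableSet_singleton s)),
    tsum_fintype]
  intro a b hab
  refine Set.disjoint_left.2 fun z hz hz' => hab ?_
  simp only [Set.mem_preimage, Set.mem_singleton_iff] at hz hz'
  rw [← hz, ← hz']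

lemma aux_row {Z S : Type*} [MeasurableSpace Z] [Fintype S] [MeasurableSpace S]
    [MeasurableSingletonClass S] (χ : Z → S) (hχ : Measurable χ) (ρ : Measure Z)
    (v : S → ℝ≥0∞) : ∫⁻ z, v (χ z) ∂ρ = ∑ s, v s * ρ (χ ⁻¹' {s}) := by
  rw [aux_sum χ hχ]
  refine Finset.sum_congr rfl fun s _ => ?_
  rw [← setLIntegral_const]
  refine setLIntegral_congr_fun (hχ (measurableSet_singleton s)) fun z hz => ?_
  simp only [Set.mem_preimage, Set.mem_singleton_iff] at hz
  simp only [hz]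

lemma aux_measure {Z S : Type*} [MeasurableSpace Z] [Fintype S] [MeasurableSpace S]
    [MeasurableSingletonClass S] (χ : Z → S) (hχ : Measurable χ) (ρ : Measure Z)
    (A : Set Z) (hA : MeasurableSet A) : ∑ s, ρ (A ∩ χ ⁻¹' {s}) = ρ A := by
  have := aux_sum χ hχ ρ (A.indicator 1)
  rw [lintegral_indicator_one hA] at this
  rw [this]
  refine Finset.sum_congr rfl fun s _ => ?_
  rw [lintegral_indicator_one hA, Measure.restrict_apply hA]

open Classical in
lemma aux_disc {X Y : Type*}
    [TopologicalSpace X] [MeasurableSpace X] [OpensMeasurableSpace X]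
    [TopologicalSpace Y] [MeasurableSpace Y] [OpensMeasurableSpace Y]
    (t : ℕ → Set X) (ht : ∀ k, IsOpen (t k))
    (htb : ∀ x, ∀ U : Set X, IsOpen U → x ∈ U → ∃ k, x ∈ t k ∧ t k ⊆ U)
    (u : ℕ → Set Y) (hu : ∀ k, IsOpen (u k))
    (hub : ∀ x, ∀ U : Set Y, IsOpen U → x ∈ U → ∃ k, x ∈ u k ∧ u k ⊆ U)
    (μ : Measure X) [IsProbabilityMeasure μ] (ν : Measure Y) [IsProbabilityMeasure ν]
    (π : Measure (X × Y)) [IsProbabilityMeasure π] (hπ1 : π.fst = μ) (hπ2 : π.snd = ν)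
    (C : X × Y → ℝ≥0∞) (hC : Continuous C) (hCm : Measurable C) (hfin : ∀ p, C p ≠ ⊤)
    (η δ : ℝ≥0∞) (hη : η ≠ 0) (hδ : δ ≠ 0) :
    ∃ n K q, (∀ x, ∫⁻ y, auxF t u n K q (x, y) ∂ν ≤ 1) ∧ (∀ y, ∫⁻ x, auxF t u n K q (x, y) ∂μ ≤ 1) ∧
      ∫⁻ p, C p * auxF t u n K q p ∂(μ.prod ν) ≤ ∫⁻ p, C p ∂π + η ∧
      1 ≤ ∫⁻ p, auxF t u n K q p ∂(μ.prod ν) + δ := by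
  have htm : ∀ k, MeasurableSet (t k) := fun k => (ht k).measurableSet
  have hum : ∀ k, MeasurableSet (u k) := fun k => (hu k).measurableSet
  let χ : (n : ℕ) → X × Y → (Fin n → Bool) × (Fin n → Bool) :=
    fun n p => (auxCell t n p.1, auxCell u n p.2)
  have hχ : ∀ n, Measurable (χ n) := fun n =>
    ((aux_cell_meas t htm n).comp measurable_fst).prodMk ((aux_cell_meas u hum n).comp measurable_snd)
  let good : (n : ℕ) → (Fin n → Bool) × (Fin n → Bool) → Prop :=
    fun n s => ∀ p p', χ n p = s → χ n p' = s → C p' ≤ C p + η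
  let G : ℕ → Set (X × Y) := fun n => χ n ⁻¹' {s | good n s}
  have hGm : ∀ n, MeasurableSet (G n) := fun n => hχ n (Set.toFinite _).measurableSet
  have hη2 : η / 2 ≠ 0 := (ENNReal.half_pos hη).ne'
  have hGev : ∀ p, ∀ᶠ n in atTop, p ∈ G n := by
    rintro ⟨x, y⟩
    have hV : IsOpen ({p' | C p' < C (x, y) + η / 2} ∩ {p' | C (x, y) < C p' + η / 2}) :=
      (isOpen_lt hC continuous_const).inter (isOpen_lt continuous_const (by fun_prop))
    have hmem : (x, y) ∈ ({p' | C p' < C (x, y) + η / 2} ∩ {p' | C (x, y) < C p' + η / 2}) :=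
      ⟨ENNReal.lt_add_right (hfin _) hη2, ENNReal.lt_add_right (hfin _) hη2⟩
    obtain ⟨U, V, hU, hV', hxU, hyV, hUV⟩ := isOpen_prod_iff.1 hV x y hmem
    obtain ⟨k, hxk, hk⟩ := htb x U hU hxU
    obtain ⟨l, hyl, hl⟩ := hub y V hV' hyV
    filter_upwards [eventually_gt_atTop k, eventually_gt_atTop l] with n hkn hln
    have hin : ∀ p, χ n p = χ n (x, y) →
        p ∈ ({p' | C p' < C (x, y) + η / 2} ∩ {p' | C (x, y) < C p' + η / 2}) := by
      intro p hp
      apply hUV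
      exact ⟨hk (aux_cell_mem t hkn (congrArg Prod.fst hp) hxk),
        hl (aux_cell_mem u hln (congrArg Prod.snd hp) hyl)⟩
    intro p p' hp hp'
    calc C p' ≤ C (x, y) + η / 2 := (hin p' hp').1.le
      _ ≤ C p + η / 2 + η / 2 := by gcongr; exact (hin p hp).2.le
      _ = C p + η := by rw [add_assoc, ENNReal.add_halves]
  have hGt : Tendsto (fun n => π (G n)) atTop (nhds (π Set.univ)) := by
    refine tendsto_measure_of_tendsto_indicator_of_isFiniteMeasure atTop π hGm ?_
    intro p
    filter_upwards [hGev p] with n hn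
    simp [hn]
  rw [measure_univ] at hGt
  have hδ2 : δ / 2 ≠ 0 := (ENNReal.half_pos hδ).ne'
  obtain ⟨n, hn⟩ : ∃ n, 1 < π (G n) + δ / 2 :=
    ((hGt.add tendsto_const_nhds).eventually
      (lt_mem_nhds (ENNReal.lt_add_right one_ne_top hδ2))).exists
  obtain ⟨K, hK⟩ := ENNReal.exists_inv_nat_lt hδ2
  have hK1 : (1 : ℝ≥0∞) / ((K : ℝ≥0∞) + 1) ≤ δ / 2 := by
    rw [one_div]
    exact (ENNReal.inv_le_inv.2 le_self_add).trans hK.le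
  let A : (Fin n → Bool) → Set X := fun a => auxCell t n ⁻¹' {a}
  let B : (Fin n → Bool) → Set Y := fun b => auxCell u n ⁻¹' {b}
  have hAm : ∀ a, MeasurableSet (A a) := fun a => aux_cell_meas t htm n (measurableSet_singleton a)
  have hBm : ∀ b, MeasurableSet (B b) := fun b => aux_cell_meas u hum n (measurableSet_singleton b)
  have hcell : ∀ a b, χ n ⁻¹' {(a, b)} = A a ×ˢ B b := by
    intro a b; ext p; simp [χ, A, B, Prod.ext_iff]
  have hπA : ∀ a b, π (A a ×ˢ B b) ≤ μ (A a) := by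
    intro a b
    rw [← hπ1, Measure.fst_apply (hAm a)]
    exact measure_mono fun p hp => hp.1
  have hπB : ∀ a b, π (A a ×ˢ B b) ≤ ν (B b) := by
    intro a b
    rw [← hπ2, Measure.snd_apply (hBm b)]
    exact measure_mono fun p hp => hp.2
  let r : (Fin n → Bool) → (Fin n → Bool) → ℝ≥0∞ :=
    fun a b => π (A a ×ˢ B b) / (μ (A a) * ν (B b))
  have hr0 : ∀ a b, μ (A a) * ν (B b) = 0 → π (A a ×ˢ B b) = 0 := by
    intro a b h
    rcases mul_eq_zero.1 h with h | h
    · exact le_antisymm (h ▸ hπA a b) bot_le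
    · exact le_antisymm (h ▸ hπB a b) bot_le
  have hrtop : ∀ a b, r a b ≠ ⊤ := by
    intro a b h
    rcases ENNReal.div_eq_top.1 h with ⟨h, h'⟩ | ⟨h, h'⟩
    · exact h (hr0 a b h')
    · exact measure_ne_top _ _ h
  have hrmul : ∀ a b, r a b * (μ (A a) * ν (B b)) = π (A a ×ˢ B b) := by
    intro a b
    refine ENNReal.div_mul_cancel' (fun h => hr0 a b h) fun h => ?_
    exact absurd h (ENNReal.mul_ne_top (measure_ne_top _ _) (measure_ne_top _ _))
  let q : (Fin n → Bool) → (Fin n → Bool) → ℕ :=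
    fun a b => if good n (a, b) then ⌊((K : ℝ) + 1) * (r a b).toReal⌋₊ else 0
  let w : (Fin n → Bool) → (Fin n → Bool) → ℝ≥0∞ :=
    fun a b => (q a b : ℝ≥0∞) / ((K : ℝ≥0∞) + 1)
  have hKpos : (0 : ℝ) < (K : ℝ) + 1 := by positivity
  have hK0 : ((K : ℝ≥0∞) + 1) ≠ 0 := by simp
  have hKt : ((K : ℝ≥0∞) + 1) ≠ ⊤ := by simp
  have hKr : ∀ a b, ((K : ℝ≥0∞) + 1) * r a b = ENNReal.ofReal (((K : ℝ) + 1) * (r a b).toReal) := by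
    intro a b
    rw [ENNReal.ofReal_mul hKpos.le, ENNReal.ofReal_toReal (hrtop a b),
      ENNReal.ofReal_add (by positivity) zero_le_one]
    simp
  have hwr : ∀ a b, w a b ≤ r a b := by
    intro a b
    refine ENNReal.div_le_of_le_mul' ?_
    rw [hKr]
    by_cases hg : good n (a, b)
    · simp only [q, hg, if_true]
      rw [← ENNReal.ofReal_natCast]
      exact ENNReal.ofReal_le_ofReal (Nat.floor_le (by positivity))
    · simp [q, hg]
  have hrw : ∀ a b, good n (a, b) → r a b ≤ w a b + 1 / ((K : ℝ≥0∞) + 1) := by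
    intro a b hg
    rw [← ENNReal.add_div, ENNReal.le_div_iff_mul_le (Or.inl hK0) (Or.inl hKt), mul_comm, hKr]
    simp only [q, hg, if_true]
    refine (ENNReal.ofReal_le_ofReal (Nat.lt_floor_add_one _).le).trans ?_
    rw [ENNReal.ofReal_add (by positivity) zero_le_one]
    simp
  have hF : ∀ p, auxF t u n K q p = w (χ n p).1 (χ n p).2 := fun p => rfl
  refine ⟨n, K, q, ?_, ?_, ?_, ?_⟩
  · intro x
    set a := auxCell t n x with ha
    calc ∫⁻ y, auxF t u n K q (x, y) ∂ν = ∑ b, w a b * ν (B b) :=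
          aux_row (auxCell u n) (aux_cell_meas u hum n) ν (fun b => w a b)
      _ ≤ ∑ b, π (Prod.fst ⁻¹' (A a) ∩ (fun p => auxCell u n p.2) ⁻¹' {b}) * (μ (A a))⁻¹ := by
          refine Finset.sum_le_sum fun b _ => ?_
          refine (mul_le_mul' (hwr a b) le_rfl).trans ?_
          have : Prod.fst ⁻¹' (A a) ∩ (fun p : X × Y => auxCell u n p.2) ⁻¹' {b} = A a ×ˢ B b := rfl
          rw [this]
          by_cases h0 : μ (A a) = 0
          · have : π (A a ×ˢ B b) = 0 := le_antisymm (h0 ▸ hπA a b) bot_le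
            simp [r, this]
          · rw [← div_eq_mul_inv, ENNReal.le_div_iff_mul_le (Or.inl h0) (Or.inl (measure_ne_top _ _)),
              ← hrmul a b]
            exact le_of_eq (by ring)
      _ = μ (A a) * (μ (A a))⁻¹ := by
          rw [← Finset.sum_mul, aux_measure (fun p : X × Y => auxCell u n p.2)
            ((aux_cell_meas u hum n).comp measurable_snd) π _ (measurable_fst (hAm a)),
            ← Measure.fst_apply (hAm a), hπ1]
      _ ≤ 1 := ENNReal.mul_inv_le_one _
  · intro y
    set b := auxCell u n y with hb
    calc ∫⁻ x, auxF t u n K q (x, y) ∂μ = ∑ a, w a b * μ (A a) :=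
          aux_row (auxCell t n) (aux_cell_meas t htm n) μ (fun a => w a b)
      _ ≤ ∑ a, π (Prod.snd ⁻¹' (B b) ∩ (fun p => auxCell t n p.1) ⁻¹' {a}) * (ν (B b))⁻¹ := by
          refine Finset.sum_le_sum fun a _ => ?_
          refine (mul_le_mul' (hwr a b) le_rfl).trans ?_
          have : Prod.snd ⁻¹' (B b) ∩ (fun p : X × Y => auxCell t n p.1) ⁻¹' {a} = A a ×ˢ B b :=
            Set.inter_comm _ _
          rw [this]
          by_cases h0 : ν (B b) = 0
          · have : π (A a ×ˢ B b) = 0 := le_antisymm (h0 ▸ hπB a b) bot_le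
            simp [r, this]
          · rw [← div_eq_mul_inv, ENNReal.le_div_iff_mul_le (Or.inl h0) (Or.inl (measure_ne_top _ _)),
              ← hrmul a b]
            exact le_of_eq (by ring)
      _ = ν (B b) * (ν (B b))⁻¹ := by
          rw [← Finset.sum_mul, aux_measure (fun p : X × Y => auxCell t n p.1)
            ((aux_cell_meas t htm n).comp measurable_fst) π _ (measurable_snd (hBm b)),
            ← Measure.snd_apply (hBm b), hπ2]
      _ ≤ 1 := ENNReal.mul_inv_le_one _
  · have hrhs : ∫⁻ p, C p ∂π + η = ∫⁻ p, (C p + η) ∂π := by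
      rw [lintegral_add_left hCm]; simp
    rw [hrhs, aux_sum (χ n) (hχ n) (μ.prod ν), aux_sum (χ n) (hχ n) π]
    refine Finset.sum_le_sum fun s _ => ?_
    obtain ⟨a, b⟩ := s
    have hsm : MeasurableSet (χ n ⁻¹' {(a, b)}) := hχ n (measurableSet_singleton _)
    have h1 : ∫⁻ p in χ n ⁻¹' {(a, b)}, C p * auxF t u n K q p ∂(μ.prod ν) =
        ∫⁻ p in χ n ⁻¹' {(a, b)}, C p * w a b ∂(μ.prod ν) := by
      refine setLIntegral_congr_fun hsm fun p hp => ?_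
      simp only [Set.mem_preimage, Set.mem_singleton_iff] at hp
      simp only [hF, hp]
    rw [h1]
    by_cases hg : good n (a, b)
    · let I : ℝ≥0∞ := ⨅ p ∈ χ n ⁻¹' {(a, b)}, (C p + η)
      calc ∫⁻ p in χ n ⁻¹' {(a, b)}, C p * w a b ∂(μ.prod ν)
          ≤ ∫⁻ p in χ n ⁻¹' {(a, b)}, I * r a b ∂(μ.prod ν) := by
            refine setLIntegral_mono' hsm fun p hp => ?_
            refine mul_le_mul' ?_ (hwr a b)
            exact le_iInf₂ fun p' hp' => hg p' p hp' hp
        _ = I * π (A a ×ˢ B b) := by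
            rw [setLIntegral_const, hcell, Measure.prod_prod, mul_assoc, hrmul]
        _ = ∫⁻ p in χ n ⁻¹' {(a, b)}, I ∂π := by rw [setLIntegral_const, hcell]
        _ ≤ _ := setLIntegral_mono' hsm fun p hp => iInf₂_le p hp
    · have : w a b = 0 := by simp [w, q, hg]
      simp [this]
  · have hGs : π (G n) ≤ ∑ s : (Fin n → Bool) × (Fin n → Bool),
        (w s.1 s.2 + 1 / ((K : ℝ≥0∞) + 1)) * (μ.prod ν) (χ n ⁻¹' {s}) := by
      rw [← aux_measure (χ n) (hχ n) π _ (hGm n)]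
      refine Finset.sum_le_sum fun s _ => ?_
      obtain ⟨a, b⟩ := s
      by_cases hg : good n (a, b)
      · refine (measure_mono Set.inter_subset_right).trans ?_
        rw [hcell, Measure.prod_prod, ← hrmul a b]
        exact mul_le_mul' (hrw a b hg) le_rfl
      · have : G n ∩ χ n ⁻¹' {(a, b)} = ∅ := by
          ext p
          simp only [Set.mem_inter_iff, Set.mem_preimage, Set.mem_singleton_iff,
            Set.mem_empty_iff_false, iff_false, not_and, G, Set.mem_ofPred_eq]
          intro h h'
          exact hg (h' ▸ h)
        rw [this]; simp
    rw [← aux_row (χ n) (hχ n) (μ.prod ν) (fun s => w s.1 s.2 + 1 / ((K : ℝ≥0∞) + 1))] at hGs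
    rw [lintegral_add_right _ measurable_const, lintegral_const, measure_univ, mul_one] at hGs
    calc (1 : ℝ≥0∞) ≤ π (G n) + δ / 2 := hn.le
      _ ≤ ∫⁻ p, auxF t u n K q p ∂(μ.prod ν) + δ / 2 + δ / 2 := by
          gcongr
          exact hGs.trans (add_le_add le_rfl hK1)
      _ = _ := by rw [add_assoc, ENNReal.add_halves]

lemma aux_approx {X Y : Type*}
    [TopologicalSpace X] [MeasurableSpace X] [OpensMeasurableSpace X]
    [TopologicalSpace Y] [MeasurableSpace Y] [OpensMeasurableSpace Y]
    (t : ℕ → Set X) (ht : ∀ k, IsOpen (t k))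
    (htb : ∀ x, ∀ U : Set X, IsOpen U → x ∈ U → ∃ k, x ∈ t k ∧ t k ⊆ U)
    (u : ℕ → Set Y) (hu : ∀ k, IsOpen (u k))
    (hub : ∀ x, ∀ U : Set Y, IsOpen U → x ∈ U → ∃ k, x ∈ u k ∧ u k ⊆ U)
    (μ : Measure X) [IsProbabilityMeasure μ] (ν : Measure Y) [IsProbabilityMeasure ν]
    (π : Measure (X × Y)) [IsProbabilityMeasure π] (hπ1 : π.fst = μ) (hπ2 : π.snd = ν)
    (C : X × Y → ℝ≥0∞) (hC : Continuous C) (hCm : Measurable C) (hfin : ∀ p, C p ≠ ⊤)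
    (hint : ∫⁻ p, C p ∂(μ.prod ν) ≠ ⊤) (η : ℝ≥0∞) (hη : η ≠ 0) :
    ∃ (k n K : ℕ) (q : (Fin n → Bool) → (Fin n → Bool) → ℕ),
      ∫⁻ p, C p * auxDens μ ν (1 - ((k : ℝ≥0∞) + 2)⁻¹) (auxNorm μ ν (auxF t u n K q)) p ∂(μ.prod ν)
        ≤ ∫⁻ p, C p ∂π + η := by
  have hη3 : η / 3 ≠ 0 := ENNReal.div_ne_zero.2 ⟨hη, by simp⟩
  set J := ∫⁻ p, C p ∂(μ.prod ν) with hJ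
  obtain ⟨k, hk⟩ := ENNReal.exists_inv_nat_lt (a := η / 3 / (J + 1))
    (ENNReal.div_ne_zero.2 ⟨hη3, by simp [hint]⟩)
  set e : ℝ≥0∞ := ((k : ℝ≥0∞) + 2)⁻¹ with he
  have he0 : e ≠ 0 := by simp [he]
  have he1 : e ≤ 1 := by
    rw [he, ENNReal.inv_le_one]
    exact le_add_left (by norm_num)
  have heJ : e * J ≤ η / 3 := by
    calc e * J ≤ (η / 3 / (J + 1)) * (J + 1) := by
          gcongr
          · exact (ENNReal.inv_le_inv.2 le_self_add).trans hk.le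
          · exact le_self_add
      _ = (J + 1) * (η / 3 / (J + 1)) := mul_comm _ _
      _ ≤ η / 3 := ENNReal.mul_div_le
  have hse : (1 - e) + e = 1 := tsub_add_cancel_of_le he1
  have hs : 1 - e < 1 := ENNReal.sub_lt_self one_ne_top one_ne_zero he0
  have h2e : 2 / e ≠ ⊤ := ENNReal.div_ne_top (by simp) he0
  have hη' : η / 3 / (2 / e) / 2 ≠ 0 :=
    ENNReal.div_ne_zero.2 ⟨ENNReal.div_ne_zero.2 ⟨hη3, h2e⟩, by simp⟩
  obtain ⟨δ, hδ, hui⟩ := aux_ui (μ.prod ν) C hCm hfin hint _ hη'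
  obtain ⟨n, K, q, h1, h2, hcost, hmass⟩ :=
    aux_disc t ht htb u hu hub μ ν π hπ1 hπ2 C hC hCm hfin (η / 3) δ hη3 hδ
  refine ⟨k, n, K, q, ?_⟩
  have hg : Measurable (auxF t u n K q) :=
    aux_F_meas t (fun k => (ht k).measurableSet) u (fun k => (hu k).measurableSet) n K q
  rw [aux_norm_eq μ ν _ h1 h2]
  set g := auxF t u n K q with hgdef
  have hmg1 : Measurable fun x => ∫⁻ y, g (x, y) ∂ν := hg.lintegral_prod_right'
  have hmg2 : Measurable fun y => ∫⁻ x, g (x, y) ∂μ := hg.lintegral_prod_left'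
  have key : ∀ v : X × Y → ℝ≥0∞, Measurable v → (∀ p, v p ≤ 1) →
      ∫⁻ p, v p ∂(μ.prod ν) = ∫⁻ p, g p ∂(μ.prod ν) →
      ∫⁻ p, C p * (1 - v p) ∂(μ.prod ν) ≤ η / 3 / (2 / e) / 2 := by
    intro v hv hv1 hvg
    refine hui _ (by fun_prop) (fun p => tsub_le_self) ?_
    have hvi : ∫⁻ p, v p ∂(μ.prod ν) ≤ 1 := by
      calc _ ≤ ∫⁻ p, 1 ∂(μ.prod ν) := lintegral_mono hv1
        _ = 1 := by simp
    rw [lintegral_sub hv (ne_top_of_le_ne_top one_ne_top hvi) (Eventually.of_forall hv1), hvg]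
    simp only [lintegral_one, measure_univ]
    rw [tsub_le_iff_left]
    exact hmass
  have k1 := key (fun p => ∫⁻ y, g (p.1, y) ∂ν) (by fun_prop) (fun p => h1 p.1) (by
    rw [lintegral_prod _ (by fun_prop), lintegral_prod _ (by fun_prop)]
    simp)
  have k2 := key (fun p => ∫⁻ x, g (x, p.2) ∂μ) (by fun_prop) (fun p => h2 p.2) (by
    rw [lintegral_prod_symm _ (by fun_prop), lintegral_prod_symm _ (by fun_prop)]
    simp)
  refine (aux_cost μ ν (1 - e) hs g hg h1 h2 e hse C hCm).trans ?_
  calc _ ≤ (∫⁻ p, C p ∂π + η / 3) + η / 3 +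
        2 / e * (η / 3 / (2 / e) / 2 + η / 3 / (2 / e) / 2) := by gcongr
    _ ≤ (∫⁻ p, C p ∂π + η / 3) + η / 3 + η / 3 := by
        gcongr
        rw [ENNReal.add_halves]
        exact ENNReal.mul_div_le
    _ = ∫⁻ p, C p ∂π + (η / 3 + η / 3 + η / 3) := by ring
    _ = _ := by rw [ENNReal.add_thirds]

lemma aux_basis (X : Type*) [TopologicalSpace X] [SecondCountableTopology X] :
    ∃ t : ℕ → Set X, (∀ k, IsOpen (t k)) ∧
      ∀ x, ∀ U : Set X, IsOpen U → x ∈ U → ∃ k, x ∈ t k ∧ t k ⊆ U := by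
  have hb := TopologicalSpace.isBasis_countableBasis X
  obtain ⟨t, ht⟩ := ((TopologicalSpace.countable_countableBasis X).insert ∅).exists_eq_range
    (Set.insert_nonempty _ _)
  refine ⟨t, fun k => ?_, fun x U hU hx => ?_⟩
  · have : t k ∈ insert ∅ (TopologicalSpace.countableBasis X) := ht ▸ Set.mem_range_self k
    rcases this with h | h
    · rw [h]; exact isOpen_empty
    · exact hb.isOpen h
  · obtain ⟨v, hv, hxv, hvU⟩ := hb.exists_subset_of_mem_open hx hU
    have : v ∈ Set.range t := ht ▸ Set.mem_insert_of_mem _ hv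
    obtain ⟨k, rfl⟩ := this
    exact ⟨k, hxv, hvU⟩

open Classical in
/-- Measurable selection among countably many kernels. -/
lemma aux_select {Ω Z : Type*} [MeasurableSpace Ω] [MeasurableSpace Z] (κ : ℕ → Kernel Ω Z)
    (F : ℕ → Ω → ℝ≥0∞) (hF : ∀ i, Measurable (F i)) (η : ℝ≥0∞) (hη : η ≠ 0) :
    ∃ (κ' : Kernel Ω Z) (i : Ω → ℕ), (∀ ω, κ' ω = κ (i ω) ω) ∧
      ∀ ω, F (i ω) ω ≤ (⨅ j, F j ω) + η := by
  have hex : ∀ ω, ∃ i, F i ω ≤ (⨅ j, F j ω) + η := by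
    intro ω
    by_cases h : (⨅ j, F j ω) = ⊤
    · exact ⟨0, by simp [h]⟩
    · obtain ⟨i, hi⟩ := iInf_lt_iff.1 (ENNReal.lt_add_right h hη)
      exact ⟨i, hi.le⟩
  have hm : Measurable fun ω => Nat.find (hex ω) :=
    measurable_find hex fun i =>
      measurableSet_le (hF i) ((Measurable.iInf hF).add measurable_const)
  refine ⟨⟨fun ω => κ (Nat.find (hex ω)) ω, ?_⟩, fun ω => Nat.find (hex ω), fun ω => rfl,
    fun ω => Nat.find_spec (hex ω)⟩
  have h2 : Measurable fun p : Ω × ℕ => κ p.2 p.1 :=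
    measurable_from_prod_countable_left fun i => (κ i).measurable
  exact h2.comp (measurable_id.prodMk hm)

/-- Index type of the countable family of approximating couplings. -/
structure AuxIdx where
  k : ℕ
  n : ℕ
  K : ℕ
  q : (Fin n → Bool) → (Fin n → Bool) → ℕ

lemma aux_enum : ∃ enc : ℕ → AuxIdx, Function.Surjective enc := by
  obtain ⟨e, he⟩ := exists_surjective_nat
    (ℕ × ℕ × (Σ n : ℕ, ((Fin n → Bool) → (Fin n → Bool) → ℕ)))
  let φ : ℕ × ℕ × (Σ n : ℕ, ((Fin n → Bool) → (Fin n → Bool) → ℕ)) → AuxIdx :=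
    fun a => ⟨a.1, a.2.2.1, a.2.1, a.2.2.2⟩
  refine ⟨fun j => φ (e j), fun i => ?_⟩
  obtain ⟨j, hj⟩ := he (i.k, i.K, ⟨i.n, i.q⟩)
  exact ⟨j, congrArg φ hj⟩

theorem stochCost_eq_lintegral_deterCost
    {Ω X Y : Type*} [MeasurableSpace Ω]
    [TopologicalSpace X] [PolishSpace X] [MeasurableSpace X] [BorelSpace X]
    [TopologicalSpace Y] [PolishSpace Y] [MeasurableSpace Y] [BorelSpace Y]
    (P : Measure Ω) [IsProbabilityMeasure P]
    (μ : Kernel Ω X) [IsMarkovKernel μ] (ν : Kernel Ω Y) [IsMarkovKernel ν]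
    (c : Ω → X → Y → ℝ)
    (hc_nonneg : ∀ ω x y, 0 ≤ c ω x y)
    (hc_cont : ∀ ω, Continuous (fun q : X × Y => c ω q.1 q.2))
    (hc_meas : ∀ x y, Measurable (fun ω => c ω x y))
    (hint : ∫⁻ ω, ∫⁻ q, ENNReal.ofReal (c ω q.1 q.2) ∂((μ ω).prod (ν ω)) ∂P < ⊤) :
    stochCost P c μ ν = ∫⁻ ω, deterCost (c ω) (μ ω) (ν ω) ∂P := by
  let C : Ω → X × Y → ℝ≥0∞ := fun ω p => ENNReal.ofReal (c ω p.1 p.2)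
  have hCcont : ∀ ω, Continuous (C ω) := fun ω => ENNReal.continuous_ofReal.comp (hc_cont ω)
  have hCjoint : Measurable (Function.uncurry C) := by
    have h := measurable_uncurry_of_continuous_of_measurable
      (u := fun (p : X × Y) (ω : Ω) => c ω p.1 p.2) hc_cont (fun p => hc_meas p.1 p.2)
    exact ENNReal.measurable_ofReal.comp (h.comp measurable_swap)
  have hCm : ∀ ω, Measurable (C ω) := fun ω => (hCcont ω).measurable
  have hCfin : ∀ ω p, C ω p ≠ ⊤ := fun ω p => ENNReal.ofReal_ne_top
  apply le_antisymm
  swap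
  · refine le_iInf₂ fun π hπ => ?_
    obtain ⟨hM, h1, h2⟩ := hπ
    refine lintegral_mono fun ω => iInf₂_le (π ω) ?_
    refine ⟨inferInstance, ?_, ?_⟩
    · rw [← h1, Kernel.fst_apply, Measure.fst]
    · rw [← h2, Kernel.snd_apply, Measure.snd]
  obtain ⟨t, ht, htb⟩ := aux_basis X
  obtain ⟨u, hu, hub⟩ := aux_basis Y
  have htm : ∀ k, MeasurableSet (t k) := fun k => (ht k).measurableSet
  have hum : ∀ k, MeasurableSet (u k) := fun k => (hu k).measurableSet
  obtain ⟨enc, henc⟩ := aux_enum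
  let f : AuxIdx → X × Y → ℝ≥0∞ := fun i => auxF t u i.n i.K i.q
  have hf : ∀ i, Measurable (f i) := fun i => aux_F_meas t htm u hum _ _ _
  let g : AuxIdx → Ω → X × Y → ℝ≥0∞ := fun i ω => auxNorm (μ ω) (ν ω) (f i)
  have hg : ∀ i, Measurable (Function.uncurry (g i)) := fun i =>
    aux_norm_meas μ ν (fun _ => f i) ((hf i).comp measurable_snd)
  let s : AuxIdx → ℝ≥0∞ := fun i => 1 - ((i.k : ℝ≥0∞) + 2)⁻¹
  have hs : ∀ i, s i < 1 := fun i => ENNReal.sub_lt_self one_ne_top one_ne_zero (by simp)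
  let h : AuxIdx → Ω → X × Y → ℝ≥0∞ := fun i ω => auxDens (μ ω) (ν ω) (s i) (g i ω)
  have hh : ∀ i, Measurable (Function.uncurry (h i)) := fun i =>
    aux_dens_meas μ ν (s i) (g i) (hg i)
  have hgω : ∀ i ω, Measurable (g i ω) := fun i ω => (hg i).of_uncurry_left
  have hhω : ∀ i ω, Measurable (h i ω) := fun i ω => (hh i).of_uncurry_left
  let κ : AuxIdx → Kernel Ω (X × Y) := fun i => (μ ×ₖ ν).withDensity (h i)
  have hκ : ∀ i ω, κ i ω = ((μ ω).prod (ν ω)).withDensity (h i ω) := by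
    intro i ω
    rw [Kernel.withDensity_apply _ (hh i), Kernel.prod_apply]
  have hcoup : ∀ i ω, (κ i ω).fst = μ ω ∧ (κ i ω).snd = ν ω := by
    intro i ω
    rw [hκ]
    have g1 := aux_norm_le1 (μ ω) (ν ω) (f i) (hf i)
    have g2 := aux_norm_le2 (μ ω) (ν ω) (f i) (hf i)
    exact aux_coupling _ _ _ (hhω i ω)
      (aux_dens_marg1 _ _ _ (hs i) _ (hgω i ω) g1 g2) (aux_dens_marg2 _ _ _ (hs i) _ (hgω i ω) g1 g2)
  let F : AuxIdx → Ω → ℝ≥0∞ := fun i ω => ∫⁻ p, C ω p ∂(κ i ω)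
  have hFeq : ∀ i ω, F i ω = ∫⁻ p, C ω p * h i ω p ∂((μ ω).prod (ν ω)) := by
    intro i ω
    simp only [F]
    rw [hκ, lintegral_withDensity_eq_lintegral_mul _ (hhω i ω) (hCm ω)]
    simp [mul_comm]
  have hFm : ∀ i, Measurable (F i) := fun i => by
    have : F i = fun ω => ∫⁻ p, C ω p * h i ω p ∂((μ ×ₖ ν) ω) := by
      funext ω; rw [hFeq, Kernel.prod_apply]
    rw [this]
    exact Measurable.lintegral_kernel_prod_right (hCjoint.mul (hh i))
  -- the countable infimum is the deterministic cost, almost everywhere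
  have hCint : Measurable fun ω => ∫⁻ p, C ω p ∂((μ ω).prod (ν ω)) := by
    have := Measurable.lintegral_kernel_prod_right (κ := μ ×ₖ ν) hCjoint
    simpa only [Kernel.prod_apply] using this
  have hae : ∀ᵐ ω ∂P, (⨅ j, F (enc j) ω) ≤ deterCost (c ω) (μ ω) (ν ω) := by
    filter_upwards [ae_lt_top hCint hint.ne] with ω hω
    refine le_iInf₂ fun π hπ => ?_
    obtain ⟨hP, h1, h2⟩ := hπ
    refine _root_.le_of_forall_pos_le_add fun η hη => ?_
    obtain ⟨k, n, K, q, hle⟩ := aux_approx t ht htb u hu hub (μ ω) (ν ω) π h1 h2 (C ω)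
      (hCcont ω) (hCm ω) (hCfin ω) hω.ne η hη.ne'
    obtain ⟨j, hj⟩ := henc ⟨k, n, K, q⟩
    refine (iInf_le _ j).trans ?_
    rw [hj, hFeq]
    exact hle
  refine _root_.le_of_forall_pos_le_add fun η hη => ?_
  obtain ⟨κ', i, hκ', hi⟩ := aux_select (fun j => κ (enc j)) (fun j => F (enc j))
    (fun j => hFm _) η hη.ne'
  have hfst : κ'.fst = μ := by
    ext1 ω
    rw [Kernel.fst_apply, hκ']
    exact (hcoup _ ω).1
  have hsnd : κ'.snd = ν := by
    ext1 ω
    rw [Kernel.snd_apply, hκ']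
    exact (hcoup _ ω).2
  have hMk : IsMarkovKernel κ' := ⟨fun ω => ⟨by
    have h1 : (κ'.fst) ω Set.univ = 1 := by rw [hfst]; exact measure_univ
    rwa [Kernel.fst_apply' _ _ MeasurableSet.univ] at h1⟩⟩
  calc stochCost P c μ ν ≤ ∫⁻ ω, ∫⁻ q, ENNReal.ofReal (c ω q.1 q.2) ∂(κ' ω) ∂P :=
        iInf₂_le κ' ⟨hMk, hfst, hsnd⟩
    _ ≤ ∫⁻ ω, (deterCost (c ω) (μ ω) (ν ω) + η) ∂P := by
        refine lintegral_mono_ae ?_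
        filter_upwards [hae] with ω hω
        rw [hκ']
        exact (hi ω).trans (add_le_add hω le_rfl)
    _ = _ := by
        rw [lintegral_add_right _ measurable_const]
        simp
end

section
/- Let X and Y be Polish spaces, (Ω,F,P) a probability space, μ a probability kernel from Ω to X, ν a probability kernel from Ω to Y, and c : Ω×X×Y → [0,∞) a function such that for each ω the map (x,y) ↦ c(ω,x,y) is continuous, for each (x,y) the map ω ↦ c(ω,x,y) is F-measurable, and E ∫_{X×Y} c(ω,x,y) μ_ω(dx) ν_ω(dy) < +∞. Then the stochastic Kantorovich duality holds: C^stoch(c,μ,ν) = sup E( ∫_Y φ(ω,y) ν_ω(dy) − ∫_X ψ(ω,x) μ_ω(dx) ), where the supremum runs over all pairs of jointly measurable functions ψ : Ω×X → ℝ with E∫_X |ψ(ω,x)| μ_ω(dx) < ∞ and φ : Ω×Y → ℝ with E∫_Y |φ(ω,y)| ν_ω(dy) < ∞ satisfying φ(ω,y) − ψ(ω,x) ≤ c(ω,x,y) for all (ω,x,y). -/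
open MeasureTheory ProbabilityTheory Filter ENNReal

/-- The space of bounded real functions. -/
def bddFun (T : Type*) : Submodule ℝ (T → ℝ) where
  carrier := {f | ∃ C, ∀ t, |f t| ≤ C}
  add_mem' := by
    rintro f g ⟨C, hC⟩ ⟨D, hD⟩
    exact ⟨C + D, fun t => (abs_add_le _ _).trans (add_le_add (hC t) (hD t))⟩
  zero_mem' := ⟨0, by simp⟩
  smul_mem' := by
    rintro a f ⟨C, hC⟩
    refine ⟨|a| * C, fun t => ?_⟩
    rw [Pi.smul_apply, smul_eq_mul, abs_mul]
    exact mul_le_mul_of_nonneg_left (hC t) (abs_nonneg _)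

theorem hahn_banach_dual {T : Type*} (D : Submodule ℝ (T → ℝ)) (L : D →ₗ[ℝ] ℝ)
    (hDb : D ≤ bddFun T)
    (one : D) (hone : ∀ t, (one : T → ℝ) t = 1)
    (hpos : ∀ h : D, (∀ t, 0 ≤ (h : T → ℝ) t) → 0 ≤ L h)
    (c : T → ℝ) (S : ℝ)
    (hLS : ∀ h : D, (∀ t, (h : T → ℝ) t ≤ c t) → L h ≤ S) :
    ∃ ℓ : bddFun T →ₗ[ℝ] ℝ,
      (∀ f : bddFun T, (∀ t, 0 ≤ (f : T → ℝ) t) → 0 ≤ ℓ f) ∧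
      (∀ h : D, ℓ ⟨h, hDb h.2⟩ = L h) ∧
      (∀ f : bddFun T, (∀ t, (f : T → ℝ) t ≤ c t) → ℓ f ≤ S) := by
  let R : bddFun T → Set ℝ := fun f => {r | ∃ h : D, ∃ a : ℝ, 0 ≤ a ∧
    (∀ t, (f : T → ℝ) t ≤ (h : T → ℝ) t + a * c t) ∧ r = L h + a * S}
  let p : bddFun T → ℝ := fun f => sInf (R f)
  have hne : ∀ f, (R f).Nonempty := by
    rintro ⟨f, C, hC⟩
    refine ⟨_, C • one, 0, le_rfl, fun t => ?_, rfl⟩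
    simpa [hone] using (le_abs_self _).trans (hC t)
  have hbd : ∀ f, BddBelow (R f) := by
    rintro ⟨f, C, hC⟩
    refine ⟨-(C * L one), ?_⟩
    rintro r ⟨h, a, ha, hh, rfl⟩
    have key : ∀ t, 0 ≤ (h : T → ℝ) t + C + a * c t := fun t => by
      have := hh t
      simp only at this
      linarith [neg_abs_le (f t), hC t]
    rcases ha.eq_or_lt with rfl | ha
    · have := hpos (h + C • one) (fun t => by simpa [hone] using key t)
      simp at this
      simp; linarith
    · have := hLS ((-a⁻¹) • (h + C • one)) (fun t => by
        have h1 := key t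
        have : (((-a⁻¹) • (h + C • one) : D) : T → ℝ) t = (-((h : T → ℝ) t + C)) / a := by
          simp [hone]; field_simp; ring
        rw [this, div_le_iff₀ ha]; linarith)
      rw [map_smul, smul_eq_mul, map_add, map_smul, smul_eq_mul] at this
      have h2 := mul_le_mul_of_nonneg_left this ha.le
      have h3 : a * (-a⁻¹ * (L h + C * L one)) = -(L h + C * L one) := by field_simp
      linarith
  have hle : ∀ f r, r ∈ R f → p f ≤ r := fun f r hr => csInf_le (hbd f) hr
  have hhom' : ∀ a : ℝ, 0 < a → ∀ f, p (a • f) ≤ a * p f := by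
    intro a ha f
    rw [← div_le_iff₀' ha]
    refine le_csInf (hne f) ?_
    rintro r ⟨h, b, hb, hh, rfl⟩
    rw [div_le_iff₀' ha]
    refine hle _ _ ⟨a • h, a * b, by positivity, fun t => ?_, ?_⟩
    · have := mul_le_mul_of_nonneg_left (hh t) ha.le
      simp only [Submodule.coe_smul, Pi.smul_apply, smul_eq_mul]
      linarith
    · simp; ring
  have hhom : ∀ a : ℝ, 0 < a → ∀ f, p (a • f) = a * p f := by
    intro a ha f
    refine le_antisymm (hhom' a ha f) ?_
    have := hhom' a⁻¹ (by positivity) (a • f)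
    rw [smul_smul, inv_mul_cancel₀ ha.ne', one_smul] at this
    rwa [← div_eq_inv_mul, le_div_iff₀' ha] at this
  have hadd : ∀ f g, p (f + g) ≤ p f + p g := by
    intro f g
    rw [← sub_le_iff_le_add]
    refine le_csInf (hne f) ?_
    rintro r ⟨h, b, hb, hh, rfl⟩
    rw [sub_le_comm]
    refine le_csInf (hne g) ?_
    rintro r ⟨h', b', hb', hh', rfl⟩
    rw [sub_le_iff_le_add]
    refine hle _ _ ⟨h' + h, b' + b, by positivity, fun t => ?_, ?_⟩
    · have := hh t
      have := hh' t
      simp only [Submodule.coe_add, Pi.add_apply]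
      linarith
    · simp; ring
  have hp0 : p 0 = 0 := by
    have := hhom 2 (by norm_num) 0
    rw [smul_zero] at this; linarith
  obtain ⟨ℓ, -, hℓ⟩ := exists_extension_of_le_sublinear (⊥ : bddFun T →ₗ.[ℝ] ℝ) p hhom hadd (by
    rintro ⟨x, hx⟩
    have hx' : x = 0 := (Submodule.mem_bot ℝ).1 hx
    subst hx'
    rw [hp0]
    exact le_of_eq (LinearPMap.map_zero _))
  have hneg : ∀ h : D, ℓ ⟨h, hDb h.2⟩ ≤ L h := fun h =>
    (hℓ _).trans (hle _ _ ⟨h, 0, le_rfl, by simp, by simp⟩)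
  refine ⟨ℓ, ?_, ?_, ?_⟩
  · intro f hf
    have := (hℓ (-f)).trans (hle _ 0 ⟨0, 0, le_rfl, by simpa using hf, by simp⟩)
    rw [map_neg] at this; linarith
  · intro h
    refine le_antisymm (hneg h) ?_
    have h1 := hneg (-h)
    have h2 : (⟨((-h : D) : T → ℝ), hDb (-h).2⟩ : bddFun T) = -⟨h, hDb h.2⟩ := by
      ext; simp
    rw [h2, map_neg, map_neg] at h1
    linarith
  · intro f hf
    exact (hℓ f).trans (hle _ _ ⟨0, 1, zero_le_one, by simpa using hf, by simp⟩)

/-- Inner regularity of a set with respect to a class of sets. -/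
def InnerApprox {T : Type*} (m : Set T → ℝ) (K : Set (Set T)) (E : Set T) : Prop :=
  ∀ ε : ℝ, 0 < ε → ∃ F ∈ K, F ⊆ E ∧ m (E \ F) ≤ ε

/-- Sets which, with their complements, are inner regular. -/
def approxAlg {T : Type*} (m : Set T → ℝ) (K : Set (Set T)) : Set (Set T) :=
  {E | InnerApprox m K E ∧ InnerApprox m K Eᶜ}

section abstractExt
variable {T : Type*} {m : Set T → ℝ} {K : Set (Set T)}

theorem fa_mono (hnn : ∀ s, 0 ≤ m s)
    (hadd : ∀ s t, Disjoint s t → m (s ∪ t) = m s + m t) {s t : Set T} (h : s ⊆ t) :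
    m s ≤ m t := by
  have := hadd s (t \ s) Set.disjoint_sdiff_right
  rw [Set.union_sdiff_cancel h] at this
  linarith [hnn (t \ s)]

theorem fa_subadd (hnn : ∀ s, 0 ≤ m s)
    (hadd : ∀ s t, Disjoint s t → m (s ∪ t) = m s + m t) (s t : Set T) :
    m (s ∪ t) ≤ m s + m t := by
  have := hadd s (t \ s) Set.disjoint_sdiff_right
  rw [Set.union_sdiff_self] at this
  linarith [fa_mono hnn hadd (Set.sdiff_subset : t \ s ⊆ t)]

theorem innerApprox_union (hnn : ∀ s, 0 ≤ m s)
    (hadd : ∀ s t, Disjoint s t → m (s ∪ t) = m s + m t)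
    (hKu : ∀ s ∈ K, ∀ t ∈ K, s ∪ t ∈ K) {s t : Set T}
    (hs : InnerApprox m K s) (ht : InnerApprox m K t) : InnerApprox m K (s ∪ t) := by
  intro ε hε
  obtain ⟨F, hF, hFs, hFm⟩ := hs (ε / 2) (by positivity)
  obtain ⟨G, hG, hGt, hGm⟩ := ht (ε / 2) (by positivity)
  refine ⟨F ∪ G, hKu _ hF _ hG, Set.union_subset_union hFs hGt, ?_⟩
  have h1 : (s ∪ t) \ (F ∪ G) ⊆ (s \ F) ∪ (t \ G) := by
    intro x hx
    simp only [Set.mem_sdiff, Set.mem_union, not_or] at *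
    tauto
  linarith [fa_mono hnn hadd h1, fa_subadd hnn hadd (s \ F) (t \ G)]

theorem innerApprox_inter (hnn : ∀ s, 0 ≤ m s)
    (hadd : ∀ s t, Disjoint s t → m (s ∪ t) = m s + m t)
    (hKi : ∀ s ∈ K, ∀ t ∈ K, s ∩ t ∈ K) {s t : Set T}
    (hs : InnerApprox m K s) (ht : InnerApprox m K t) : InnerApprox m K (s ∩ t) := by
  intro ε hε
  obtain ⟨F, hF, hFs, hFm⟩ := hs (ε / 2) (by positivity)
  obtain ⟨G, hG, hGt, hGm⟩ := ht (ε / 2) (by positivity)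
  refine ⟨F ∩ G, hKi _ hF _ hG, Set.inter_subset_inter hFs hGt, ?_⟩
  have h1 : (s ∩ t) \ (F ∩ G) ⊆ (s \ F) ∪ (t \ G) := by
    intro x hx
    simp only [Set.mem_sdiff, Set.mem_union, Set.mem_inter_iff, not_and] at *
    tauto
  linarith [fa_mono hnn hadd h1, fa_subadd hnn hadd (s \ F) (t \ G)]

theorem approxAlg_isSetAlgebra (h0 : m ∅ = 0) (hnn : ∀ s, 0 ≤ m s)
    (hadd : ∀ s t, Disjoint s t → m (s ∪ t) = m s + m t)
    (hKe : ∅ ∈ K) (hKuniv : InnerApprox m K Set.univ)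
    (hKi : ∀ s ∈ K, ∀ t ∈ K, s ∩ t ∈ K)
    (hKu : ∀ s ∈ K, ∀ t ∈ K, s ∪ t ∈ K) : IsSetAlgebra (approxAlg m K) where
  empty_mem := ⟨fun ε hε => ⟨∅, hKe, subset_rfl, by simp [h0, hε.le]⟩, by simpa using hKuniv⟩
  compl_mem := fun s hs => ⟨hs.2, by simpa using hs.1⟩
  union_mem := fun s t hs ht => ⟨innerApprox_union hnn hadd hKu hs.1 ht.1, by
    rw [Set.compl_union]; exact innerApprox_inter hnn hadd hKi hs.2 ht.2⟩

theorem approx_tendsto (hnn : ∀ s, 0 ≤ m s)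
    (hadd : ∀ s t, Disjoint s t → m (s ∪ t) = m s + m t)
    (hKi : ∀ s ∈ K, ∀ t ∈ K, s ∩ t ∈ K)
    (hK : ∀ F : ℕ → Set T, (∀ n, F n ∈ K) → Antitone F → (⋂ n, F n) = ∅ →
      Tendsto (fun n => m (F n)) atTop (nhds 0))
    (s : ℕ → Set T) (hs : ∀ n, InnerApprox m K (s n)) (hanti : Antitone s)
    (hemp : (⋂ n, s n) = ∅) : Tendsto (fun n => m (s n)) atTop (nhds 0) := by
  rw [Metric.tendsto_atTop]
  intro ε hε
  choose F hF hFs hFm using fun n => hs n ((ε / 2) * (1 / 2) ^ (n + 1)) (by positivity)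
  let G : ℕ → Set T := fun n => Nat.rec (F 0) (fun n g => g ∩ F (n + 1)) n
  have hG0 : G 0 = F 0 := rfl
  have hGs : ∀ n, G (n + 1) = G n ∩ F (n + 1) := fun n => rfl
  have hGK : ∀ n, G n ∈ K := by
    intro n
    induction n with
    | zero => exact hF 0
    | succ n ih => exact hKi _ ih _ (hF _)
  have hGF : ∀ n, G n ⊆ F n := by
    intro n
    cases n with
    | zero => exact subset_rfl
    | succ n => exact Set.inter_subset_right
  have hGa : Antitone G := antitone_nat_of_succ_le fun n => Set.inter_subset_left
  have hGe : (⋂ n, G n) = ∅ := by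
    rw [← Set.subset_empty_iff, ← hemp]
    exact Set.iInter_mono fun n => (hGF n).trans (hFs n)
  have hb : ∀ n, m (s n \ G n) ≤ (ε / 2) * (1 - (1 / 2) ^ (n + 1)) := by
    intro n
    induction n with
    | zero => rw [hG0]; refine (hFm 0).trans (le_of_eq ?_); ring
    | succ n ih =>
      have h1 : s (n + 1) \ G (n + 1) ⊆ (s n \ G n) ∪ (s (n + 1) \ F (n + 1)) := by
        intro x hx
        have h0 : x ∈ s n := hanti (Nat.le_succ n) hx.1
        rw [hGs] at hx
        rcases Classical.em (x ∈ G n) with hg | hg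
        · exact Or.inr ⟨hx.1, fun hf => hx.2 ⟨hg, hf⟩⟩
        · exact Or.inl ⟨h0, hg⟩
      have h2 := hFm (n + 1)
      have h3 := fa_mono hnn hadd h1
      have h4 := fa_subadd hnn hadd (s n \ G n) (s (n + 1) \ F (n + 1))
      have h5 : (ε / 2) * (1 - (1 / 2) ^ (n + 1 + 1)) =
        (ε / 2) * (1 - (1 / 2) ^ (n + 1)) + (ε / 2) * (1 / 2) ^ (n + 1 + 1) := by ring
      linarith
  have := hK G hGK hGa hGe
  rw [Metric.tendsto_atTop] at this
  obtain ⟨N, hN⟩ := this (ε / 2) (by positivity)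
  refine ⟨N, fun n hn => ?_⟩
  have h1 := hN n hn
  rw [Real.dist_eq, sub_zero, abs_of_nonneg (hnn _)] at h1 ⊢
  have h2 := fa_subadd hnn hadd (s n \ G n) (G n)
  rw [Set.sdiff_union_of_subset ((hGF n).trans (hFs n))] at h2
  have h3 := hb n
  have h4 : (ε / 2) * (1 - (1 / 2) ^ (n + 1)) ≤ ε / 2 := by
    have : 0 ≤ (ε / 2) * (1 / 2 : ℝ) ^ (n + 1) := by positivity
    linarith
  linarith

theorem fa_sUnion (h0 : m ∅ = 0)
    (hadd : ∀ s t, Disjoint s t → m (s ∪ t) = m s + m t) (I : Finset (Set T))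
    (hd : (I : Set (Set T)).PairwiseDisjoint id) :
    m (⋃₀ (I : Set (Set T))) = ∑ u ∈ I, m u := by
  classical
  induction I using Finset.induction_on with
  | empty => simp [h0]
  | insert a I ha ih =>
    rw [Finset.coe_insert, Set.sUnion_insert, hadd, Finset.sum_insert ha, ih]
    · exact hd.subset (by simp)
    · rw [Set.disjoint_sUnion_right]
      intro t ht
      exact hd (by simp) (by simp [ht]) (by rintro rfl; exact ha (by simpa using ht))

theorem exists_measure_of_innerApprox [mT : MeasurableSpace T]
    (h0 : m ∅ = 0) (hnn : ∀ s, 0 ≤ m s)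
    (hadd : ∀ s t, Disjoint s t → m (s ∪ t) = m s + m t)
    (hKe : ∅ ∈ K) (hKuniv : InnerApprox m K Set.univ)
    (hKi : ∀ s ∈ K, ∀ t ∈ K, s ∩ t ∈ K)
    (hKu : ∀ s ∈ K, ∀ t ∈ K, s ∪ t ∈ K)
    (hK : ∀ F : ℕ → Set T, (∀ n, F n ∈ K) → Antitone F → (⋂ n, F n) = ∅ →
      Tendsto (fun n => m (F n)) atTop (nhds 0))
    (hgen : mT ≤ MeasurableSpace.generateFrom (approxAlg m K)) :
    ∃ ρ : Measure T, ∀ s ∈ approxAlg m K, MeasurableSet s → ρ s = ENNReal.ofReal (m s) := by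
  have halg := approxAlg_isSetAlgebra h0 hnn hadd hKe hKuniv hKi hKu
  let M : AddContent ℝ≥0∞ (approxAlg m K) :=
    { toFun := fun s => ENNReal.ofReal (m s)
      empty' := by simp [h0]
      sUnion' := by
        intro I _ hd _
        rw [fa_sUnion h0 hadd I hd, ENNReal.ofReal_sum_of_nonneg fun _ _ => hnn _] }
  have hM : ∀ s, M s = ENNReal.ofReal (m s) := fun s => rfl
  have hsub : M.IsSigmaSubadditive := by
    refine isSigmaSubadditive_of_addContent_iUnion_eq_tsum halg.isSetRing ?_
    refine addContent_iUnion_eq_sum_of_tendsto_zero halg.isSetRing M (by simp [hM]) ?_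
    intro s hs ha he
    have := approx_tendsto hnn hadd hKi hK s (fun n => (hs n).1) ha he
    simpa [hM] using ENNReal.tendsto_ofReal this
  refine ⟨(@AddContent.measure T _ (MeasurableSpace.generateFrom (approxAlg m K)) M
    halg.isSetRing.isSetSemiring le_rfl hsub).trim hgen, fun s hs hsm => ?_⟩
  rw [trim_measurableSet_eq _ hsm]
  exact @AddContent.measure_eq T _ s (MeasurableSpace.generateFrom (approxAlg m K)) M
    halg.isSetRing.isSetSemiring rfl hsub hs

end abstractExt

/-- Sets over `Ω` with compact sections, taking finitely many values. -/
def kclass (Ω Z : Type*) [MeasurableSpace Ω] [TopologicalSpace Z] : Set (Set (Ω × Z)) :=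
  {F | ∃ s : SimpleFunc Ω (Set Z), (∀ ω, IsCompact (s ω)) ∧ F = {q | q.2 ∈ s q.1}}

theorem kclass_empty {Ω Z : Type*} [MeasurableSpace Ω] [TopologicalSpace Z] :
    ∅ ∈ kclass Ω Z :=
  ⟨SimpleFunc.const Ω ∅, by simp, by ext; simp⟩

theorem kclass_inter {Ω Z : Type*} [MeasurableSpace Ω] [TopologicalSpace Z] [T2Space Z] :
    ∀ s ∈ kclass Ω Z, ∀ t ∈ kclass Ω Z, s ∩ t ∈ kclass Ω Z := by
  rintro _ ⟨s, hs, rfl⟩ _ ⟨t, ht, rfl⟩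
  exact ⟨(s.pair t).map (fun p : Set Z × Set Z => p.1 ∩ p.2), fun ω => (hs ω).inter (ht ω), by ext; simp⟩

theorem kclass_union {Ω Z : Type*} [MeasurableSpace Ω] [TopologicalSpace Z] :
    ∀ s ∈ kclass Ω Z, ∀ t ∈ kclass Ω Z, s ∪ t ∈ kclass Ω Z := by
  rintro _ ⟨s, hs, rfl⟩ _ ⟨t, ht, rfl⟩
  exact ⟨(s.pair t).map (fun p : Set Z × Set Z => p.1 ∪ p.2), fun ω => (hs ω).union (ht ω), by ext; simp⟩

theorem kclass_tendsto {Ω Z : Type*} [MeasurableSpace Ω] [TopologicalSpace Z] [T2Space Z]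
    (P : Measure Ω) [IsFiniteMeasure P] {m : Set (Ω × Z) → ℝ} (hnn : ∀ s, 0 ≤ m s)
    (hadd : ∀ s t, Disjoint s t → m (s ∪ t) = m s + m t)
    (hP : ∀ A, MeasurableSet A → m (Prod.fst ⁻¹' A) = P.real A)
    (F : ℕ → Set (Ω × Z)) (hF : ∀ n, F n ∈ kclass Ω Z) (hanti : Antitone F)
    (hemp : (⋂ n, F n) = ∅) : Tendsto (fun n => m (F n)) atTop (nhds 0) := by
  choose s hs hFs using hF
  let A : ℕ → Set Ω := fun n => {ω | (s n ω).Nonempty}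
  have hA : ∀ n, MeasurableSet (A n) := fun n => (s n).measurableSet_preimage {t | t.Nonempty}
  have hsub : ∀ ω n k, n ≤ k → s k ω ⊆ s n ω := by
    intro ω n k hnk z hz
    have : (ω, z) ∈ F k := by rw [hFs]; exact hz
    have := hanti hnk this
    rw [hFs] at this; exact this
  have hAanti : Antitone A := fun n k hnk ω hω => hω.mono (hsub ω n k hnk)
  have hAe : (⋂ n, A n) = ∅ := by
    rw [Set.eq_empty_iff_forall_notMem]
    intro ω hω
    rw [Set.mem_iInter] at hω
    obtain ⟨z, hz⟩ := IsCompact.nonempty_iInter_of_sequence_nonempty_isCompact_isClosed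
      (fun n => s n ω) (fun n => hsub ω n (n + 1) (Nat.le_succ n)) hω (hs 0 ω)
      (fun n => (hs n ω).isClosed)
    have : (ω, z) ∈ ⋂ n, F n := by
      rw [Set.mem_iInter] at hz ⊢
      intro n; rw [hFs]; exact hz n
    rw [hemp] at this; exact this
  have h1 : Tendsto (fun n => P.real (A n)) atTop (nhds 0) := by
    have := tendsto_measure_iInter_atTop (μ := P) (fun n => (hA n).nullMeasurableSet) hAanti
      ⟨0, measure_ne_top _ _⟩
    rw [hAe, measure_empty] at this
    exact (ENNReal.tendsto_toReal ENNReal.zero_ne_top).comp this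
  refine squeeze_zero (fun n => hnn _) (fun n => ?_) h1
  rw [← hP _ (hA n)]
  refine fa_mono hnn hadd ?_
  rintro ⟨ω, z⟩ hz
  rw [hFs] at hz
  exact ⟨z, hz⟩

section rect
variable {Ω X Y : Type*} [MeasurableSpace Ω]
    [TopologicalSpace X] [PolishSpace X] [MeasurableSpace X] [BorelSpace X]
    [TopologicalSpace Y] [PolishSpace Y] [MeasurableSpace Y] [BorelSpace Y]
    {m : Set (Ω × X × Y) → ℝ}

theorem exists_compact_real (μX : Measure X) [IsFiniteMeasure μX] {B : Set X}
    (hB : MeasurableSet B) {ε : ℝ} (hε : 0 < ε) :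
    ∃ K ⊆ B, IsCompact K ∧ μX.real (B \ K) ≤ ε := by
  obtain ⟨K, hKB, hK, h⟩ := hB.exists_isCompact_sdiff_lt (μ := μX) (measure_ne_top _ _)
    (ε := ENNReal.ofReal ε) (by simpa using hε)
  exact ⟨K, hKB, hK, ENNReal.toReal_le_of_le_ofReal hε.le h.le⟩

theorem rect_innerApprox (hnn : ∀ s, 0 ≤ m s)
    (hadd : ∀ s t, Disjoint s t → m (s ∪ t) = m s + m t)
    (μX : Measure X) [IsFiniteMeasure μX] (μY : Measure Y) [IsFiniteMeasure μY]
    (hX : ∀ B, MeasurableSet B → m {q | q.2.1 ∈ B} = μX.real B)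
    (hY : ∀ B, MeasurableSet B → m {q | q.2.2 ∈ B} = μY.real B)
    {A : Set Ω} {B : Set X} {C : Set Y} (hA : MeasurableSet A) (hB : MeasurableSet B)
    (hC : MeasurableSet C) : InnerApprox m (kclass Ω (X × Y)) (A ×ˢ B ×ˢ C) := by
  intro ε hε
  obtain ⟨K, hKB, hK, hK'⟩ := exists_compact_real μX hB (half_pos hε)
  obtain ⟨L, hLC, hL, hL'⟩ := exists_compact_real μY hC (half_pos hε)
  refine ⟨A ×ˢ K ×ˢ L, ⟨SimpleFunc.piecewise A hA (SimpleFunc.const Ω (K ×ˢ L))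
    (SimpleFunc.const Ω ∅), ?_, ?_⟩, ?_, ?_⟩
  · intro ω
    by_cases h : ω ∈ A
    · simpa [SimpleFunc.piecewise_apply, h] using hK.prod hL
    · simp [SimpleFunc.piecewise_apply, h]
  · ext ⟨ω, x, y⟩
    by_cases h : ω ∈ A
    · simp [SimpleFunc.piecewise_apply, h]
    · simp [SimpleFunc.piecewise_apply, h]
  · exact Set.prod_mono subset_rfl (Set.prod_mono hKB hLC)
  · have h1 : A ×ˢ B ×ˢ C \ A ×ˢ K ×ˢ L ⊆
        ({q | q.2.1 ∈ B \ K} ∪ {q | q.2.2 ∈ C \ L} : Set (Ω × X × Y)) := by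
      rintro ⟨ω, x, y⟩ h
      simp only [Set.mem_sdiff, Set.mem_prod, Set.mem_union, Set.mem_ofPred_eq] at *
      tauto
    have h2 := fa_mono hnn hadd h1
    have h3 := fa_subadd hnn hadd ({q | q.2.1 ∈ B \ K} : Set (Ω × X × Y)) {q | q.2.2 ∈ C \ L}
    rw [hX _ (hB.diff hK.measurableSet), hY _ (hC.diff hL.measurableSet)] at h3
    linarith

theorem rect_mem (hnn : ∀ s, 0 ≤ m s)
    (hadd : ∀ s t, Disjoint s t → m (s ∪ t) = m s + m t)
    (μX : Measure X) [IsFiniteMeasure μX] (μY : Measure Y) [IsFiniteMeasure μY]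
    (hX : ∀ B, MeasurableSet B → m {q | q.2.1 ∈ B} = μX.real B)
    (hY : ∀ B, MeasurableSet B → m {q | q.2.2 ∈ B} = μY.real B)
    {A : Set Ω} {B : Set X} {C : Set Y} (hA : MeasurableSet A) (hB : MeasurableSet B)
    (hC : MeasurableSet C) : A ×ˢ B ×ˢ C ∈ approxAlg m (kclass Ω (X × Y)) := by
  refine ⟨rect_innerApprox hnn hadd μX μY hX hY hA hB hC, ?_⟩
  have : (A ×ˢ B ×ˢ C)ᶜ = (Aᶜ ×ˢ (Set.univ : Set X) ×ˢ (Set.univ : Set Y)) ∪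
      (((Set.univ : Set Ω) ×ˢ Bᶜ ×ˢ (Set.univ : Set Y)) ∪
      ((Set.univ : Set Ω) ×ˢ (Set.univ : Set X) ×ˢ Cᶜ)) := by
    ext ⟨ω, x, y⟩
    simp only [Set.mem_compl_iff, Set.mem_prod, Set.mem_union, Set.mem_univ]
    tauto
  rw [this]
  exact innerApprox_union hnn hadd kclass_union
    (rect_innerApprox hnn hadd μX μY hX hY hA.compl .univ .univ)
    (innerApprox_union hnn hadd kclass_union
      (rect_innerApprox hnn hadd μX μY hX hY .univ hB.compl .univ)
      (rect_innerApprox hnn hadd μX μY hX hY .univ .univ hC.compl))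

theorem exists_measure_rect (P : Measure Ω) [IsFiniteMeasure P] (h0 : m ∅ = 0)
    (hnn : ∀ s, 0 ≤ m s)
    (hadd : ∀ s t, Disjoint s t → m (s ∪ t) = m s + m t)
    (μX : Measure X) [IsFiniteMeasure μX] (μY : Measure Y) [IsFiniteMeasure μY]
    (hP : ∀ A, MeasurableSet A → m (Prod.fst ⁻¹' A) = P.real A)
    (hX : ∀ B, MeasurableSet B → m {q | q.2.1 ∈ B} = μX.real B)
    (hY : ∀ B, MeasurableSet B → m {q | q.2.2 ∈ B} = μY.real B) :
    IsSetAlgebra (approxAlg m (kclass Ω (X × Y))) ∧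
    ∃ ρ : Measure (Ω × X × Y), ∀ s ∈ approxAlg m (kclass Ω (X × Y)), MeasurableSet s →
      ρ s = ENNReal.ofReal (m s) := by
  have hr := fun (A : Set Ω) (B : Set X) (C : Set Y) (hA : MeasurableSet A)
    (hB : MeasurableSet B) (hC : MeasurableSet C) => rect_mem hnn hadd μX μY hX hY hA hB hC
  have hu : InnerApprox m (kclass Ω (X × Y)) Set.univ := by
    have := (hr _ _ _ .univ .univ .univ).1
    simpa using this
  refine ⟨approxAlg_isSetAlgebra h0 hnn hadd kclass_empty hu kclass_inter kclass_union,
    exists_measure_of_innerApprox h0 hnn hadd kclass_empty hu kclass_inter kclass_union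
    (kclass_tendsto P hnn hadd hP) ?_⟩
  change MeasurableSpace.comap Prod.fst _ ⊔ MeasurableSpace.comap Prod.snd
    (MeasurableSpace.comap Prod.fst _ ⊔ MeasurableSpace.comap Prod.snd _) ≤ _
  rw [MeasurableSpace.comap_sup, MeasurableSpace.comap_comp, MeasurableSpace.comap_comp]
  refine sup_le ?_ (sup_le ?_ ?_)
  · rintro _ ⟨s, hs, rfl⟩
    refine MeasurableSpace.measurableSet_generateFrom ?_
    convert hr _ _ _ hs .univ .univ using 1
    ext; simp
  · rintro _ ⟨s, hs, rfl⟩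
    refine MeasurableSpace.measurableSet_generateFrom ?_
    convert hr _ _ _ .univ hs .univ using 1
    ext; simp
  · rintro _ ⟨s, hs, rfl⟩
    refine MeasurableSpace.measurableSet_generateFrom ?_
    convert hr _ _ _ .univ .univ hs using 1
    ext; simp

end rect

section simple
variable {T : Type*}

theorem indicator_mem_bdd (s : Set T) : s.indicator (fun _ => (1 : ℝ)) ∈ bddFun T :=
  ⟨1, fun t => by by_cases h : t ∈ s <;> simp [h]⟩

/-- The finitely additive set function of a functional on bounded functions. -/
noncomputable def setFun (ℓ : bddFun T →ₗ[ℝ] ℝ) (s : Set T) : ℝ :=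
  ℓ ⟨s.indicator (fun _ => (1 : ℝ)), indicator_mem_bdd s⟩

theorem setFun_empty (ℓ : bddFun T →ₗ[ℝ] ℝ) : setFun ℓ ∅ = 0 := by
  have : (⟨(∅ : Set T).indicator (fun _ => (1 : ℝ)), indicator_mem_bdd ∅⟩ : bddFun T) = 0 := by
    ext; simp
  rw [setFun, this, map_zero]

theorem setFun_nonneg (ℓ : bddFun T →ₗ[ℝ] ℝ)
    (hℓ : ∀ f : bddFun T, (∀ t, 0 ≤ (f : T → ℝ) t) → 0 ≤ ℓ f) (s : Set T) : 0 ≤ setFun ℓ s :=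
  hℓ _ fun t => Set.indicator_nonneg (fun _ _ => zero_le_one) t

theorem setFun_add (ℓ : bddFun T →ₗ[ℝ] ℝ) (s t : Set T) (h : Disjoint s t) :
    setFun ℓ (s ∪ t) = setFun ℓ s + setFun ℓ t := by
  rw [setFun, setFun, setFun, ← map_add]
  congr 1
  ext x
  simp [Set.indicator_union_of_disjoint h]

theorem lintegral_eq_functional [MeasurableSpace T] (ℓ : bddFun T →ₗ[ℝ] ℝ)
    (hℓ : ∀ f : bddFun T, (∀ t, 0 ≤ (f : T → ℝ) t) → 0 ≤ ℓ f) (ρ : Measure T)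
    (f : bddFun T) (hf0 : ∀ t, 0 ≤ (f : T → ℝ) t) (hfin : (Set.range (f : T → ℝ)).Finite)
    (hm : ∀ r, MeasurableSet ((f : T → ℝ) ⁻¹' {r}))
    (hρ : ∀ r, ρ ((f : T → ℝ) ⁻¹' {r}) = ENNReal.ofReal (setFun ℓ ((f : T → ℝ) ⁻¹' {r}))) :
    ∫⁻ t, ENNReal.ofReal ((f : T → ℝ) t) ∂ρ = ENNReal.ofReal (ℓ f) := by
  have hI : ∀ t, (f : T → ℝ) t ∈ hfin.toFinset := fun t => by simp
  have hI0 : ∀ r ∈ hfin.toFinset, 0 ≤ r := by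
    intro r hr
    simp only [Set.Finite.mem_toFinset, Set.mem_range] at hr
    obtain ⟨t, rfl⟩ := hr
    exact hf0 t
  have h1 : f = ∑ r ∈ hfin.toFinset, r • (⟨((f : T → ℝ) ⁻¹' {r}).indicator (fun _ => (1 : ℝ)),
      indicator_mem_bdd _⟩ : bddFun T) := by
    ext t
    simp only [Submodule.coe_sum, Submodule.coe_smul, Finset.sum_apply, Pi.smul_apply, smul_eq_mul]
    rw [Finset.sum_eq_single_of_mem _ (hI t)]
    · simp
    · intro r _ hr
      simp [hr.symm]
  have h2 : ∀ t, ENNReal.ofReal ((f : T → ℝ) t) = ∑ r ∈ hfin.toFinset,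
      ENNReal.ofReal r * ((f : T → ℝ) ⁻¹' {r}).indicator (fun _ => (1 : ℝ≥0∞)) t := by
    intro t
    rw [Finset.sum_eq_single_of_mem _ (hI t)]
    · simp
    · intro r _ hr
      simp [hr.symm]
  have h3 : ℓ f = ∑ r ∈ hfin.toFinset, r * setFun ℓ ((f : T → ℝ) ⁻¹' {r}) := by
    conv_lhs => rw [h1]
    rw [map_sum]
    simp only [map_smul, smul_eq_mul, setFun]
  rw [h3, ENNReal.ofReal_sum_of_nonneg fun r hr => mul_nonneg (hI0 r hr) (setFun_nonneg ℓ hℓ _)]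
  simp_rw [h2]
  rw [lintegral_finsetSum _ fun r _ => (measurable_const.indicator (hm r)).const_mul _]
  refine Finset.sum_congr rfl fun r hr => ?_
  rw [lintegral_const_mul _ (measurable_const.indicator (hm r)), ENNReal.ofReal_mul (hI0 r hr),
    ← hρ r]
  congr 1
  exact lintegral_indicator_one (hm r)

/-- Running maxima of multiples of indicators. -/
noncomputable def maxSeq (R : ℕ → Set T) (q : ℕ → ℝ) : ℕ → T → ℝ
  | 0 => fun _ => 0
  | n + 1 => fun t => max (maxSeq R q n t) ((R n).indicator (fun _ => q n) t)

theorem maxSeq_nonneg (R : ℕ → Set T) (q : ℕ → ℝ) (n : ℕ) (t : T) : 0 ≤ maxSeq R q n t := by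
  induction n with
  | zero => exact le_rfl
  | succ n ih => exact ih.trans (le_max_left _ _)

theorem maxSeq_mono (R : ℕ → Set T) (q : ℕ → ℝ) (t : T) : Monotone fun n => maxSeq R q n t :=
  monotone_nat_of_le_succ fun _ => le_max_left _ _

theorem maxSeq_preimage {C : Set (Set T)} (hC : IsSetAlgebra C) (R : ℕ → Set T)
    (hR : ∀ n, R n ∈ C) (q : ℕ → ℝ) (n : ℕ) (S : Set ℝ) : maxSeq R q n ⁻¹' S ∈ C := by
  induction n generalizing S with
  | zero =>
    by_cases h : (0 : ℝ) ∈ S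
    · convert hC.univ_mem using 1
      ext; simp [maxSeq, h]
    · convert hC.empty_mem using 1
      ext; simp [maxSeq, h]
  | succ n ih =>
    have : maxSeq R q (n + 1) ⁻¹' S =
        ((R n) ∩ maxSeq R q n ⁻¹' {r | max r (q n) ∈ S}) ∪ ((R n)ᶜ ∩ maxSeq R q n ⁻¹' S) := by
      ext t
      by_cases h : t ∈ R n
      · simp [maxSeq, h]
      · simp [maxSeq, h, max_eq_left (maxSeq_nonneg R q n t)]
    rw [this]
    exact hC.union_mem (hC.inter_mem (hR n) (ih _)) (hC.inter_mem (hC.compl_mem (hR n)) (ih _))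

theorem maxSeq_finite (R : ℕ → Set T) (q : ℕ → ℝ) (n : ℕ) :
    (Set.range (maxSeq R q n)).Finite := by
  induction n with
  | zero => exact (Set.finite_singleton (0 : ℝ)).subset (by rintro _ ⟨t, rfl⟩; simp [maxSeq])
  | succ n ih =>
    refine ((ih.image fun r => max r (q n)).union ih).subset ?_
    rintro _ ⟨t, rfl⟩
    by_cases h : t ∈ R n
    · left; exact ⟨_, ⟨t, rfl⟩, by simp [maxSeq, h]⟩
    · right; exact ⟨t, by simp [maxSeq, h, max_eq_left (maxSeq_nonneg R q n t)]⟩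

theorem maxSeq_bdd (R : ℕ → Set T) (q : ℕ → ℝ) (n : ℕ) : maxSeq R q n ∈ bddFun T := by
  obtain ⟨C, hC⟩ := (maxSeq_finite R q n).bddAbove
  exact ⟨C, fun t => by rw [abs_of_nonneg (maxSeq_nonneg R q n t)]; exact hC ⟨t, rfl⟩⟩

theorem lintegral_le_of_sup [MeasurableSpace T] (ℓ : bddFun T →ₗ[ℝ] ℝ)
    (hℓ : ∀ f : bddFun T, (∀ t, 0 ≤ (f : T → ℝ) t) → 0 ≤ ℓ f) (ρ : Measure T)
    (c : T → ℝ) (hc : ∀ t, 0 ≤ c t) (S : ℝ)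
    (hS : ∀ f : bddFun T, (∀ t, (f : T → ℝ) t ≤ c t) → ℓ f ≤ S)
    {C : Set (Set T)} (hC : IsSetAlgebra C)
    (hρ : ∀ s ∈ C, MeasurableSet s → ρ s = ENNReal.ofReal (setFun ℓ s))
    (R : ℕ → Set T) (q : ℕ → ℝ) (hR : ∀ n, R n ∈ C) (hRm : ∀ n, MeasurableSet (R n))
    (hle : ∀ n, ∀ t ∈ R n, q n ≤ c t)
    (hsup : ∀ t r, 0 ≤ r → r < c t → ∃ n, t ∈ R n ∧ r < q n) :
    ∫⁻ t, ENNReal.ofReal (c t) ∂ρ ≤ ENNReal.ofReal S := by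
  have hgm : ∀ n, ∀ S, MeasurableSet (maxSeq R q n ⁻¹' S) := fun n S =>
    maxSeq_preimage (C := {s | MeasurableSet s})
      ⟨MeasurableSet.empty, fun _ h => MeasurableSet.compl h,
        fun _ _ h h' => MeasurableSet.union h h'⟩ R hRm q n S
  have hgc : ∀ n t, maxSeq R q n t ≤ c t := by
    intro n t
    induction n with
    | zero => exact hc t
    | succ n ih =>
      refine max_le ih ?_
      by_cases h : t ∈ R n
      · simpa [h] using hle n t h
      · simpa [h] using hc t
  have hint : ∀ n, ∫⁻ t, ENNReal.ofReal (maxSeq R q n t) ∂ρ ≤ ENNReal.ofReal S := by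
    intro n
    refine (lintegral_eq_functional ℓ hℓ ρ ⟨maxSeq R q n, maxSeq_bdd R q n⟩
      (maxSeq_nonneg R q n) (maxSeq_finite R q n) (fun r => hgm n _)
      (fun r => hρ _ (maxSeq_preimage hC R hR q n _) (hgm n _))).trans_le ?_
    exact ENNReal.ofReal_le_ofReal (hS _ (hgc n))
  have hsup' : ∀ t, ENNReal.ofReal (c t) ≤ ⨆ n, ENNReal.ofReal (maxSeq R q n t) := by
    intro t
    refine le_of_forall_lt fun b hb => ?_
    have hbt : b ≠ ⊤ := hb.ne_top
    have h1 : b.toReal < c t := (ENNReal.lt_ofReal_iff_toReal_lt hbt).1 hb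
    obtain ⟨n, htn, hn⟩ := hsup t b.toReal ENNReal.toReal_nonneg h1
    refine lt_of_lt_of_le ?_ (le_iSup _ (n + 1))
    rw [ENNReal.lt_ofReal_iff_toReal_lt hbt]
    refine hn.trans_le ?_
    simp [maxSeq, htn]
  calc ∫⁻ t, ENNReal.ofReal (c t) ∂ρ ≤ ∫⁻ t, ⨆ n, ENNReal.ofReal (maxSeq R q n t) ∂ρ :=
        lintegral_mono hsup'
    _ = ⨆ n, ∫⁻ t, ENNReal.ofReal (maxSeq R q n t) ∂ρ := by
        refine lintegral_iSup (fun n => ?_) fun i j hij t =>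
          ENNReal.ofReal_le_ofReal (maxSeq_mono R q t hij)
        exact ENNReal.measurable_ofReal.comp fun s _ => hgm n s
    _ ≤ _ := iSup_le hint

end simple

theorem exists_rect_rep {Ω X Y : Type*} [MeasurableSpace Ω]
    [TopologicalSpace X] [PolishSpace X] [MeasurableSpace X] [BorelSpace X]
    [TopologicalSpace Y] [PolishSpace Y] [MeasurableSpace Y] [BorelSpace Y]
    [Nonempty X] [Nonempty Y]
    (c : Ω → X → Y → ℝ)
    (hc_cont : ∀ ω, Continuous (fun q : X × Y => c ω q.1 q.2))
    (hc_meas : ∀ x y, Measurable (fun ω => c ω x y)) :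
    ∃ (A : ℕ → Set Ω) (U : ℕ → Set X) (V : ℕ → Set Y) (q : ℕ → ℝ),
      (∀ n, MeasurableSet (A n)) ∧ (∀ n, MeasurableSet (U n)) ∧ (∀ n, MeasurableSet (V n)) ∧
      (∀ n, ∀ ω ∈ A n, ∀ x ∈ U n, ∀ y ∈ V n, q n ≤ c ω x y) ∧
      (∀ ω x y r, r < c ω x y → ∃ n, ω ∈ A n ∧ x ∈ U n ∧ y ∈ V n ∧ r < q n) := by
  have bX := TopologicalSpace.isBasis_countableBasis X
  have bY := TopologicalSpace.isBasis_countableBasis Y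
  let ι := TopologicalSpace.countableBasis X × TopologicalSpace.countableBasis Y × ℚ
  have hcX : Countable (TopologicalSpace.countableBasis X) :=
    (TopologicalSpace.countable_countableBasis X).to_subtype
  have hcY : Countable (TopologicalSpace.countableBasis Y) :=
    (TopologicalSpace.countable_countableBasis Y).to_subtype
  have hne : Nonempty ι := by
    obtain ⟨u, hu, -⟩ := bX.exists_subset_of_mem_open (Set.mem_univ (Classical.arbitrary X))
      isOpen_univ
    obtain ⟨v, hv, -⟩ := bY.exists_subset_of_mem_open (Set.mem_univ (Classical.arbitrary Y))
      isOpen_univ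
    exact ⟨⟨u, hu⟩, ⟨v, hv⟩, 0⟩
  obtain ⟨e, he⟩ := exists_surjective_nat ι
  have hUo : ∀ n, IsOpen ((e n).1 : Set X) := fun n => bX.isOpen (e n).1.2
  have hVo : ∀ n, IsOpen ((e n).2.1 : Set Y) := fun n => bY.isOpen (e n).2.1.2
  refine ⟨fun n => {ω | ∀ x ∈ ((e n).1 : Set X), ∀ y ∈ ((e n).2.1 : Set Y),
    ((e n).2.2 : ℝ) ≤ c ω x y}, fun n => (e n).1, fun n => (e n).2.1, fun n => ((e n).2.2 : ℝ),
    fun n => ?_, fun n => (hUo n).measurableSet, fun n => (hVo n).measurableSet,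
    fun n ω hω x hx y hy => hω x hx y hy, ?_⟩
  · obtain ⟨D, hDc, hDd⟩ := TopologicalSpace.exists_countable_dense (X × Y)
    have : {ω | ∀ x ∈ ((e n).1 : Set X), ∀ y ∈ ((e n).2.1 : Set Y),
        ((e n).2.2 : ℝ) ≤ c ω x y} =
        ⋂ d ∈ D ∩ (((e n).1 : Set X) ×ˢ ((e n).2.1 : Set Y)),
          {ω | ((e n).2.2 : ℝ) ≤ c ω d.1 d.2} := by
      ext ω
      simp only [Set.mem_iInter, Set.mem_ofPred_eq]
      constructor
      · intro h d hd
        exact h _ hd.2.1 _ hd.2.2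
      · intro h x hx y hy
        have h1 : IsClosed {z : X × Y | ((e n).2.2 : ℝ) ≤ c ω z.1 z.2} :=
          isClosed_le continuous_const (hc_cont ω)
        have h2 := hDd.open_subset_closure_inter ((hUo n).prod (hVo n))
        have h3 := closure_minimal (s := (((e n).1 : Set X) ×ˢ ((e n).2.1 : Set Y)) ∩ D)
          (fun d hd => h d ⟨hd.2, hd.1⟩) h1
        exact h3 (h2 (Set.mk_mem_prod hx hy))
    refine (congrArg MeasurableSet this).mpr ?_
    exact MeasurableSet.biInter (hDc.mono Set.inter_subset_left) fun d _ =>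
      measurableSet_le measurable_const (hc_meas _ _)
  · intro ω x y r hr
    obtain ⟨a, hra, hac⟩ := exists_rat_btwn hr
    have h1 : IsOpen {z : X × Y | (a : ℝ) < c ω z.1 z.2} :=
      isOpen_lt continuous_const (hc_cont ω)
    obtain ⟨u, v, hu, hv, hxu, hyv, huv⟩ := isOpen_prod_iff.1 h1 x y hac
    obtain ⟨u', hu', hxu', huu'⟩ := bX.exists_subset_of_mem_open hxu hu
    obtain ⟨v', hv', hyv', hvv'⟩ := bY.exists_subset_of_mem_open hyv hv
    obtain ⟨n, hn⟩ := he ⟨⟨u', hu'⟩, ⟨v', hv'⟩, a⟩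
    refine ⟨n, ?_⟩
    simp only [hn, Set.mem_ofPred_eq]
    refine ⟨fun x hx y hy => ?_, hxu', hyv', hra⟩
    exact le_of_lt (huv (Set.mk_mem_prod (huu' hx) (hvv' hy)))

theorem ofReal_integral_le_lintegral' {α : Type*} [MeasurableSpace α] (P : Measure α) (F : α → ℝ) :
    ENNReal.ofReal (∫ a, F a ∂P) ≤ ∫⁻ a, ENNReal.ofReal (F a) ∂P := by
  by_cases h : Integrable F P
  · rw [integral_eq_lintegral_pos_part_sub_lintegral_neg_part h]
    refine (ENNReal.ofReal_le_ofReal (sub_le_self _ ENNReal.toReal_nonneg)).trans ?_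
    exact ENNReal.ofReal_toReal_le
  · rw [integral_undef h]; simp

section coupling
variable {Ω X Y : Type*} [MeasurableSpace Ω]
    [TopologicalSpace X] [PolishSpace X] [MeasurableSpace X] [BorelSpace X]
    [TopologicalSpace Y] [PolishSpace Y] [MeasurableSpace Y] [BorelSpace Y]

theorem weak_duality (P : Measure Ω) (μ : Kernel Ω X) [IsMarkovKernel μ]
    (ν : Kernel Ω Y) [IsMarkovKernel ν] (c : Ω → X → Y → ℝ) (π : Kernel Ω (X × Y))
    (hfst : π.fst = μ) (hsnd : π.snd = ν) (ψ : Ω → X → ℝ) (φ : Ω → Y → ℝ)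
    (hψ : Measurable fun q : Ω × X => ψ q.1 q.2) (hφ : Measurable fun q : Ω × Y => φ q.1 q.2)
    (hψi : ∫⁻ ω, ∫⁻ x, ENNReal.ofReal |ψ ω x| ∂(μ ω) ∂P < ⊤)
    (hφi : ∫⁻ ω, ∫⁻ y, ENNReal.ofReal |φ ω y| ∂(ν ω) ∂P < ⊤)
    (hle : ∀ ω x y, φ ω y - ψ ω x ≤ c ω x y) :
    ENNReal.ofReal (∫ ω, ((∫ y, φ ω y ∂(ν ω)) - (∫ x, ψ ω x ∂(μ ω))) ∂P) ≤
      ∫⁻ ω, ∫⁻ q, ENNReal.ofReal (c ω q.1 q.2) ∂(π ω) ∂P := by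
  refine (ofReal_integral_le_lintegral' _ _).trans (lintegral_mono_ae ?_)
  have h1 := ae_lt_top (Measurable.lintegral_kernel_prod_right (κ := μ)
    (f := fun ω x => ENNReal.ofReal |ψ ω x|) (by
      exact ENNReal.measurable_ofReal.comp (continuous_abs.measurable.comp hψ))) hψi.ne
  have h2 := ae_lt_top (Measurable.lintegral_kernel_prod_right (κ := ν)
    (f := fun ω x => ENNReal.ofReal |φ ω x|) (by
      exact ENNReal.measurable_ofReal.comp (continuous_abs.measurable.comp hφ))) hφi.ne
  filter_upwards [h1, h2] with ω h1 h2
  have mψ : Measurable (ψ ω) := hψ.comp measurable_prodMk_left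
  have mφ : Measurable (φ ω) := hφ.comp measurable_prodMk_left
  have iψ : Integrable (ψ ω) (μ ω) := by
    refine ⟨mψ.aestronglyMeasurable, ?_⟩
    rw [hasFiniteIntegral_iff_norm]; exact h1
  have iφ : Integrable (φ ω) (ν ω) := by
    refine ⟨mφ.aestronglyMeasurable, ?_⟩
    rw [hasFiniteIntegral_iff_norm]; exact h2
  have eμ : μ ω = (π ω).map Prod.fst := by rw [← hfst, Kernel.fst_apply]
  have eν : ν ω = (π ω).map Prod.snd := by rw [← hsnd, Kernel.snd_apply]
  rw [eμ] at iψ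
  rw [eν] at iφ
  rw [eμ, eν, integral_map measurable_fst.aemeasurable mψ.aestronglyMeasurable,
    integral_map measurable_snd.aemeasurable mφ.aestronglyMeasurable,
    ← integral_sub (f := fun q : X × Y => φ ω q.2) (g := fun q : X × Y => ψ ω q.1)
      (iφ.comp_measurable measurable_snd) (iψ.comp_measurable measurable_fst)]
  refine (ofReal_integral_le_lintegral' _ _).trans (lintegral_mono fun q => ?_)
  exact ENNReal.ofReal_le_ofReal (hle _ _ _)

theorem exists_coupling [Nonempty X] [Nonempty Y] (P : Measure Ω) [IsProbabilityMeasure P]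
    (μ : Kernel Ω X) [IsMarkovKernel μ]
    (ν : Kernel Ω Y) [IsMarkovKernel ν] (c : Ω → X → Y → ℝ)
    (hcm : Measurable fun q : Ω × X × Y => c q.1 q.2.1 q.2.2)
    (ρ : Measure (Ω × X × Y))
    (hX : ∀ A B, MeasurableSet A → MeasurableSet B →
      ρ (A ×ˢ B ×ˢ Set.univ) = (P ⊗ₘ μ) (A ×ˢ B))
    (hY : ∀ A B, MeasurableSet A → MeasurableSet B →
      ρ (A ×ˢ Set.univ ×ˢ B) = (P ⊗ₘ ν) (A ×ˢ B)) :
    ∃ π : Kernel Ω (X × Y), (IsMarkovKernel π ∧ π.fst = μ ∧ π.snd = ν) ∧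
      ∫⁻ ω, ∫⁻ q, ENNReal.ofReal (c ω q.1 q.2) ∂(π ω) ∂P =
        ∫⁻ q, ENNReal.ofReal (c q.1 q.2.1 q.2.2) ∂ρ := by
  have hfst : ρ.fst = P := by
    ext A hA
    have h := hX A Set.univ hA .univ
    rw [Set.univ_prod_univ, Set.prod_univ, Set.prod_univ] at h
    rw [Measure.fst_apply hA, h, ← Measure.fst_apply hA, Measure.fst_compProd]
  have : IsProbabilityMeasure ρ := by
    constructor
    rw [← Measure.fst_univ, hfst, measure_univ]
  let κ : Kernel Ω (X × Y) := ρ.condKernel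
  have hκ : P ⊗ₘ κ = ρ := by
    have := ρ.disintegrate ρ.condKernel
    rwa [hfst] at this
  have e1 : κ.fst =ᵐ[P] μ := by
    refine Kernel.ae_eq_of_compProd_eq (Measure.ext_prod fun {A B} hA hB => ?_)
    rw [← hX A B hA hB, ← hκ, Measure.compProd_apply_prod hA hB,
      Measure.compProd_apply_prod hA (hB.prod .univ)]
    refine lintegral_congr fun ω => ?_
    rw [Kernel.fst_apply' _ _ hB]
    congr 1; ext; simp
  have e2 : κ.snd =ᵐ[P] ν := by
    refine Kernel.ae_eq_of_compProd_eq (Measure.ext_prod fun {A B} hA hB => ?_)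
    rw [← hY A B hA hB, ← hκ, Measure.compProd_apply_prod hA hB,
      Measure.compProd_apply_prod hA (MeasurableSet.univ.prod hB)]
    refine lintegral_congr fun ω => ?_
    rw [Kernel.snd_apply' _ _ hB]
    congr 1; ext; simp
  obtain ⟨G, hGs, hGm, hGP⟩ := (e1.and e2).exists_measurable_mem
  classical
  let π : Kernel Ω (X × Y) := Kernel.piecewise hGm κ (μ ×ₖ ν)
  have hπ : ∀ ω, π ω = if ω ∈ G then κ ω else (μ ×ₖ ν) ω := fun ω => Kernel.piecewise_apply ω
  refine ⟨π, ⟨inferInstance, ?_, ?_⟩, ?_⟩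
  · ext1 ω
    rw [Kernel.fst_apply, hπ]
    split_ifs with h
    · rw [← Kernel.fst_apply]; exact (hGP ω h).1
    · rw [← Kernel.fst_apply, Kernel.fst_prod]
  · ext1 ω
    rw [Kernel.snd_apply, hπ]
    split_ifs with h
    · rw [← Kernel.snd_apply]; exact (hGP ω h).2
    · rw [← Kernel.snd_apply, Kernel.snd_prod]
  · conv_rhs => rw [← hκ]
    rw [Measure.lintegral_compProd
      (f := fun q : Ω × X × Y => ENNReal.ofReal (c q.1 q.2.1 q.2.2))
      (ENNReal.measurable_ofReal.comp hcm)]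
    refine lintegral_congr_ae ?_
    filter_upwards [hGs] with ω hω
    rw [hπ, if_pos hω]

end coupling

section sums
variable {Ω X Y : Type*} [MeasurableSpace Ω] [MeasurableSpace X] [MeasurableSpace Y]

/-- Bounded measurable functions of the form `ψ(ω,x) + φ(ω,y)`. -/
def sumFun (Ω X Y : Type*) [MeasurableSpace Ω] [MeasurableSpace X] [MeasurableSpace Y] :
    Submodule ℝ (Ω × X × Y → ℝ) where
  carrier := {h | ∃ (ψ : Ω × X → ℝ) (φ : Ω × Y → ℝ), Measurable ψ ∧ Measurable φ ∧
    ψ ∈ bddFun _ ∧ φ ∈ bddFun _ ∧ h = fun q => ψ (q.1, q.2.1) + φ (q.1, q.2.2)}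
  add_mem' := by
    rintro _ _ ⟨ψ, φ, h1, h2, h3, h4, rfl⟩ ⟨ψ', φ', h1', h2', h3', h4', rfl⟩
    refine ⟨ψ + ψ', φ + φ', h1.add h1', h2.add h2', add_mem h3 h3', add_mem h4 h4', ?_⟩
    ext; simp; ring
  zero_mem' := ⟨0, 0, measurable_zero, measurable_zero, zero_mem _, zero_mem _, by ext; simp⟩
  smul_mem' := by
    rintro a _ ⟨ψ, φ, h1, h2, h3, h4, rfl⟩
    refine ⟨a • ψ, a • φ, h1.const_smul a, h2.const_smul a, Submodule.smul_mem _ _ h3,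
      Submodule.smul_mem _ _ h4, ?_⟩
    ext; simp; ring

theorem sumFun_le : sumFun Ω X Y ≤ bddFun _ := by
  rintro _ ⟨ψ, φ, h1, h2, ⟨C, hC⟩, ⟨D, hD⟩, rfl⟩
  exact ⟨C + D, fun t => (abs_add_le _ _).trans (add_le_add (hC _) (hD _))⟩

theorem sumFun_measurable {h : Ω × X × Y → ℝ} (hh : h ∈ sumFun Ω X Y) : Measurable h := by
  obtain ⟨ψ, φ, h1, h2, -, -, rfl⟩ := hh
  exact (h1.comp (by fun_prop)).add (h2.comp (by fun_prop))

theorem sumFun_integrable (Q : Measure (Ω × X × Y)) [IsFiniteMeasure Q]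
    {h : Ω × X × Y → ℝ} (hh : h ∈ sumFun Ω X Y) : Integrable h Q := by
  obtain ⟨C, hC⟩ := sumFun_le hh
  exact Integrable.of_bound (sumFun_measurable hh).aestronglyMeasurable C
    (Eventually.of_forall hC)

/-- Integration as a linear map on `sumFun`. -/
noncomputable def sumInt (Q : Measure (Ω × X × Y)) [IsFiniteMeasure Q] :
    sumFun Ω X Y →ₗ[ℝ] ℝ where
  toFun h := ∫ q, (h : Ω × X × Y → ℝ) q ∂Q
  map_add' f g := integral_add (sumFun_integrable Q f.2) (sumFun_integrable Q g.2)
  map_smul' a _ := integral_const_mul a _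

end sums

section strong
variable {Ω X Y : Type*} [MeasurableSpace Ω]
    [TopologicalSpace X] [PolishSpace X] [MeasurableSpace X] [BorelSpace X]
    [TopologicalSpace Y] [PolishSpace Y] [MeasurableSpace Y] [BorelSpace Y]

theorem setFun_eq_of_mem (Q : Measure (Ω × X × Y)) [IsFiniteMeasure Q]
    (ℓ : bddFun (Ω × X × Y) →ₗ[ℝ] ℝ)
    (hℓ : ∀ h : sumFun Ω X Y, ℓ ⟨h, sumFun_le h.2⟩ = sumInt Q h) (s : Set (Ω × X × Y))
    (hs : MeasurableSet s) (hmem : s.indicator (fun _ => (1 : ℝ)) ∈ sumFun Ω X Y) :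
    setFun ℓ s = Q.real s := by
  have := hℓ ⟨_, hmem⟩
  rw [setFun, this]
  exact integral_indicator_one hs

theorem indicator_sumFun_left {G : Set (Ω × X)} (hG : MeasurableSet G) :
    ({q | (q.1, q.2.1) ∈ G} : Set (Ω × X × Y)).indicator (fun _ => (1 : ℝ)) ∈ sumFun Ω X Y := by
  refine ⟨G.indicator (fun _ => 1), 0, measurable_const.indicator hG, measurable_zero,
    indicator_mem_bdd _, zero_mem _, ?_⟩
  ext q
  by_cases h : (q.1, q.2.1) ∈ G
  · have h' : q ∈ ({q | (q.1, q.2.1) ∈ G} : Set (Ω × X × Y)) := h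
    simp only [Set.indicator_of_mem h', Set.indicator_of_mem h, Pi.zero_apply, add_zero]
  · have h' : q ∉ ({q | (q.1, q.2.1) ∈ G} : Set (Ω × X × Y)) := h
    simp only [Set.indicator_of_notMem h', Set.indicator_of_notMem h, Pi.zero_apply, add_zero]

theorem indicator_sumFun_right {G : Set (Ω × Y)} (hG : MeasurableSet G) :
    ({q | (q.1, q.2.2) ∈ G} : Set (Ω × X × Y)).indicator (fun _ => (1 : ℝ)) ∈ sumFun Ω X Y := by
  refine ⟨0, G.indicator (fun _ => 1), measurable_zero, measurable_const.indicator hG,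
    zero_mem _, indicator_mem_bdd _, ?_⟩
  ext q
  by_cases h : (q.1, q.2.2) ∈ G
  · have h' : q ∈ ({q | (q.1, q.2.2) ∈ G} : Set (Ω × X × Y)) := h
    simp only [Set.indicator_of_mem h', Set.indicator_of_mem h, Pi.zero_apply, zero_add]
  · have h' : q ∉ ({q | (q.1, q.2.2) ∈ G} : Set (Ω × X × Y)) := h
    simp only [Set.indicator_of_notMem h', Set.indicator_of_notMem h, Pi.zero_apply, zero_add]

theorem strong_duality [Nonempty X] [Nonempty Y] (P : Measure Ω) [IsProbabilityMeasure P]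
    (μ : Kernel Ω X) [IsMarkovKernel μ]
    (ν : Kernel Ω Y) [IsMarkovKernel ν] (c : Ω → X → Y → ℝ)
    (hc_nonneg : ∀ ω x y, 0 ≤ c ω x y)
    (hc_cont : ∀ ω, Continuous (fun q : X × Y => c ω q.1 q.2))
    (hc_meas : ∀ x y, Measurable (fun ω => c ω x y)) (S : ℝ)
    (hS : ∀ h ∈ sumFun Ω X Y, (∀ q, h q ≤ c q.1 q.2.1 q.2.2) →
      ∫ q, h q ∂(P ⊗ₘ (μ ×ₖ ν)) ≤ S) :
    stochCost P c μ ν ≤ ENNReal.ofReal S := by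
  let Q : Measure (Ω × X × Y) := P ⊗ₘ (μ ×ₖ ν)
  have hone : (fun _ => (1 : ℝ)) ∈ sumFun Ω X Y :=
    ⟨fun _ => 1, 0, measurable_const, measurable_zero, ⟨1, by simp⟩, zero_mem _, by ext; simp⟩
  obtain ⟨ℓ, hpos, hQ, hcost⟩ := hahn_banach_dual (sumFun Ω X Y) (sumInt Q) sumFun_le
    ⟨_, hone⟩ (fun _ => rfl) (fun h hh => integral_nonneg hh)
    (fun q => c q.1 q.2.1 q.2.2) S (fun h hh => hS h h.2 hh)
  have hL : ∀ G : Set (Ω × X), MeasurableSet G →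
      setFun ℓ {q | (q.1, q.2.1) ∈ G} = Q.real {q | (q.1, q.2.1) ∈ G} := fun G hG =>
    setFun_eq_of_mem Q ℓ hQ _
      (hG.preimage (f := fun q : Ω × X × Y => (q.1, q.2.1)) (by fun_prop))
      (indicator_sumFun_left hG)
  have hR : ∀ G : Set (Ω × Y), MeasurableSet G →
      setFun ℓ {q | (q.1, q.2.2) ∈ G} = Q.real {q | (q.1, q.2.2) ∈ G} := fun G hG =>
    setFun_eq_of_mem Q ℓ hQ _
      (hG.preimage (f := fun q : Ω × X × Y => (q.1, q.2.2)) (by fun_prop))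
      (indicator_sumFun_right hG)
  have hnn := setFun_nonneg ℓ hpos
  have hadd := setFun_add ℓ
  let μX : Measure X := Q.map (fun q => q.2.1)
  let μY : Measure Y := Q.map (fun q => q.2.2)
  have hP' : ∀ A, MeasurableSet A → setFun ℓ (Prod.fst ⁻¹' A) = P.real A := by
    intro A hA
    have h1 := hL (A ×ˢ Set.univ) (hA.prod .univ)
    have h2 : {q : Ω × X × Y | (q.1, q.2.1) ∈ A ×ˢ (Set.univ : Set X)} = Prod.fst ⁻¹' A := by
      ext; simp
    rw [h2] at h1
    rw [h1, Measure.real, ← Measure.fst_apply hA, Measure.fst_compProd, Measure.real]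
  have hX' : ∀ B, MeasurableSet B → setFun ℓ {q | q.2.1 ∈ B} = μX.real B := by
    intro B hB
    have h1 := hL (Set.univ ×ˢ B) (MeasurableSet.univ.prod hB)
    have h2 : {q : Ω × X × Y | (q.1, q.2.1) ∈ (Set.univ : Set Ω) ×ˢ B} = {q | q.2.1 ∈ B} := by
      ext; simp
    rw [h2] at h1
    rw [h1, Measure.real, Measure.real, Measure.map_apply (by fun_prop) hB]
    rfl
  have hY' : ∀ B, MeasurableSet B → setFun ℓ {q | q.2.2 ∈ B} = μY.real B := by
    intro B hB
    have h1 := hR (Set.univ ×ˢ B) (MeasurableSet.univ.prod hB)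
    have h2 : {q : Ω × X × Y | (q.1, q.2.2) ∈ (Set.univ : Set Ω) ×ˢ B} = {q | q.2.2 ∈ B} := by
      ext; simp
    rw [h2] at h1
    rw [h1, Measure.real, Measure.real, Measure.map_apply (by fun_prop) hB]
    rfl
  obtain ⟨halg, ρ, hρ⟩ := exists_measure_rect P (setFun_empty ℓ) hnn hadd μX μY hP' hX' hY'
  have hrect := fun (A : Set Ω) (B : Set X) (C : Set Y) (hA : MeasurableSet A)
    (hB : MeasurableSet B) (hC : MeasurableSet C) => rect_mem hnn hadd μX μY hX' hY' hA hB hC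
  obtain ⟨A, U, V, q, hA, hU, hV, hle, hsup⟩ := exists_rect_rep c hc_cont hc_meas
  have hbound : ∫⁻ t, ENNReal.ofReal (c t.1 t.2.1 t.2.2) ∂ρ ≤ ENNReal.ofReal S := by
    refine lintegral_le_of_sup ℓ hpos ρ (fun t => c t.1 t.2.1 t.2.2)
      (fun t => hc_nonneg _ _ _) S hcost halg hρ (fun n => A n ×ˢ U n ×ˢ V n) q
      (fun n => hrect _ _ _ (hA n) (hU n) (hV n)) (fun n => (hA n).prod ((hU n).prod (hV n)))
      (fun n t ht => hle n _ ht.1 _ ht.2.1 _ ht.2.2) ?_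
    intro t r _ hr
    obtain ⟨n, h1, h2, h3, h4⟩ := hsup t.1 t.2.1 t.2.2 r hr
    exact ⟨n, ⟨h1, h2, h3⟩, h4⟩
  have hcm : Measurable fun q : Ω × X × Y => c q.1 q.2.1 q.2.2 := by
    have := measurable_uncurry_of_continuous_of_measurable
      (u := fun (z : X × Y) (ω : Ω) => c ω z.1 z.2) hc_cont (fun z => hc_meas z.1 z.2)
    exact this.comp measurable_swap
  have hX : ∀ A B, MeasurableSet A → MeasurableSet B →
      ρ (A ×ˢ B ×ˢ Set.univ) = (P ⊗ₘ μ) (A ×ˢ B) := by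
    intro A B hA hB
    rw [hρ _ (hrect _ _ _ hA hB .univ) (hA.prod (hB.prod .univ))]
    have h1 := hL (A ×ˢ B) (hA.prod hB)
    have h2 : {q : Ω × X × Y | (q.1, q.2.1) ∈ A ×ˢ B} = A ×ˢ B ×ˢ Set.univ := by
      ext; simp
    rw [h2] at h1
    rw [h1, ofReal_measureReal, Measure.compProd_apply_prod hA hB,
      Measure.compProd_apply_prod hA (hB.prod .univ)]
    refine lintegral_congr fun ω => ?_
    rw [Kernel.prod_apply, Measure.prod_prod, measure_univ, mul_one]
  have hY : ∀ A B, MeasurableSet A → MeasurableSet B →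
      ρ (A ×ˢ Set.univ ×ˢ B) = (P ⊗ₘ ν) (A ×ˢ B) := by
    intro A B hA hB
    rw [hρ _ (hrect _ _ _ hA .univ hB) (hA.prod (MeasurableSet.univ.prod hB))]
    have h1 := hR (A ×ˢ B) (hA.prod hB)
    have h2 : {q : Ω × X × Y | (q.1, q.2.2) ∈ A ×ˢ B} = A ×ˢ Set.univ ×ˢ B := by
      ext; simp
    rw [h2] at h1
    rw [h1, ofReal_measureReal, Measure.compProd_apply_prod hA hB,
      Measure.compProd_apply_prod hA (MeasurableSet.univ.prod hB)]
    refine lintegral_congr fun ω => ?_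
    rw [Kernel.prod_apply, Measure.prod_prod, measure_univ, one_mul]
  obtain ⟨π, hπ, hπc⟩ := exists_coupling P μ ν c hcm ρ hX hY
  exact (iInf₂_le π hπ).trans (hπc.trans_le hbound)

theorem lintegral_bdd_lt_top {Z : Type*} [MeasurableSpace Z] (P : Measure Ω)
    [IsProbabilityMeasure P] (κ : Kernel Ω Z) [IsMarkovKernel κ] (f : Ω → Z → ℝ) (C : ℝ)
    (hC : ∀ ω z, |f ω z| ≤ C) : ∫⁻ ω, ∫⁻ z, ENNReal.ofReal |f ω z| ∂(κ ω) ∂P < ⊤ := by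
  calc ∫⁻ ω, ∫⁻ z, ENNReal.ofReal |f ω z| ∂(κ ω) ∂P
      ≤ ∫⁻ _, ∫⁻ _, ENNReal.ofReal C ∂(κ _) ∂P :=
        lintegral_mono fun ω => lintegral_mono fun z => ENNReal.ofReal_le_ofReal (hC ω z)
    _ = ENNReal.ofReal C := by simp
    _ < ⊤ := ENNReal.ofReal_lt_top

end strong

/-- **Stochastic Kantorovich duality (L¹ version).**
`C^stoch(c,μ,ν)` equals the supremum of `E( ∫ φ(ω,y) ν_ω(dy) − ∫ ψ(ω,x) μ_ω(dx) )`
over all pairs of jointly measurable functions `ψ : Ω × X → ℝ` with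
`E ∫ |ψ(ω,x)| μ_ω(dx) < ∞` and `φ : Ω × Y → ℝ` with `E ∫ |φ(ω,y)| ν_ω(dy) < ∞`
satisfying `φ(ω,y) − ψ(ω,x) ≤ c(ω,x,y)` everywhere. -/
theorem stochastic_kantorovich_duality
    {Ω X Y : Type*} [MeasurableSpace Ω]
    [TopologicalSpace X] [PolishSpace X] [MeasurableSpace X] [BorelSpace X]
    [TopologicalSpace Y] [PolishSpace Y] [MeasurableSpace Y] [BorelSpace Y]
    (P : Measure Ω) [IsProbabilityMeasure P]
    (μ : Kernel Ω X) [IsMarkovKernel μ] (ν : Kernel Ω Y) [IsMarkovKernel ν]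
    (c : Ω → X → Y → ℝ)
    (hc_nonneg : ∀ ω x y, 0 ≤ c ω x y)
    (hc_cont : ∀ ω, Continuous (fun q : X × Y => c ω q.1 q.2))
    (hc_meas : ∀ x y, Measurable (fun ω => c ω x y))
    (hint : ∫⁻ ω, ∫⁻ q, ENNReal.ofReal (c ω q.1 q.2) ∂((μ ω).prod (ν ω)) ∂P < ⊤) :
    stochCost P c μ ν =
      ⨆ pr : {pr : (Ω → X → ℝ) × (Ω → Y → ℝ) //
          Measurable (fun q : Ω × X => pr.1 q.1 q.2) ∧
          Measurable (fun q : Ω × Y => pr.2 q.1 q.2) ∧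
          (∫⁻ ω, ∫⁻ x, ENNReal.ofReal |pr.1 ω x| ∂(μ ω) ∂P < ⊤) ∧
          (∫⁻ ω, ∫⁻ y, ENNReal.ofReal |pr.2 ω y| ∂(ν ω) ∂P < ⊤) ∧
          ∀ ω x y, pr.2 ω y - pr.1 ω x ≤ c ω x y},
        ENNReal.ofReal
          (∫ ω, ((∫ y, pr.1.2 ω y ∂(ν ω)) - (∫ x, pr.1.1 ω x ∂(μ ω))) ∂P) := by
  have hΩ : Nonempty Ω := nonempty_of_isProbabilityMeasure P
  have hXne : Nonempty X := nonempty_of_isProbabilityMeasure (μ (Classical.arbitrary Ω))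
  have hYne : Nonempty Y := nonempty_of_isProbabilityMeasure (ν (Classical.arbitrary Ω))
  apply le_antisymm
  · set s : ℝ≥0∞ := ⨆ pr : {pr : (Ω → X → ℝ) × (Ω → Y → ℝ) //
          Measurable (fun q : Ω × X => pr.1 q.1 q.2) ∧
          Measurable (fun q : Ω × Y => pr.2 q.1 q.2) ∧
          (∫⁻ ω, ∫⁻ x, ENNReal.ofReal |pr.1 ω x| ∂(μ ω) ∂P < ⊤) ∧
          (∫⁻ ω, ∫⁻ y, ENNReal.ofReal |pr.2 ω y| ∂(ν ω) ∂P < ⊤) ∧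
          ∀ ω x y, pr.2 ω y - pr.1 ω x ≤ c ω x y},
        ENNReal.ofReal
          (∫ ω, ((∫ y, pr.1.2 ω y ∂(ν ω)) - (∫ x, pr.1.1 ω x ∂(μ ω))) ∂P) with hs
    by_cases htop : s = ⊤
    · rw [htop]; exact le_top
    rw [← ENNReal.ofReal_toReal htop]
    refine strong_duality P μ ν c hc_nonneg hc_cont hc_meas _ ?_
    intro h hh hhc
    have hint := sumFun_integrable (P ⊗ₘ (μ ×ₖ ν)) hh
    obtain ⟨ψ, φ, hψ, hφ, ⟨C, hC⟩, ⟨D, hD⟩, rfl⟩ := hh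
    rw [← ENNReal.ofReal_le_iff_le_toReal htop]
    refine le_trans (le_of_eq ?_) (le_iSup _ ⟨(fun ω x => -ψ (ω, x), fun ω y => φ (ω, y)),
      hψ.neg, hφ, ?_, ?_, ?_⟩)
    · congr 1
      rw [Measure.integral_compProd hint]
      refine integral_congr_ae (Eventually.of_forall fun ω => ?_)
      have i1 : Integrable (fun x => ψ (ω, x)) (μ ω) := Integrable.of_bound
        (hψ.comp measurable_prodMk_left).aestronglyMeasurable C
        (Eventually.of_forall fun x => hC _)
      have i2 : Integrable (fun y => φ (ω, y)) (ν ω) := Integrable.of_bound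
        (hφ.comp measurable_prodMk_left).aestronglyMeasurable D
        (Eventually.of_forall fun x => hD _)
      simp only [Kernel.prod_apply]
      rw [integral_add (i1.comp_fst (ν ω)) (i2.comp_snd (μ ω)),
        integral_fun_fst (fun x => ψ (ω, x)), integral_fun_snd (fun y => φ (ω, y)), integral_neg]
      simp
      ring
    · exact lintegral_bdd_lt_top P μ _ C fun ω x => by simpa using hC (ω, x)
    · exact lintegral_bdd_lt_top P ν _ D fun ω y => hD (ω, y)
    · intro ω x y
      have := hhc (ω, x, y)
      simp only at this ⊢
      linarith
  · refine iSup_le ?_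
    rintro ⟨⟨ψ, φ⟩, h1, h2, h3, h4, h5⟩
    refine le_iInf₂ fun π hπ => ?_
    exact weak_duality P μ ν c π hπ.2.1 hπ.2.2 ψ φ h1 h2 h3 h4 h5
end
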